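/- Assume Σ_{x∈ℤ}⟨x⟩^k(|α(x)−α₀| + |θ(x)|) < ∞ with k = 1 if U is generic and k = 2 if U is exceptional. Let P_c be the orthogonal projection of l²(ℤ,ℂ²) onto the orthogonal complement of the closed linear span of all eigenvectors of U. Then there exists a constant C > 0 such that for every t ∈ ℤ and every u₀ ∈ l¹(ℤ,ℂ²) ∩ l²(ℤ,ℂ²), sup_{x∈ℤ} ‖(U^t P_c u₀)(x)‖_{ℂ²} ≤ C·(1+|t|)^{−1/3}·Σ_{x∈ℤ}‖u₀(x)‖_{ℂ²}. -/

import Mathlib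

open Complex Matrix

noncomputable section

/-- The coin matrix `C_{α,β,θ} = e^{iθ}[[β, conj α],[−α, conj β]]`. -/
def coinMat (a b : ℂ) (t : ℝ) : Matrix (Fin 2) (Fin 2) ℂ :=
  Complex.exp ((t : ℂ) * Complex.I) • !![b, (starRingEnd ℂ) a; -a, (starRingEnd ℂ) b]

/-- The quantum walk evolution operator `U = SĈ`, acting on arbitrary `u : ℤ → ℂ²`:
`(Uu)↑(x) = (C(x−1)u(x−1))↑`, `(Uu)↓(x) = (C(x+1)u(x+1))↓`. -/
def qw (C : ℤ → Matrix (Fin 2) (Fin 2) ℂ) (u : ℤ → Fin 2 → ℂ) : ℤ → Fin 2 → ℂ :=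
  fun x => ![(C (x - 1)).mulVec (u (x - 1)) 0, (C (x + 1)).mulVec (u (x + 1)) 1]

/-- `ρ = √(1−|a|²)`. -/
def rho (a : ℂ) : ℝ := Real.sqrt (1 - ‖a‖ ^ 2)

/-- The coin map `x ↦ C_{α(x), ρ(x), θ(x)}`. -/
def coinOf (α : ℤ → ℂ) (θ : ℤ → ℝ) : ℤ → Matrix (Fin 2) (Fin 2) ℂ :=
  fun x => coinMat (α x) ((rho (α x) : ℝ) : ℂ) (θ x)

/-- The transfer matrix `T_λ(x)`. -/
def Tmat (α : ℤ → ℂ) (θ : ℤ → ℝ) (lam : ℂ) (x : ℤ) : Matrix (Fin 2) (Fin 2) ℂ :=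
  (((rho (α x) : ℝ) : ℂ))⁻¹ •
    !![Complex.exp (Complex.I * (lam - (θ x : ℂ))), α x;
       (starRingEnd ℂ) (α x), Complex.exp (-(Complex.I * (lam - (θ x : ℂ))))]

/-- `(J_VE u)(x) = (u↓(x−1), u↑(x))`. -/
def Jve (u : ℤ → Fin 2 → ℂ) : ℤ → Fin 2 → ℂ := fun x => ![u (x - 1) 1, u x 0]

/-- `(J_EV v)(x) = (v↓(x), v↑(x+1))`, the inverse of `J_VE`. -/
def Jev (v : ℤ → Fin 2 → ℂ) : ℤ → Fin 2 → ℂ := fun x => ![v x 1, v (x + 1) 0]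

/-- Determinant of the 2×2 matrix with columns `v, w`. -/
def det2 (v w : Fin 2 → ℂ) : ℂ := v 0 * w 1 - v 1 * w 0

/-- The Euclidean norm on ℂ². -/
def nrm2 (v : Fin 2 → ℂ) : ℝ := Real.sqrt (‖v 0‖ ^ 2 + ‖v 1‖ ^ 2)

/-- Membership in `l²(ℤ, ℂ²)`. -/
def MemL2 (u : ℤ → Fin 2 → ℂ) : Prop := Summable fun x : ℤ => ‖u x 0‖ ^ 2 + ‖u x 1‖ ^ 2

/-- The Japanese bracket `⟨x⟩ = √(1+x²)`. -/
def jp (x : ℤ) : ℝ := Real.sqrt (1 + (x : ℝ) ^ 2)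

/-- `w` is a resonance: a nonzero bounded generalized eigenfunction exists. -/
def IsResonance (α : ℤ → ℂ) (θ : ℤ → ℝ) (w : ℂ) : Prop :=
  ∃ u : ℤ → Fin 2 → ℂ, (∃ x : ℤ, u x ≠ 0) ∧ (∃ M : ℝ, ∀ x : ℤ, nrm2 (u x) ≤ M) ∧
    ∀ x : ℤ, qw (coinOf α θ) u x = w • u x

/-- `U` is generic: no edge point of the essential spectrum is a resonance. -/
def Generic (α₀ : ℂ) (α : ℤ → ℂ) (θ : ℤ → ℝ) : Prop :=
  ∀ lam : ℝ, |Real.cos lam| = rho α₀ →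
    ¬ IsResonance α θ (Complex.exp (Complex.I * (lam : ℂ)))

/-- The Hilbert space `H = l²(ℤ, ℂ²)`. -/
abbrev Hsp : Type := lp (fun _ : ℤ => EuclideanSpace ℂ (Fin 2)) 2

theorem vdc_first {Φ g k : ℝ → ℝ} (hΦ : ∀ x, HasDerivAt Φ (g x) x)
    (hg : ∀ x, HasDerivAt g (k x) x) (hk : Continuous k) {a b ν : ℝ} (hab : a ≤ b) (hν : 0 < ν)
    (hk0 : ∀ x ∈ Set.Icc a b, 0 ≤ k x)
    (h : (∀ x ∈ Set.Icc a b, ν ≤ g x) ∨ (∀ x ∈ Set.Icc a b, g x ≤ -ν)) :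
    ‖∫ x in a..b, Complex.exp (I * (Φ x : ℂ))‖ ≤ 4 / ν := by
  have hgc : Continuous g := continuous_iff_continuousAt.2 fun x => (hg x).continuousAt
  have hΦc : Continuous Φ := continuous_iff_continuousAt.2 fun x => (hΦ x).continuousAt
  have hgν : ∀ x ∈ Set.Icc a b, ν ≤ |g x| := by
    intro x hx
    rcases h with h | h
    · exact (h x hx).trans (le_abs_self _)
    · have := h x hx
      exact le_trans (by linarith) (neg_le_abs _)
  have hg0 : ∀ x ∈ Set.Icc a b, g x ≠ 0 := by
    intro x hx h0
    have := hgν x hx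
    rw [h0, abs_zero] at this
    linarith
  have hinv : ∀ x ∈ Set.Icc a b, |(g x)⁻¹| ≤ ν⁻¹ := by
    intro x hx
    rw [abs_inv]
    exact inv_anti₀ hν (hgν x hx)
  have hE : ∀ x, ‖Complex.exp (I * (Φ x : ℂ))‖ = 1 := by
    intro x
    rw [mul_comm]
    exact Complex.norm_exp_ofReal_mul_I _
  have hu : Set.uIcc a b = Set.Icc a b := Set.uIcc_of_le hab
  have key : ∫ x in a..b, (Complex.exp (I * (Φ x : ℂ)) +
      Complex.exp (I * (Φ x : ℂ)) * (I * ((k x / g x ^ 2 : ℝ) : ℂ)))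
      = Complex.exp (I * (Φ b : ℂ)) * (-I * ((g b)⁻¹ : ℝ)) -
        Complex.exp (I * (Φ a : ℂ)) * (-I * ((g a)⁻¹ : ℝ)) := by
    apply intervalIntegral.integral_eq_sub_of_hasDerivAt
      (f := fun x => Complex.exp (I * (Φ x : ℂ)) * (-I * ((g x)⁻¹ : ℝ)))
    · intro x hx
      rw [hu] at hx
      have h1 : HasDerivAt (fun x => Complex.exp (I * (Φ x : ℂ)))
          (Complex.exp (I * (Φ x : ℂ)) * (I * (g x : ℂ))) x :=
        ((hΦ x).ofReal_comp.const_mul I).cexp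
      have h2 : HasDerivAt (fun x => (((g x)⁻¹ : ℝ) : ℂ)) ((-(k x) / g x ^ 2 : ℝ) : ℂ) x :=
        ((hg x).inv (hg0 x hx)).ofReal_comp
      refine (h1.mul (h2.const_mul (-I))).congr_deriv ?_
      have h3 : (g x : ℂ) ≠ 0 := by exact_mod_cast hg0 x hx
      have h4 : (g x : ℂ) * (g x : ℂ)⁻¹ = 1 := mul_inv_cancel₀ h3
      push_cast
      rw [div_eq_mul_inv, div_eq_mul_inv]
      linear_combination -(Complex.exp (I * (Φ x : ℂ)) * I * I) * h4 - Complex.exp (I * (Φ x : ℂ)) * I_mul_I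
    · apply ContinuousOn.intervalIntegrable
      rw [hu]
      apply ContinuousOn.add
      · fun_prop
      · apply ContinuousOn.mul (by fun_prop)
        apply ContinuousOn.mul (by fun_prop)
        apply Complex.continuous_ofReal.comp_continuousOn
        apply ContinuousOn.div (by fun_prop) (by fun_prop)
        intro x hx
        exact pow_ne_zero _ (hg0 x hx)
  have hint2 : IntervalIntegrable (fun x => k x / g x ^ 2) MeasureTheory.volume a b := by
    apply ContinuousOn.intervalIntegrable
    rw [hu]
    apply ContinuousOn.div (by fun_prop) (by fun_prop)
    intro x hx
    exact pow_ne_zero _ (hg0 x hx)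
  have hint3 : IntervalIntegrable (fun x => Complex.exp (I * (Φ x : ℂ)) *
      (I * ((k x / g x ^ 2 : ℝ) : ℂ))) MeasureTheory.volume a b := by
    apply ContinuousOn.intervalIntegrable
    rw [hu]
    apply ContinuousOn.mul (by fun_prop)
    apply ContinuousOn.mul (by fun_prop)
    apply Complex.continuous_ofReal.comp_continuousOn
    apply ContinuousOn.div (by fun_prop) (by fun_prop)
    intro x hx
    exact pow_ne_zero _ (hg0 x hx)
  rw [intervalIntegral.integral_add (Continuous.intervalIntegrable (by fun_prop) _ _) hint3] at key
  have h4 : ∫ x in a..b, k x / g x ^ 2 = -(g b)⁻¹ - -(g a)⁻¹ := by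
    apply intervalIntegral.integral_eq_sub_of_hasDerivAt (f := fun x => -(g x)⁻¹)
    · intro x hx
      rw [hu] at hx
      refine ((hg x).inv (hg0 x hx)).neg.congr_deriv ?_
      ring
    · exact hint2
  have h5 : ‖∫ x in a..b, Complex.exp (I * (Φ x : ℂ)) * (I * ((k x / g x ^ 2 : ℝ) : ℂ))‖
      ≤ ∫ x in a..b, k x / g x ^ 2 := by
    apply intervalIntegral.norm_integral_le_of_norm_le hab _ hint2
    refine MeasureTheory.ae_of_all _ fun x hx => ?_
    rw [norm_mul, hE, norm_mul, norm_I, Complex.norm_real, Real.norm_eq_abs, abs_of_nonneg]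
    · simp
    · exact div_nonneg (hk0 x ⟨hx.1.le, hx.2⟩) (sq_nonneg _)
  have ha := hinv a ⟨le_rfl, hab⟩
  have hb := hinv b ⟨hab, le_rfl⟩
  have h6 : ∀ x, ‖Complex.exp (I * (Φ x : ℂ)) * (-I * ((g x)⁻¹ : ℝ))‖ = |(g x)⁻¹| := by
    intro x
    rw [norm_mul, hE, norm_mul, norm_neg, norm_I, Complex.norm_real, Real.norm_eq_abs]
    simp
  have h7 := eq_sub_of_add_eq key
  rw [h7]
  refine (norm_sub_le _ _).trans ?_
  have h8 := norm_sub_le (Complex.exp (I * (Φ b : ℂ)) * (-I * ((g b)⁻¹ : ℝ)))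
    (Complex.exp (I * (Φ a : ℂ)) * (-I * ((g a)⁻¹ : ℝ)))
  rw [h6, h6] at h8
  have h9 := neg_le_abs (g b)⁻¹
  have h10 := le_abs_self (g a)⁻¹
  rw [div_eq_mul_inv]
  linarith

theorem vdc_second {Φ g k : ℝ → ℝ} (hΦ : ∀ x, HasDerivAt Φ (g x) x)
    (hg : ∀ x, HasDerivAt g (k x) x) (hk : Continuous k) {a b δ μ : ℝ} (hab : a ≤ b) (hμ : 0 < μ)
    (hδ : 0 < δ) (hk0 : ∀ x ∈ Set.Icc a b, μ ≤ k x) :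
    ‖∫ x in a..b, Complex.exp (I * (Φ x : ℂ))‖ ≤ 8 / (μ * δ) + 2 * δ := by
  have hgc : Continuous g := continuous_iff_continuousAt.2 fun x => (hg x).continuousAt
  have hΦc : Continuous Φ := continuous_iff_continuousAt.2 fun x => (hΦ x).continuousAt
  have hE : ∀ x, ‖Complex.exp (I * (Φ x : ℂ))‖ = 1 := by
    intro x
    rw [mul_comm]
    exact Complex.norm_exp_ofReal_mul_I _
  have hgrow : ∀ x ∈ Set.Icc a b, ∀ y ∈ Set.Icc a b, x ≤ y → μ * (y - x) ≤ g y - g x := by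
    apply Convex.mul_sub_le_image_sub_of_le_deriv (convex_Icc a b) hgc.continuousOn
    · intro x _
      exact (hg x).differentiableAt.differentiableWithinAt
    · intro x hx
      rw [(hg x).deriv]
      exact hk0 x (interior_subset hx)
  obtain ⟨c, hc, hc1, hc2⟩ : ∃ c ∈ Set.Icc a b, (c = a ∨ g c ≤ 0) ∧ (c = b ∨ 0 ≤ g c) := by
    by_cases h1 : 0 ≤ g a
    · exact ⟨a, ⟨le_rfl, hab⟩, Or.inl rfl, Or.inr h1⟩
    by_cases h2 : g b ≤ 0
    · exact ⟨b, ⟨hab, le_rfl⟩, Or.inr h2, Or.inl rfl⟩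
    obtain ⟨c, hc, h3⟩ := intermediate_value_Icc hab hgc.continuousOn
      (show (0 : ℝ) ∈ Set.Icc (g a) (g b) from ⟨(not_le.1 h1).le, (not_le.1 h2).le⟩)
    exact ⟨c, hc, Or.inr h3.le, Or.inr h3.ge⟩
  have hii : ∀ x y, IntervalIntegrable (fun x => Complex.exp (I * (Φ x : ℂ)))
      MeasureTheory.volume x y := fun x y => Continuous.intervalIntegrable (by fun_prop) _ _
  set a' := max a (c - δ)
  set b' := min b (c + δ)
  have h1 : ‖∫ x in a..a', Complex.exp (I * (Φ x : ℂ))‖ ≤ 4 / (μ * δ) := by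
    by_cases hca : a ≤ c - δ
    · have ha' : a' = c - δ := max_eq_right hca
      rw [ha']
      apply vdc_first hΦ hg hk hca (by positivity)
      · intro x hx
        exact hμ.le.trans (hk0 x ⟨hx.1, by linarith [hx.2, hc.2]⟩)
      · right
        intro x hx
        have h2 := hgrow x ⟨hx.1, by linarith [hx.2, hc.2]⟩ c hc (by linarith [hx.2])
        have h3 : g c ≤ 0 := hc1.resolve_left (by linarith)
        have : μ * δ ≤ μ * (c - x) := by gcongr; linarith [hx.2]
        linarith
    · have ha' : a' = a := max_eq_left (not_le.1 hca).le
      rw [ha', intervalIntegral.integral_same, norm_zero]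
      positivity
  have h2 : ‖∫ x in b'..b, Complex.exp (I * (Φ x : ℂ))‖ ≤ 4 / (μ * δ) := by
    by_cases hca : c + δ ≤ b
    · have ha' : b' = c + δ := min_eq_right hca
      rw [ha']
      apply vdc_first hΦ hg hk hca (by positivity)
      · intro x hx
        exact hμ.le.trans (hk0 x ⟨by linarith [hx.1, hc.1], hx.2⟩)
      · left
        intro x hx
        have h2 := hgrow c hc x ⟨by linarith [hx.1, hc.1], hx.2⟩ (by linarith [hx.1])
        have h3 : 0 ≤ g c := hc2.resolve_left (by linarith)
        have : μ * δ ≤ μ * (x - c) := by gcongr; linarith [hx.1]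
        linarith
    · have ha' : b' = b := min_eq_left (not_le.1 hca).le
      rw [ha', intervalIntegral.integral_same, norm_zero]
      positivity
  have h3 : ‖∫ x in a'..b', Complex.exp (I * (Φ x : ℂ))‖ ≤ 2 * δ := by
    have := intervalIntegral.norm_integral_le_of_norm_le_const (a := a') (b := b') (C := 1)
      (f := fun x => Complex.exp (I * (Φ x : ℂ))) (fun x _ => (hE x).le)
    refine this.trans ?_
    have h4 : a' ≤ c := max_le hc.1 (by linarith)
    have h5 : c ≤ b' := le_min hc.2 (by linarith)
    have h6 : c - δ ≤ a' := le_max_right _ _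
    have h7 : b' ≤ c + δ := min_le_right _ _
    rw [abs_of_nonneg (by linarith)]
    linarith
  rw [← intervalIntegral.integral_add_adjacent_intervals (hii a a') (hii a' b),
    ← intervalIntegral.integral_add_adjacent_intervals (hii a' b') (hii b' b)]
  refine (norm_add_le _ _).trans ?_
  have := norm_add_le (∫ x in a'..b', Complex.exp (I * (Φ x : ℂ)))
    (∫ x in b'..b, Complex.exp (I * (Φ x : ℂ)))
  have h8 : 8 / (μ * δ) = 4 / (μ * δ) + 4 / (μ * δ) := by ring
  linarith

theorem norm_integral_exp_neg (Φ : ℝ → ℝ) (a b : ℝ) :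
    ‖∫ x in a..b, Complex.exp (I * ((-Φ x : ℝ) : ℂ))‖ =
      ‖∫ x in a..b, Complex.exp (I * (Φ x : ℂ))‖ := by
  have : ∀ x, Complex.exp (I * ((-Φ x : ℝ) : ℂ)) =
      (starRingEnd ℂ) (Complex.exp (I * (Φ x : ℂ))) := by
    intro x
    rw [← Complex.exp_conj]
    simp
  simp_rw [this]
  rw [intervalIntegral.intervalIntegral_eq_integral_uIoc,
    intervalIntegral.intervalIntegral_eq_integral_uIoc, integral_conj, norm_smul, norm_smul,
    Complex.norm_conj]

/-- The dispersion relation `λ(ξ) = arccos (r cos ξ)`. -/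
def disp (r ξ : ℝ) : ℝ := Real.arccos (r * Real.cos ξ)

/-- `√(1 − r² cos² ξ)`, the sine of the dispersion relation. -/
def sdisp (r ξ : ℝ) : ℝ := Real.sqrt (1 - (r * Real.cos ξ) ^ 2)

section disp
variable {r : ℝ}

theorem one_sub_sq_pos (h0 : 0 < r) (h1 : r < 1) (ξ : ℝ) : 0 < 1 - (r * Real.cos ξ) ^ 2 := by
  have := Real.cos_sq_le_one ξ
  rw [mul_pow]
  nlinarith [sq_nonneg r, sq_nonneg (Real.cos ξ)]

theorem sdisp_pos (h0 : 0 < r) (h1 : r < 1) (ξ : ℝ) : 0 < sdisp r ξ :=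
  Real.sqrt_pos.2 (one_sub_sq_pos h0 h1 ξ)

theorem sdisp_le_one (ξ : ℝ) : sdisp r ξ ≤ 1 := by
  apply Real.sqrt_le_one.2
  nlinarith [sq_nonneg (r * Real.cos ξ)]

theorem sdisp_sq (h0 : 0 < r) (h1 : r < 1) (ξ : ℝ) :
    sdisp r ξ ^ 2 = 1 - (r * Real.cos ξ) ^ 2 :=
  Real.sq_sqrt (one_sub_sq_pos h0 h1 ξ).le

theorem hasDerivAt_sdisp (h0 : 0 < r) (h1 : r < 1) (ξ : ℝ) :
    HasDerivAt (sdisp r) (r ^ 2 * Real.cos ξ * Real.sin ξ / sdisp r ξ) ξ := by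
  have h2 := ((((Real.hasDerivAt_cos ξ).const_mul r).pow 2).const_sub 1).sqrt
    (one_sub_sq_pos h0 h1 ξ).ne'
  refine h2.congr_deriv ?_
  have h3 := (sdisp_pos h0 h1 ξ).ne'
  change _ / (2 * sdisp r ξ) = _
  field_simp
  push_cast
  ring

theorem hasDerivAt_disp (h0 : 0 < r) (h1 : r < 1) (ξ : ℝ) :
    HasDerivAt (disp r) (r * Real.sin ξ / sdisp r ξ) ξ := by
  have h3 := one_sub_sq_pos h0 h1 ξ
  have h4 : r * Real.cos ξ ≠ -1 := fun h => by rw [h] at h3; norm_num at h3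
  have h5 : r * Real.cos ξ ≠ 1 := fun h => by rw [h] at h3; norm_num at h3
  refine ((Real.hasDerivAt_arccos h4 h5).comp ξ
    ((Real.hasDerivAt_cos ξ).const_mul r)).congr_deriv ?_
  change -(1 / sdisp r ξ) * _ = _
  ring

theorem hasDerivAt_disp_deriv (h0 : 0 < r) (h1 : r < 1) (ξ : ℝ) :
    HasDerivAt (fun ξ => r * Real.sin ξ / sdisp r ξ)
      (r * (1 - r ^ 2) * Real.cos ξ / sdisp r ξ ^ 3) ξ := by
  have h3 := (sdisp_pos h0 h1 ξ).ne'
  refine (((Real.hasDerivAt_sin ξ).const_mul r).div (hasDerivAt_sdisp h0 h1 ξ) h3).congr_deriv ?_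
  have h4 := sdisp_sq h0 h1 ξ
  have h5 := Real.sin_sq_add_cos_sq ξ
  field_simp
  rw [h4]
  linear_combination (-(r ^ 2) * Real.cos ξ) * h5

theorem continuous_sdisp (h0 : 0 < r) (h1 : r < 1) : Continuous (sdisp r) :=
  continuous_iff_continuousAt.2 fun x => (hasDerivAt_sdisp h0 h1 x).continuousAt

theorem continuous_disp (h0 : 0 < r) (h1 : r < 1) : Continuous (disp r) :=
  continuous_iff_continuousAt.2 fun x => (hasDerivAt_disp h0 h1 x).continuousAt

theorem osc_pos (h0 : 0 < r) (h1 : r < 1) : ∃ C : ℝ, 0 ≤ C ∧ ∀ t : ℕ, 1 ≤ t → ∀ n : ℤ,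
    ‖∫ ξ in (0 : ℝ)..Real.pi, Complex.exp (I * ((t * disp r ξ + n * ξ : ℝ) : ℂ))‖
      ≤ C * (t : ℝ) ^ (-(1 / 3 : ℝ)) := by
  set m : ℝ := r * (1 - r ^ 2) * (2 / Real.pi) with hm
  have hr2 : 0 < 1 - r ^ 2 := by nlinarith
  have hm0 : 0 < m := by positivity
  refine ⟨2 * (8 / m + 2) + 2, by positivity, fun t ht n => ?_⟩
  have ht1 : (1 : ℝ) ≤ t := by exact_mod_cast ht
  have ht0 : (0 : ℝ) < t := by linarith
  set δ : ℝ := (t : ℝ) ^ (-(1 / 3 : ℝ)) with hδ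
  have hδ0 : 0 < δ := Real.rpow_pos_of_pos ht0 _
  have hδ1 : δ ≤ 1 := Real.rpow_le_one_of_one_le_of_nonpos ht1 (by norm_num)
  have hδ3 : t * δ ^ 3 = 1 := by
    rw [hδ, ← Real.rpow_natCast, ← Real.rpow_mul ht0.le]
    norm_num
    rw [Real.rpow_neg_one]
    field_simp
  set Φ : ℝ → ℝ := fun ξ => t * disp r ξ + n * ξ with hΦ
  have hd1 : ∀ x, HasDerivAt Φ (t * (r * Real.sin x / sdisp r x) + n) x := by
    intro x
    refine (((hasDerivAt_disp h0 h1 x).const_mul (t : ℝ)).add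
      ((hasDerivAt_id x).const_mul (n : ℝ))).congr_deriv ?_
    ring
  have hd2 : ∀ x, HasDerivAt (fun x => t * (r * Real.sin x / sdisp r x) + n)
      (t * (r * (1 - r ^ 2) * Real.cos x / sdisp r x ^ 3)) x := by
    intro x
    exact ((hasDerivAt_disp_deriv h0 h1 x).const_mul (t : ℝ)).add_const _
  have hk : Continuous fun x => t * (r * (1 - r ^ 2) * Real.cos x / sdisp r x ^ 3) := by
    have := continuous_sdisp h0 h1
    apply continuous_const.mul
    apply Continuous.div (by fun_prop) (by fun_prop)
    intro x
    exact pow_ne_zero _ (sdisp_pos h0 h1 x).ne'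
  have hcos : ∀ x c : ℝ, 0 ≤ c → c ≤ Real.cos x →
      r * (1 - r ^ 2) * c ≤ r * (1 - r ^ 2) * Real.cos x / sdisp r x ^ 3 := by
    intro x c hc hx
    rw [le_div_iff₀ (pow_pos (sdisp_pos h0 h1 x) _)]
    have h3 : sdisp r x ^ 3 ≤ 1 := pow_le_one₀ (sdisp_pos h0 h1 x).le (sdisp_le_one x)
    have h4 : r * (1 - r ^ 2) * c ≤ r * (1 - r ^ 2) * Real.cos x := by gcongr
    have h5 : 0 ≤ r * (1 - r ^ 2) * c := by positivity
    nlinarith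
  have hπ := Real.pi_gt_three
  have hsin : 2 / Real.pi * δ ≤ Real.sin δ := Real.mul_le_sin hδ0.le (by linarith)
  have hval : 8 / (t * (m * δ) * δ) + 2 * δ = (8 / m + 2) * δ := by
    have : 8 / (t * (m * δ) * δ) = 8 / m * δ := by
      rw [div_mul_eq_mul_div, div_eq_div_iff (by positivity) (by positivity)]
      linear_combination (-(8 * m)) * hδ3
    rw [this]; ring
  have b1 : ‖∫ ξ in (0 : ℝ)..(Real.pi / 2 - δ), Complex.exp (I * (Φ ξ : ℂ))‖
      ≤ (8 / m + 2) * δ := by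
    rw [← hval]
    apply vdc_second hd1 hd2 hk (by linarith) (by positivity) hδ0
    intro x hx
    have h3 : Real.sin δ ≤ Real.cos x := by
      rw [← Real.cos_pi_div_two_sub]
      exact Real.cos_le_cos_of_nonneg_of_le_pi hx.1 (by linarith) hx.2
    have := hcos x (2 / Real.pi * δ) (by positivity) (hsin.trans h3)
    rw [hm]
    have h6 := mul_le_mul_of_nonneg_left this ht0.le
    linarith
  have b2 : ‖∫ ξ in (Real.pi / 2 + δ)..Real.pi, Complex.exp (I * (Φ ξ : ℂ))‖
      ≤ (8 / m + 2) * δ := by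
    rw [← hval, ← norm_integral_exp_neg]
    apply vdc_second (fun x => (hd1 x).neg) (fun x => (hd2 x).neg) hk.neg (by linarith)
      (by positivity) hδ0
    intro x hx
    have h3 : Real.sin δ ≤ Real.cos (Real.pi - x) := by
      rw [← Real.cos_pi_div_two_sub]
      exact Real.cos_le_cos_of_nonneg_of_le_pi (by linarith [hx.2]) (by linarith)
        (by linarith [hx.1])
    have := hcos (Real.pi - x) (2 / Real.pi * δ) (by positivity) (hsin.trans h3)
    have h7 : sdisp r (Real.pi - x) = sdisp r x := by
      unfold sdisp
      rw [Real.cos_pi_sub]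
      congr 1
      ring
    rw [h7, Real.cos_pi_sub, mul_neg, neg_div] at this
    rw [hm]
    have h6 := mul_le_mul_of_nonneg_left this ht0.le
    linarith
  have b3 : ‖∫ ξ in (Real.pi / 2 - δ)..(Real.pi / 2 + δ), Complex.exp (I * (Φ ξ : ℂ))‖
      ≤ 2 * δ := by
    have := intervalIntegral.norm_integral_le_of_norm_le_const (a := Real.pi / 2 - δ)
      (b := Real.pi / 2 + δ) (C := 1) (f := fun x => Complex.exp (I * (Φ x : ℂ)))
      (fun x _ => by rw [mul_comm]; exact (Complex.norm_exp_ofReal_mul_I _).le)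
    refine this.trans ?_
    rw [abs_of_nonneg (by linarith)]
    linarith
  have hΦc : Continuous Φ := continuous_iff_continuousAt.2 fun x => (hd1 x).continuousAt
  have hii : ∀ x y, IntervalIntegrable (fun x => Complex.exp (I * (Φ x : ℂ)))
      MeasureTheory.volume x y := fun x y => Continuous.intervalIntegrable (by fun_prop) _ _
  change ‖∫ ξ in (0 : ℝ)..Real.pi, Complex.exp (I * (Φ ξ : ℂ))‖ ≤ _
  rw [← intervalIntegral.integral_add_adjacent_intervals (hii 0 (Real.pi / 2 - δ)) (hii _ _),
    ← intervalIntegral.integral_add_adjacent_intervals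
      (hii (Real.pi / 2 - δ) (Real.pi / 2 + δ)) (hii _ _)]
  refine (norm_add_le _ _).trans ?_
  have := norm_add_le (∫ ξ in (Real.pi / 2 - δ)..(Real.pi / 2 + δ), Complex.exp (I * (Φ ξ : ℂ)))
    (∫ ξ in (Real.pi / 2 + δ)..Real.pi, Complex.exp (I * (Φ ξ : ℂ)))
  linarith

/-- The oscillatory integral bound `O(|t|^{-1/3})`, uniform in the frequency `n`. -/
theorem osc_bound (h0 : 0 < r) (h1 : r < 1) : ∃ C : ℝ, 0 ≤ C ∧ ∀ t n : ℤ,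
    ‖∫ ξ in (0 : ℝ)..Real.pi, Complex.exp (I * ((t * disp r ξ + n * ξ : ℝ) : ℂ))‖
      ≤ C * (1 + |(t : ℝ)|) ^ (-(1 / 3 : ℝ)) := by
  obtain ⟨C, hC, h⟩ := osc_pos h0 h1
  refine ⟨max Real.pi (2 * C), le_max_of_le_left Real.pi_pos.le, fun t n => ?_⟩
  have key : ∀ t : ℕ, ∀ n : ℤ, ‖∫ ξ in (0 : ℝ)..Real.pi,
      Complex.exp (I * ((t * disp r ξ + n * ξ : ℝ) : ℂ))‖
      ≤ max Real.pi (2 * C) * (1 + (t : ℝ)) ^ (-(1 / 3 : ℝ)) := by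
    intro t n
    rcases Nat.eq_zero_or_pos t with rfl | ht
    · have := intervalIntegral.norm_integral_le_of_norm_le_const (a := 0)
        (b := Real.pi) (C := 1)
        (f := fun ξ => Complex.exp (I * (((0 : ℕ) * disp r ξ + n * ξ : ℝ) : ℂ)))
        (fun x _ => by rw [mul_comm]; exact (Complex.norm_exp_ofReal_mul_I _).le)
      refine this.trans ?_
      rw [sub_zero, one_mul, abs_of_pos Real.pi_pos]
      simp
    · refine (h t ht n).trans ?_
      have ht1 : (1 : ℝ) ≤ t := by exact_mod_cast ht
      have h2 : (2 * t : ℝ) ^ (-(1 / 3 : ℝ)) ≤ (1 + (t : ℝ)) ^ (-(1 / 3 : ℝ)) :=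
        Real.rpow_le_rpow_of_nonpos (by linarith) (by linarith) (by norm_num)
      rw [Real.mul_rpow (by norm_num) (by linarith)] at h2
      have h3 : (1 / 2 : ℝ) ≤ 2 ^ (-(1 / 3 : ℝ)) := by
        rw [show (1 / 2 : ℝ) = 2 ^ (-1 : ℝ) by rw [Real.rpow_neg_one]; norm_num]
        exact Real.rpow_le_rpow_of_exponent_le (by norm_num) (by norm_num)
      have h4 : 0 < (t : ℝ) ^ (-(1 / 3 : ℝ)) := Real.rpow_pos_of_pos (by linarith) _
      have h5 : (t : ℝ) ^ (-(1 / 3 : ℝ)) ≤ 2 * (1 + (t : ℝ)) ^ (-(1 / 3 : ℝ)) := by nlinarith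
      calc C * (t : ℝ) ^ (-(1 / 3 : ℝ)) ≤ C * (2 * (1 + (t : ℝ)) ^ (-(1 / 3 : ℝ))) := by gcongr
        _ = (2 * C) * (1 + (t : ℝ)) ^ (-(1 / 3 : ℝ)) := by ring
        _ ≤ _ := by gcongr; exact le_max_right _ _
  obtain ⟨m, rfl | rfl⟩ := t.eq_nat_or_neg
  · simpa using key m n
  · have h6 := key m (-n)
    rw [← norm_integral_exp_neg] at h6
    refine le_of_eq_of_le (congrArg norm ?_) (h6.trans_eq (by simp))
    apply intervalIntegral.integral_congr
    intro ξ _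
    simp only
    congr 3
    push_cast
    ring

end disp

/-- A normed class of functions: `N F M` says that `F` belongs to a Banach algebra of functions on
`S`, with norm at most `M`. -/
structure NC {P : Type} (S : Set P) (N : (P → ℂ) → ℝ → Prop) : Prop where
  const : ∀ c : ℂ, N (fun _ => c) ‖c‖
  add : ∀ {F G A B}, N F A → N G B → N (fun p => F p + G p) (A + B)
  mul : ∀ {F G A B}, N F A → N G B → N (fun p => F p * G p) (A * B)
  tsum : ∀ {F : ℕ → P → ℂ} {M : ℕ → ℝ}, (∀ n, N (F n) (M n)) → Summable M →
    N (fun p => ∑' n, F n p) (∑' n, M n)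
  mono : ∀ {F A B}, N F A → A ≤ B → N F B
  congr : ∀ {F G A}, N F A → (∀ p ∈ S, F p = G p) → N G A
  bound : ∀ {F A}, N F A → ∀ p ∈ S, ‖F p‖ ≤ A

namespace NC
variable {P : Type} {S : Set P} {N : (P → ℂ) → ℝ → Prop}

theorem sum {ι : Type} (h : NC S N) (s : Finset ι) {F : ι → P → ℂ} {M : ι → ℝ}
    (hF : ∀ i ∈ s, N (F i) (M i)) : N (fun p => ∑ i ∈ s, F i p) (∑ i ∈ s, M i) := by
  classical
  induction s using Finset.induction_on with
  | empty => simpa using h.const 0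
  | insert a s ha ih =>
    simp only [Finset.sum_insert ha]
    exact h.add (hF a (Finset.mem_insert_self a s))
      (ih fun i hi => hF i (Finset.mem_insert_of_mem hi))

theorem smul (h : NC S N) (c : ℂ) {F A} (hF : N F A) : N (fun p => c * F p) (‖c‖ * A) :=
  h.mul (h.const c) hF

theorem neg (h : NC S N) {F A} (hF : N F A) : N (fun p => -F p) A := by
  have := h.smul (-1) hF
  simpa using this

theorem sub (h : NC S N) {F G A B} (hF : N F A) (hG : N G B) :
    N (fun p => F p - G p) (A + B) := by
  simpa [sub_eq_add_neg] using h.add hF (h.neg hG)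

end NC

/-- Bounded pointwise evaluations and continuity on a set form a normed class. -/
theorem nc_continuousOn {P : Type} [TopologicalSpace P] (S : Set P) :
    NC S (fun F M => 0 ≤ M ∧ ContinuousOn F S ∧ ∀ p ∈ S, ‖F p‖ ≤ M) where
  const c := ⟨norm_nonneg _, continuousOn_const, fun _ _ => le_rfl⟩
  add h1 h2 := ⟨add_nonneg h1.1 h2.1, h1.2.1.add h2.2.1, fun p hp =>
    (norm_add_le _ _).trans (add_le_add (h1.2.2 p hp) (h2.2.2 p hp))⟩
  mul h1 h2 := ⟨mul_nonneg h1.1 h2.1, h1.2.1.mul h2.2.1, fun p hp => by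
    rw [norm_mul]
    exact mul_le_mul (h1.2.2 p hp) (h2.2.2 p hp) (norm_nonneg _) h1.1⟩
  tsum h hM := ⟨tsum_nonneg fun n => (h n).1,
    continuousOn_tsum (fun n => (h n).2.1) hM (fun n p hp => (h n).2.2 p hp), fun p hp =>
      tsum_of_norm_bounded hM.hasSum fun n => (h n).2.2 p hp⟩
  mono h hab := ⟨h.1.trans hab, h.2.1, fun p hp => (h.2.2 p hp).trans hab⟩
  congr h he := ⟨h.1, h.2.1.congr fun p hp => (he p hp).symm, fun p hp => by
    rw [← he p hp]; exact h.2.2 p hp⟩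
  bound h := h.2.2

/-- The character `ξ ↦ e^{inξ}`. -/
def ch (n : ℤ) (ξ : ℝ) : ℂ := Complex.exp (I * ((n * ξ : ℝ) : ℂ))

@[simp] theorem norm_ch (n : ℤ) (ξ : ℝ) : ‖ch n ξ‖ = 1 := by
  rw [ch, mul_comm]; exact Complex.norm_exp_ofReal_mul_I _

@[simp] theorem ch_zero (ξ : ℝ) : ch 0 ξ = 1 := by simp [ch]

theorem ch_ne_zero (n : ℤ) (ξ : ℝ) : ch n ξ ≠ 0 := Complex.exp_ne_zero _

theorem ch_add (m n : ℤ) (ξ : ℝ) : ch (m + n) ξ = ch m ξ * ch n ξ := by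
  rw [ch, ch, ch, ← Complex.exp_add]
  congr 1
  push_cast
  ring

theorem conj_ch (n : ℤ) (ξ : ℝ) : (starRingEnd ℂ) (ch n ξ) = ch (-n) ξ := by
  rw [ch, ch, ← Complex.exp_conj]
  simp

theorem ch_neg_right (n : ℤ) (ξ : ℝ) : ch n (-ξ) = ch (-n) ξ := by
  simp [ch]

@[fun_prop] theorem continuous_ch (n : ℤ) : Continuous (ch n) := by
  unfold ch
  fun_prop

/-- `F` has an absolutely convergent Fourier series, with norm at most `M` in the weighted Wiener
algebra of order `k`. -/
def IsW (k : ℕ) (F : ℝ → ℂ) (M : ℝ) : Prop :=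
  ∃ (ι : Type) (_ : Countable ι) (c : ι → ℂ) (s : ι → ℤ),
    Summable (fun i => ‖c i‖ * (1 + |(s i : ℝ)|) ^ k) ∧
    ∑' i, ‖c i‖ * (1 + |(s i : ℝ)|) ^ k ≤ M ∧
    ∀ ξ : ℝ, F ξ = ∑' i, c i * ch (s i) ξ

namespace IsW
variable {k : ℕ} {F G : ℝ → ℂ} {A B : ℝ}

theorem summable_norm_of {ι : Type} {c : ι → ℂ} {s : ι → ℤ}
    (h : Summable (fun i => ‖c i‖ * (1 + |(s i : ℝ)|) ^ k)) (j : ℕ) (hj : j ≤ k) :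
    Summable (fun i => ‖c i‖ * (1 + |(s i : ℝ)|) ^ j) := by
  refine Summable.of_nonneg_of_le (fun i => by positivity) (fun i => ?_) h
  gcongr
  linarith [abs_nonneg (s i : ℝ)]

theorem summable_norm {ι : Type} {c : ι → ℂ} {s : ι → ℤ}
    (h : Summable (fun i => ‖c i‖ * (1 + |(s i : ℝ)|) ^ k)) : Summable (fun i => ‖c i‖) := by
  simpa using summable_norm_of h 0 (Nat.zero_le _)

theorem summable_char {ι : Type} {c : ι → ℂ} {s : ι → ℤ}
    (h : Summable (fun i => ‖c i‖)) (ξ : ℝ) :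
    Summable fun i => c i * ch (s i) ξ := by
  apply Summable.of_norm
  simpa [norm_mul, norm_ch] using h

theorem mono (h : IsW k F A) (hab : A ≤ B) : IsW k F B := by
  obtain ⟨ι, hι, c, s, h1, h2, h3⟩ := h
  exact ⟨ι, hι, c, s, h1, h2.trans hab, h3⟩

theorem of_le {j : ℕ} (h : IsW k F A) (hj : j ≤ k) : IsW j F A := by
  obtain ⟨ι, hι, c, s, h1, h2, h3⟩ := h
  refine ⟨ι, hι, c, s, summable_norm_of h1 j hj, le_trans ?_ h2, h3⟩
  refine (summable_norm_of h1 j hj).tsum_le_tsum (fun i => ?_) h1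
  gcongr
  linarith [abs_nonneg (s i : ℝ)]

theorem char (c : ℂ) (n : ℤ) :
    IsW k (fun ξ => c * ch n ξ) (‖c‖ * (1 + |(n : ℝ)|) ^ k) :=
  ⟨Unit, inferInstance, fun _ => c, fun _ => n, (hasSum_fintype _).summable, by simp, by simp⟩

theorem const (c : ℂ) : IsW k (fun _ => c) ‖c‖ := by
  simpa using char (k := k) c 0

theorem nonneg (h : IsW k F A) : 0 ≤ A := by
  obtain ⟨ι, hι, c, s, h1, h2, h3⟩ := h
  exact (tsum_nonneg fun i => by positivity).trans h2

theorem bound (h : IsW k F A) (ξ : ℝ) : ‖F ξ‖ ≤ A := by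
  have h' := h.of_le (Nat.zero_le k)
  obtain ⟨ι, hι, c, s, h1, h2, h3⟩ := h'
  rw [h3]
  refine (tsum_of_norm_bounded h1.hasSum fun i => ?_).trans h2
  simp [norm_ch]

theorem add (hF : IsW k F A) (hG : IsW k G B) : IsW k (fun ξ => F ξ + G ξ) (A + B) := by
  obtain ⟨ι, hι, c, s, h1, h2, h3⟩ := hF
  obtain ⟨κ, hκ, d, t, g1, g2, g3⟩ := hG
  have hs : HasSum (fun i => ‖Sum.elim c d i‖ * (1 + |((Sum.elim s t i : ℤ) : ℝ)|) ^ k)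
      (∑' i, ‖c i‖ * (1 + |(s i : ℝ)|) ^ k + ∑' i, ‖d i‖ * (1 + |(t i : ℝ)|) ^ k) := by
    apply HasSum.sum
    · simpa [Function.comp_def] using h1.hasSum
    · simpa [Function.comp_def] using g1.hasSum
  refine ⟨ι ⊕ κ, inferInstance, Sum.elim c d, Sum.elim s t, hs.summable, ?_, fun ξ => ?_⟩
  · rw [hs.tsum_eq]; exact add_le_add h2 g2
  · have : HasSum (fun i => Sum.elim c d i * ch (Sum.elim s t i) ξ)
        (F ξ + G ξ) := by
      apply HasSum.sum
      · rw [h3]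
        simpa [Function.comp_def] using (summable_char (s := s) (summable_norm h1) ξ).hasSum
      · rw [g3]
        simpa [Function.comp_def] using (summable_char (s := t) (summable_norm g1) ξ).hasSum
    exact this.tsum_eq.symm

theorem mul (hF : IsW k F A) (hG : IsW k G B) : IsW k (fun ξ => F ξ * G ξ) (A * B) := by
  have hA := hF.nonneg
  obtain ⟨ι, hι, c, s, h1, h2, h3⟩ := hF
  obtain ⟨κ, hκ, d, t, g1, g2, g3⟩ := hG
  have hprod := h1.mul_of_nonneg g1 (fun i => by positivity) (fun i => by positivity)
  have hle : ∀ z : ι × κ, ‖c z.1 * d z.2‖ * (1 + |((s z.1 + t z.2 : ℤ) : ℝ)|) ^ k ≤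
      (‖c z.1‖ * (1 + |(s z.1 : ℝ)|) ^ k) * (‖d z.2‖ * (1 + |(t z.2 : ℝ)|) ^ k) := by
    intro z
    have : (1 + |((s z.1 + t z.2 : ℤ) : ℝ)|) ≤ (1 + |(s z.1 : ℝ)|) * (1 + |(t z.2 : ℝ)|) := by
      push_cast
      have := abs_add_le (s z.1 : ℝ) (t z.2)
      nlinarith [abs_nonneg (s z.1 : ℝ), abs_nonneg (t z.2 : ℝ)]
    calc _ ≤ ‖c z.1 * d z.2‖ * ((1 + |(s z.1 : ℝ)|) * (1 + |(t z.2 : ℝ)|)) ^ k := by gcongr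
      _ = _ := by rw [norm_mul, mul_pow]; ring
  have hs := Summable.of_nonneg_of_le (fun z => by positivity) hle hprod
  refine ⟨ι × κ, inferInstance, fun z => c z.1 * d z.2, fun z => s z.1 + t z.2, hs, ?_,
    fun ξ => ?_⟩
  · refine (hs.tsum_le_tsum hle hprod).trans ?_
    rw [← h1.tsum_mul_tsum g1 hprod]
    exact mul_le_mul h2 g2 (tsum_nonneg fun i => by positivity) hA
  · have hc := summable_char (s := s) (summable_norm h1) ξ
    have hd := summable_char (s := t) (summable_norm g1) ξ
    simp only
    rw [h3, g3, tsum_mul_tsum_of_summable_norm hc.norm hd.norm]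
    congr 1
    ext z
    rw [ch_add]
    ring

theorem tsum {F : ℕ → ℝ → ℂ} {M : ℕ → ℝ} (h : ∀ n, IsW k (F n) (M n)) (hM : Summable M) :
    IsW k (fun ξ => ∑' n, F n ξ) (∑' n, M n) := by
  choose ι hι c s h1 h2 h3 using h
  have hsm : Summable fun z : Σ n, ι n => ‖c z.1 z.2‖ * (1 + |(s z.1 z.2 : ℝ)|) ^ k := by
    refine (summable_sigma_of_nonneg fun z => by positivity).2 ⟨h1, ?_⟩
    exact Summable.of_nonneg_of_le (fun n => tsum_nonneg fun i => by positivity) h2 hM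
  refine ⟨Σ n, ι n, inferInstance, fun z => c z.1 z.2, fun z => s z.1 z.2, hsm, ?_, fun ξ => ?_⟩
  · rw [hsm.tsum_sigma' h1]
    exact (Summable.of_nonneg_of_le (fun n => tsum_nonneg fun i => by positivity) h2
      hM).tsum_le_tsum h2 hM
  · have hn : Summable fun z : Σ n, ι n => ‖c z.1 z.2‖ := by
      refine Summable.of_nonneg_of_le (fun z => norm_nonneg _) (fun z => ?_) hsm
      exact le_mul_of_one_le_right (norm_nonneg _)
        (one_le_pow₀ (le_add_of_nonneg_right (abs_nonneg _)))
    have := summable_char (c := fun z : Σ n, ι n => c z.1 z.2) (s := fun z => s z.1 z.2) hn ξ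
    have hsc : ∀ n, Summable fun i => c n i * ch (s n i) ξ := fun n =>
      summable_char (c := c n) (s := s n) (summable_norm (k := k) (s := s n) (h1 n)) ξ
    rw [this.tsum_sigma' hsc]
    simp_rw [h3]

theorem conj (hF : IsW k F A) : IsW k (fun ξ => (starRingEnd ℂ) (F ξ)) A := by
  obtain ⟨ι, hι, c, s, h1, h2, h3⟩ := hF
  refine ⟨ι, hι, fun i => (starRingEnd ℂ) (c i), fun i => -s i, by simpa using h1,
    by simpa using h2, fun ξ => ?_⟩
  simp only
  rw [h3, Complex.conj_tsum]
  congr 1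
  ext i
  rw [map_mul, conj_ch]

theorem comp_neg (hF : IsW k F A) : IsW k (fun ξ => F (-ξ)) A := by
  obtain ⟨ι, hι, c, s, h1, h2, h3⟩ := hF
  refine ⟨ι, hι, c, fun i => -s i, by simpa using h1, by simpa using h2, fun ξ => ?_⟩
  simp only
  rw [h3]
  simp only [ch_neg_right]

theorem nc (k : ℕ) {P : Type} (p : ℝ → P) :
    NC (Set.range p) (fun F M => IsW k (F ∘ p) M) where
  const c := const c
  add := add
  mul := mul
  tsum := tsum
  mono := mono
  congr {F G A} h he := by
    have : F ∘ p = G ∘ p := funext fun ξ => he _ ⟨ξ, rfl⟩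
    exact this ▸ h
  bound h := by
    rintro _ ⟨ξ, rfl⟩
    exact h.bound ξ

theorem continuous (h : IsW k F A) : Continuous F := by
  obtain ⟨ι, hι, c, s, h1, h2, h3⟩ := h
  rw [show F = _ from funext h3]
  refine continuous_tsum (fun i => by fun_prop) (summable_norm h1) fun i ξ => ?_
  simp [norm_ch]

end IsW

/-- Iterates of the Volterra equation for the Jost solution. -/
def volt (G : ℕ → ℕ → Matrix (Fin 2) (Fin 2) ℂ) (e : Fin 2 → ℂ) : ℕ → ℕ → Fin 2 → ℂ
  | 0, _ => e
  | k + 1, x => fun i => ∑' n, ∑ j, G n (x + n) i j * volt G e k (x + n + 1) j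

/-- The solution of the Volterra equation. -/
def jost (G : ℕ → ℕ → Matrix (Fin 2) (Fin 2) ℂ) (e : Fin 2 → ℂ) (x : ℕ) (i : Fin 2) : ℂ :=
  ∑' k, volt G e k x i

/-- The weight `exp (2 ∑_{n ≥ x} φ n)`. -/
def vwt (φ : ℕ → ℝ) (x : ℕ) : ℝ := Real.exp (2 * ∑' n, φ (x + n))

section weight
variable {φ : ℕ → ℝ}

theorem summable_shift (hs : Summable φ) (x : ℕ) : Summable fun n => φ (x + n) := by
  simpa only [add_comm] using (summable_nat_add_iff x).2 hs

theorem one_le_vwt (h0 : ∀ n, 0 ≤ φ n) (x : ℕ) : 1 ≤ vwt φ x :=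
  Real.one_le_exp (mul_nonneg zero_le_two (tsum_nonneg fun _ => h0 _))

theorem vwt_step (h0 : ∀ n, 0 ≤ φ n) (hs : Summable φ) (x : ℕ) :
    vwt φ (x + 1) + 2 * (φ x * vwt φ (x + 1)) ≤ vwt φ x := by
  have h1 : ∑' n, φ (x + n) = φ x + ∑' n, φ (x + 1 + n) := by
    rw [(summable_shift hs x).tsum_eq_zero_add]
    simp only [add_zero, add_assoc, add_comm 1]
  have h2 : vwt φ x = Real.exp (2 * φ x) * vwt φ (x + 1) := by
    rw [vwt, vwt, h1, ← Real.exp_add]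
    ring_nf
  have h3 := Real.add_one_le_exp (2 * φ x)
  have h4 := one_le_vwt h0 (x + 1)
  rw [h2]
  nlinarith

theorem vwt_anti (h0 : ∀ n, 0 ≤ φ n) (hs : Summable φ) : Antitone (vwt φ) := by
  refine antitone_nat_of_succ_le fun n => ?_
  have := vwt_step h0 hs n
  have := mul_nonneg (h0 n) (zero_le_one.trans (one_le_vwt h0 (n + 1)))
  linarith

theorem vwt_partial (h0 : ∀ n, 0 ≤ φ n) (hs : Summable φ) (x N : ℕ) :
    ∑ n ∈ Finset.range N, φ (x + n) * vwt φ (x + n + 1) ≤ (vwt φ x - 1) / 2 := by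
  have key : ∑ n ∈ Finset.range N, φ (x + n) * vwt φ (x + n + 1)
      ≤ (vwt φ x - vwt φ (x + N)) / 2 := by
    induction N with
    | zero => simp
    | succ N ih =>
      rw [Finset.sum_range_succ]
      have := vwt_step h0 hs (x + N)
      rw [← add_assoc]
      linarith
  have := one_le_vwt h0 (x + N)
  linarith

theorem vwt_summable (h0 : ∀ n, 0 ≤ φ n) (hs : Summable φ) (x : ℕ) :
    Summable fun n => φ (x + n) * vwt φ (x + n + 1) :=
  summable_of_sum_range_le (fun _ => mul_nonneg (h0 _) (Real.exp_pos _).le)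
    (vwt_partial h0 hs x)

theorem vwt_tsum (h0 : ∀ n, 0 ≤ φ n) (hs : Summable φ) (x : ℕ) :
    ∑' n, φ (x + n) * vwt φ (x + n + 1) ≤ (vwt φ x - 1) / 2 :=
  Real.tsum_le_of_sum_range_le (fun _ => mul_nonneg (h0 _) (Real.exp_pos _).le)
    (vwt_partial h0 hs x)

theorem tendsto_vwt (φ : ℕ → ℝ) : Filter.Tendsto (vwt φ) Filter.atTop (nhds 1) := by
  have h1 := (tendsto_sum_nat_add φ).const_mul 2
  have h2 := (Real.continuous_exp.tendsto _).comp h1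
  simp only [mul_zero, Real.exp_zero] at h2
  refine h2.congr fun x => ?_
  simp only [Function.comp, vwt, add_comm]

end weight

section volt
variable {P : Type} {S : Set P} {N : (P → ℂ) → ℝ → Prop} (hN : NC S N)
  {G : P → ℕ → ℕ → Matrix (Fin 2) (Fin 2) ℂ} {e : P → Fin 2 → ℂ} {φ : ℕ → ℝ} {E : ℝ}
  (h0 : ∀ n, 0 ≤ φ n) (hs : Summable φ) (hE : 0 ≤ E)
  (hG : ∀ n y i j, n ≤ y → N (fun p => G p n y i j) (φ y / 2))
  (he : ∀ i, N (fun p => e p i) E)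
include hN h0 hs hE hG he

theorem volt_bound (k x : ℕ) (i : Fin 2) :
    N (fun p => volt (G p) (e p) k x i) (E * vwt φ x / 2 ^ k) ∧
    N (fun p => volt (G p) (e p) (k + 1) x i) (E * (vwt φ x - 1) / 2 ^ (k + 1)) := by
  have step : ∀ k, (∀ x i, N (fun p => volt (G p) (e p) k x i) (E * vwt φ x / 2 ^ k)) →
      ∀ x i, N (fun p => volt (G p) (e p) (k + 1) x i) (E * (vwt φ x - 1) / 2 ^ (k + 1)) := by
    intro k ih x i
    have h1 : ∀ n, N (fun p => ∑ j, G p n (x + n) i j * volt (G p) (e p) k (x + n + 1) j)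
        (E / 2 ^ k * (φ (x + n) * vwt φ (x + n + 1))) := by
      intro n
      refine hN.mono (hN.sum Finset.univ fun j _ =>
        hN.mul (hG n (x + n) i j (Nat.le_add_left _ _)) (ih (x + n + 1) j)) ?_
      simp only [Finset.sum_const, Finset.card_univ, Fintype.card_fin, nsmul_eq_mul]
      apply le_of_eq
      push_cast
      ring
    refine hN.mono (hN.tsum h1 ((vwt_summable h0 hs x).mul_left _)) ?_
    rw [tsum_mul_left, pow_succ]
    calc _ ≤ E / 2 ^ k * ((vwt φ x - 1) / 2) := by gcongr; exact vwt_tsum h0 hs x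
      _ = _ := by field_simp
  have main : ∀ k x i, N (fun p => volt (G p) (e p) k x i) (E * vwt φ x / 2 ^ k) := by
    intro k
    induction k with
    | zero =>
      intro x i
      refine hN.mono (he i) ?_
      simpa using le_mul_of_one_le_right hE (one_le_vwt h0 x)
    | succ k ih =>
      intro x i
      refine hN.mono (step k ih x i) ?_
      gcongr
      linarith
  exact ⟨main k x i, step k (main k) x i⟩

theorem jost_bound (x : ℕ) (i : Fin 2) :
    N (fun p => jost (G p) (e p) x i) (2 * E * vwt φ 0) := by
  have h1 : HasSum (fun k : ℕ => E * vwt φ x / 2 ^ k) (2 * (E * vwt φ x)) := by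
    have := hasSum_geometric_two.mul_left (E * vwt φ x)
    rw [mul_comm (E * vwt φ x) 2] at this
    refine this.congr_fun fun k => ?_
    simp [div_eq_mul_inv]
  refine hN.mono (hN.tsum (fun k => (volt_bound hN h0 hs hE hG he k x i).1) h1.summable) ?_
  rw [h1.tsum_eq, mul_assoc]
  gcongr
  exact vwt_anti h0 hs (Nat.zero_le x)

theorem summable_volt {p : P} (hp : p ∈ S) (x : ℕ) (i : Fin 2) :
    Summable fun k => volt (G p) (e p) k x i := by
  refine Summable.of_norm_bounded (g := fun k : ℕ => E * vwt φ x * (1 / 2) ^ k)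
    (summable_geometric_two.mul_left _) fun k => ?_
  have := hN.bound (volt_bound hN h0 hs hE hG he k x i).1 p hp
  simpa [div_eq_mul_inv] using this

theorem jost_sub_bound {p : P} (hp : p ∈ S) (x : ℕ) (i : Fin 2) :
    ‖jost (G p) (e p) x i - e p i‖ ≤ E * (vwt φ x - 1) := by
  have h1 := summable_volt hN h0 hs hE hG he hp x i
  rw [jost, h1.tsum_eq_zero_add, volt, add_sub_cancel_left]
  have h2 : HasSum (fun k : ℕ => E * (vwt φ x - 1) / 2 ^ (k + 1)) (E * (vwt φ x - 1)) := by
    have := hasSum_geometric_two.mul_left (E * (vwt φ x - 1) / 2)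
    rw [div_mul_cancel₀ _ two_ne_zero] at this
    refine this.congr_fun fun k => ?_
    simp [div_eq_mul_inv, pow_succ]
    ring
  exact tsum_of_norm_bounded h2 fun k =>
    hN.bound (volt_bound hN h0 hs hE hG he k x i).2 p hp

theorem tendsto_jost {p : P} (hp : p ∈ S) (i : Fin 2) :
    Filter.Tendsto (fun x => jost (G p) (e p) x i) Filter.atTop (nhds (e p i)) := by
  rw [tendsto_iff_norm_sub_tendsto_zero]
  have h1 := ((tendsto_vwt φ).sub_const 1).const_mul E
  rw [sub_self, mul_zero] at h1
  exact squeeze_zero (fun _ => norm_nonneg _)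
    (fun x => jost_sub_bound hN h0 hs hE hG he hp x i) h1

theorem jost_rec {X : P → Matrix (Fin 2) (Fin 2) ℂ}
    (hX : ∀ p n y, G p (n + 1) y = X p * G p n y) {p : P} (hp : p ∈ S)
    (hXe : (X p).mulVec (e p) = e p) (x : ℕ) :
    jost (G p) (e p) x = (X p + G p 0 x).mulVec (jost (G p) (e p) (x + 1)) := by
  have hsv := summable_volt hN h0 hs hE hG he hp
  have hsn : ∀ k x i, Summable fun n =>
      ∑ j, G p n (x + n) i j * volt (G p) (e p) k (x + n + 1) j := by
    intro k x i
    refine Summable.of_norm_bounded (g := fun n => E / 2 ^ k * (φ (x + n) * vwt φ (x + n + 1)))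
      ((vwt_summable h0 hs x).mul_left _) fun n => ?_
    refine (norm_sum_le _ _).trans ?_
    have : ∀ j ∈ Finset.univ, ‖G p n (x + n) i j * volt (G p) (e p) k (x + n + 1) j‖ ≤
        φ (x + n) / 2 * (E * vwt φ (x + n + 1) / 2 ^ k) := fun j _ =>
      hN.bound (hN.mul (hG n (x + n) i j (Nat.le_add_left _ _))
        (volt_bound hN h0 hs hE hG he k (x + n + 1) j).1) p hp
    refine (Finset.sum_le_sum this).trans (le_of_eq ?_)
    simp only [Finset.sum_const, Finset.card_univ, Fintype.card_fin, nsmul_eq_mul]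
    push_cast
    ring
  have hstep : ∀ k i, volt (G p) (e p) (k + 1) x i =
      ∑ j, G p 0 x i j * volt (G p) (e p) k (x + 1) j +
        ∑ l, X p i l * volt (G p) (e p) (k + 1) (x + 1) l := by
    intro k i
    change ∑' n, ∑ j, G p n (x + n) i j * volt (G p) (e p) k (x + n + 1) j = _
    rw [(hsn k x i).tsum_eq_zero_add]
    congr 1
    have h1 : ∀ n, ∑ j, G p (n + 1) (x + (n + 1)) i j *
        volt (G p) (e p) k (x + (n + 1) + 1) j =
        ∑ l, X p i l * ∑ j, G p n (x + 1 + n) l j * volt (G p) (e p) k (x + 1 + n + 1) j := by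
      intro n
      rw [show x + (n + 1) = x + 1 + n by ring, hX]
      simp only [Matrix.mul_apply, Finset.sum_mul, Finset.mul_sum]
      rw [Finset.sum_comm]
      simp only [mul_assoc]
    simp_rw [h1]
    rw [Summable.tsum_finsetSum fun l _ => (hsn k (x + 1) l).mul_left _]
    simp_rw [tsum_mul_left]
    rfl
  ext i
  have hsv1 : ∀ x i, Summable fun k => volt (G p) (e p) (k + 1) x i := fun x i =>
    (summable_nat_add_iff 1).2 (hsv x i)
  have hj : ∀ x i, jost (G p) (e p) x i = e p i + ∑' k, volt (G p) (e p) (k + 1) x i := by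
    intro x i
    rw [jost, (hsv x i).tsum_eq_zero_add, volt]
  have hXi : ∑ l, X p i l * e p l = e p i := congrFun hXe i
  rw [hj]
  simp_rw [hstep]
  rw [Summable.tsum_add (summable_sum fun j _ => (hsv (x + 1) j).mul_left _)
      (summable_sum fun j _ => (hsv1 (x + 1) j).mul_left _),
    Summable.tsum_finsetSum fun j _ => (hsv (x + 1) j).mul_left _,
    Summable.tsum_finsetSum fun j _ => (hsv1 (x + 1) j).mul_left _]
  simp_rw [tsum_mul_left]
  simp only [Matrix.mulVec, dotProduct, Matrix.add_apply, add_mul, Finset.sum_add_distrib]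
  conv_rhs => arg 1; simp only [hj (x + 1), mul_add, Finset.sum_add_distrib]
  rw [hXi]
  change _ = _ + _ + ∑ j, G p 0 x i j * ∑' k, volt (G p) (e p) k (x + 1) j
  ring

end volt

/-- The transfer matrix at spectral parameter `w`. -/
def Tf (a : ℂ) (t : ℝ) (w : ℂ) : Matrix (Fin 2) (Fin 2) ℂ :=
  ((rho a : ℝ) : ℂ)⁻¹ • !![w * exp (-(t * I)), a; (starRingEnd ℂ) a, w⁻¹ * exp (t * I)]

/-- The inverse transfer matrix at spectral parameter `w`. -/
def Ti (a : ℂ) (t : ℝ) (w : ℂ) : Matrix (Fin 2) (Fin 2) ℂ :=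
  ((rho a : ℝ) : ℂ)⁻¹ • !![w⁻¹ * exp (t * I), -a; -(starRingEnd ℂ) a, w * exp (-(t * I))]

theorem rho_pos {a : ℂ} (ha : ‖a‖ < 1) : 0 < rho a := by
  apply Real.sqrt_pos.2
  nlinarith [norm_nonneg a]

theorem rho_sq {a : ℂ} (ha : ‖a‖ < 1) : rho a ^ 2 = 1 - ‖a‖ ^ 2 := by
  apply Real.sq_sqrt
  nlinarith [norm_nonneg a]

theorem rho_le_one (a : ℂ) : rho a ≤ 1 := by
  apply Real.sqrt_le_one.2
  nlinarith [norm_nonneg a]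

theorem rho_lt_one {a : ℂ} (ha : 0 < ‖a‖) : rho a < 1 := by
  rw [rho, Real.sqrt_lt' one_pos]
  nlinarith

theorem rho_neg_conj (a : ℂ) : rho (-(starRingEnd ℂ) a) = rho a := by
  simp [rho]

theorem rho_sq_complex {a : ℂ} (ha : ‖a‖ < 1) :
    ((rho a : ℝ) : ℂ) ^ 2 = 1 - a * (starRingEnd ℂ) a := by
  rw [← ofReal_pow, rho_sq ha, Complex.mul_conj, Complex.normSq_eq_norm_sq]
  push_cast
  ring

theorem Tf_mul_Ti {a : ℂ} (ha : ‖a‖ < 1) (t : ℝ) {w : ℂ} (hw : w ≠ 0) :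
    Tf a t w * Ti a t w = 1 := by
  have h1 := rho_sq_complex ha
  have h2 : ((rho a : ℝ) : ℂ) ≠ 0 := ofReal_ne_zero.2 (rho_pos ha).ne'
  have h3 : exp (t * I) * exp (-(t * I)) = 1 := by rw [← exp_add]; simp
  have h4 : w * w⁻¹ = 1 := mul_inv_cancel₀ hw
  rw [Tf, Ti, smul_mul_smul_comm]
  have h5 : ((rho a : ℝ) : ℂ)⁻¹ * ((rho a : ℝ) : ℂ)⁻¹ * (1 - a * (starRingEnd ℂ) a) = 1 := by
    rw [← h1]; field_simp
  ext i j
  fin_cases i <;> fin_cases j <;>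
    simp only [Matrix.smul_apply, Matrix.mul_apply, Fin.sum_univ_two, smul_eq_mul] <;>
    simp
  · linear_combination h5 + ((rho a : ℝ) : ℂ)⁻¹ * ((rho a : ℝ) : ℂ)⁻¹ *
      (exp (t * I) * exp (-(t * I)) * h4 + h3)
  · ring_nf
    simp
  · ring_nf
    simp
  · linear_combination h5 + ((rho a : ℝ) : ℂ)⁻¹ * ((rho a : ℝ) : ℂ)⁻¹ *
      (exp (t * I) * exp (-(t * I)) * h4 + h3)

theorem Ti_mul_Tf {a : ℂ} (ha : ‖a‖ < 1) (t : ℝ) {w : ℂ} (hw : w ≠ 0) :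
    Ti a t w * Tf a t w = 1 :=
  mul_eq_one_comm.1 (Tf_mul_Ti ha t hw)

/-- The spectral curve: pairs `(w, κ)` with `w + w⁻¹ = r (κ + κ⁻¹)`. -/
def Sg (r : ℝ) : Set (ℂ × ℂ) :=
  {p | p.1 ≠ 0 ∧ p.2 ≠ 0 ∧ ‖p.2‖ ≤ 1 ∧ 1 / 2 ≤ ‖p.1‖ ∧ ‖p.1‖ ≤ 1 ∧
    p.1 + p.1⁻¹ = r * (p.2 + p.2⁻¹)}

/-- A normed class of functions on the spectral curve containing the coordinate functions. -/
structure MC (r : ℝ) (S : Set (ℂ × ℂ)) (N : (ℂ × ℂ → ℂ) → ℝ → Prop) (k : ℕ) (B : ℝ) : Prop where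
  nc : NC S N
  sub : S ⊆ Sg r
  pow : ∀ n : ℕ, N (fun p => p.2 ^ n) ((1 + n) ^ k)
  w : N (fun p => p.1) B
  winv : N (fun p => p.1⁻¹) B
  B_nonneg : 0 ≤ B

/-- The normalized free inverse transfer matrix. -/
def Xm (a₀ : ℂ) (p : ℂ × ℂ) : Matrix (Fin 2) (Fin 2) ℂ := p.2 • Ti a₀ 0 p.1

/-- The perturbation of the normalized inverse transfer matrix. -/
def Ym (a₀ a : ℂ) (t : ℝ) (p : ℂ × ℂ) : Matrix (Fin 2) (Fin 2) ℂ :=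
  p.2 • (Ti a t p.1 - Ti a₀ 0 p.1)

/-- The eigenvector of the free transfer matrix. -/
def ev (a₀ : ℂ) (p : ℂ × ℂ) : Fin 2 → ℂ := ![a₀, rho a₀ * p.2 - p.1]

/-- The size of the perturbation. -/
def pert (a₀ a : ℂ) (t : ℝ) : ℝ :=
  ‖((rho a : ℝ) : ℂ)⁻¹ * exp (t * I) - ((rho a₀ : ℝ) : ℂ)⁻¹‖ +
  ‖((rho a : ℝ) : ℂ)⁻¹ * exp (-(t * I)) - ((rho a₀ : ℝ) : ℂ)⁻¹‖ +
  ‖((rho a : ℝ) : ℂ)⁻¹ * a - ((rho a₀ : ℝ) : ℂ)⁻¹ * a₀‖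

theorem pert_nonneg (a₀ a : ℂ) (t : ℝ) : 0 ≤ pert a₀ a t := by unfold pert; positivity

theorem Xm_mulVec_ev {a₀ : ℂ} (ha : ‖a₀‖ < 1) {p : ℂ × ℂ} (hp : p ∈ Sg (rho a₀)) :
    (Xm a₀ p).mulVec (ev a₀ p) = ev a₀ p := by
  obtain ⟨hw, hk, -, -, -, h⟩ := hp
  have h1 := rho_sq_complex ha
  have h2 : ((rho a₀ : ℝ) : ℂ) ≠ 0 := ofReal_ne_zero.2 (rho_pos ha).ne'
  set r : ℂ := ((rho a₀ : ℝ) : ℂ)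
  have h3 : p.1 * p.1⁻¹ = 1 := mul_inv_cancel₀ hw
  have h4 : p.2 * p.2⁻¹ = 1 := mul_inv_cancel₀ hk
  have h5 : r * r⁻¹ = 1 := mul_inv_cancel₀ h2
  ext i
  fin_cases i
  · simp [Xm, Ti, ev, Matrix.mulVec, dotProduct, Fin.sum_univ_two]
    change p.2 * (r⁻¹ * p.1⁻¹) * a₀ + -(p.2 * (r⁻¹ * a₀) * (r * p.2 - p.1)) = a₀
    linear_combination (a₀ * p.2 * r⁻¹) * h + a₀ * h5 + a₀ * r * r⁻¹ * h4
  · simp [Xm, Ti, ev, Matrix.mulVec, dotProduct, Fin.sum_univ_two]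
    change -(p.2 * (r⁻¹ * (starRingEnd ℂ) a₀) * a₀) + p.2 * (r⁻¹ * p.1) * (r * p.2 - p.1) =
      r * p.2 - p.1
    linear_combination (-(p.2 * p.1 * r⁻¹)) * h - (r⁻¹ * p.2) * h1
      + (p.2 * r⁻¹) * h3 - p.1 * h5 - p.1 * r * r⁻¹ * h4 + r * p.2 * h5

/-- The geometric sums `∑_{j<n} κ^(2 j)`. -/
def hgeo (n : ℕ) (p : ℂ × ℂ) : ℂ := ∑ j ∈ Finset.range n, p.2 ^ (2 * j)

theorem Xm_sq {a₀ : ℂ} (ha : ‖a₀‖ < 1) {p : ℂ × ℂ} (hp : p ∈ Sg (rho a₀)) :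
    Xm a₀ p * Xm a₀ p = (p.2 ^ 2 + 1) • Xm a₀ p - (p.2 ^ 2) • (1 : Matrix (Fin 2) (Fin 2) ℂ) := by
  obtain ⟨hw, hk, -, -, -, h⟩ := hp
  have h1 := rho_sq_complex ha
  have h2 : ((rho a₀ : ℝ) : ℂ) ≠ 0 := ofReal_ne_zero.2 (rho_pos ha).ne'
  set r : ℂ := ((rho a₀ : ℝ) : ℂ)
  have h3 : p.1 * p.1⁻¹ = 1 := mul_inv_cancel₀ hw
  have h4 : p.2 * p.2⁻¹ = 1 := mul_inv_cancel₀ hk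
  have h5 : r * r⁻¹ = 1 := mul_inv_cancel₀ h2
  have hX : Xm a₀ p = !![p.2 * r⁻¹ * p.1⁻¹, -(p.2 * r⁻¹ * a₀);
      -(p.2 * r⁻¹ * (starRingEnd ℂ) a₀), p.2 * r⁻¹ * p.1] := by
    ext i j
    fin_cases i <;> fin_cases j <;> simp [Xm, Ti, r] <;> ring
  have h6 : r⁻¹ * r⁻¹ * (1 - a₀ * (starRingEnd ℂ) a₀) = 1 := by rw [← h1]; field_simp
  have h7 : p.2 * r⁻¹ * (p.1 + p.1⁻¹) = p.2 ^ 2 + 1 := by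
    rw [h]; field_simp
  rw [hX]
  ext i j
  fin_cases i <;> fin_cases j <;>
    simp [Matrix.mul_apply, Fin.sum_univ_two]
  · linear_combination (p.2 * r⁻¹ * p.1⁻¹) * h7 - p.2 ^ 2 * h6 - p.2 ^ 2 * r⁻¹ * r⁻¹ * h3
  · linear_combination (-(p.2 * r⁻¹ * a₀)) * h7
  · linear_combination (-(p.2 * r⁻¹ * (starRingEnd ℂ) a₀)) * h7
  · linear_combination (p.2 * r⁻¹ * p.1) * h7 - p.2 ^ 2 * h6 - p.2 ^ 2 * r⁻¹ * r⁻¹ * h3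

theorem Xm_pow {a₀ : ℂ} (ha : ‖a₀‖ < 1) {p : ℂ × ℂ} (hp : p ∈ Sg (rho a₀)) (n : ℕ) :
    Xm a₀ p ^ n = 1 + hgeo n p • (Xm a₀ p - 1) := by
  induction n with
  | zero => simp [hgeo]
  | succ n ih =>
    have h1 : hgeo (n + 1) p = 1 + p.2 ^ 2 * hgeo n p := by
      rw [hgeo, Finset.sum_range_succ', hgeo, Finset.mul_sum, add_comm]
      congr 1
      refine Finset.sum_congr rfl fun j _ => ?_
      ring
    rw [pow_succ, ih, add_mul, smul_mul_assoc, sub_mul, Xm_sq ha hp, h1]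
    simp only [one_mul]
    ext i j
    simp
    ring

namespace MC
variable {r : ℝ} {S : Set (ℂ × ℂ)} {N : (ℂ × ℂ → ℂ) → ℝ → Prop} {k : ℕ} {B : ℝ}

theorem kappa (h : MC r S N k B) : N (fun p => p.2) (2 ^ k) := by
  have := h.pow 1
  simpa [one_add_one_eq_two] using this

theorem geo (h : MC r S N k B) (n : ℕ) : N (hgeo n) (2 ^ k * (n + 1) ^ (k + 1)) := by
  refine h.nc.mono (h.nc.sum (Finset.range n) fun j _ => h.pow (2 * j)) ?_
  have : ∀ j ∈ Finset.range n, (1 + ((2 * j : ℕ) : ℝ)) ^ k ≤ 2 ^ k * (n + 1) ^ k := by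
    intro j hj
    rw [← mul_pow]
    have : (j : ℝ) + 1 ≤ n := by exact_mod_cast Finset.mem_range.1 hj
    gcongr
    push_cast
    linarith
  refine (Finset.sum_le_sum this).trans ?_
  rw [Finset.sum_const, Finset.card_range, nsmul_eq_mul, pow_succ]
  have h2 : (0 : ℝ) ≤ 2 ^ k * (n + 1) ^ k := by positivity
  nlinarith

variable {a₀ : ℂ}

theorem Xm_entry (h : MC r S N k B) (ha : ‖a₀‖ < 1) (i j : Fin 2) :
    N (fun p => Xm a₀ p i j) (2 ^ k * (rho a₀)⁻¹ * (B + 1)) := by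
  have hr := rho_pos ha
  have hB := h.B_nonneg
  have h1 : ∀ (F : ℂ × ℂ → ℂ) (A : ℝ), N F A → A ≤ B + 1 →
      N (fun p => p.2 * (((rho a₀ : ℝ) : ℂ)⁻¹ * F p)) (2 ^ k * (rho a₀)⁻¹ * (B + 1)) := by
    intro F A hF hA
    refine h.nc.mono (h.nc.mul h.kappa (h.nc.smul _ hF)) ?_
    rw [norm_inv, Complex.norm_real, Real.norm_eq_abs, abs_of_pos hr, mul_assoc]
    gcongr
  fin_cases i <;> fin_cases j
  · simpa [Xm, Ti] using h1 _ _ h.winv (by linarith)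
  · simpa [Xm, Ti] using h1 _ _ (h.nc.neg (h.nc.const a₀)) (by linarith)
  · simpa [Xm, Ti] using h1 _ _ (h.nc.neg (h.nc.const ((starRingEnd ℂ) a₀)))
      (by simp; linarith)
  · simpa [Xm, Ti] using h1 _ _ h.w (by linarith)

theorem Ym_entry (h : MC r S N k B) (a : ℂ) (t : ℝ) (i j : Fin 2) :
    N (fun p => Ym a₀ a t p i j) (2 ^ k * (B + 1) * pert a₀ a t) := by
  have hB := h.B_nonneg
  have h1 : ∀ (c : ℂ) (F : ℂ × ℂ → ℂ) (A : ℝ), N F A → A ≤ B + 1 → ‖c‖ ≤ pert a₀ a t →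
      N (fun p => p.2 * (c * F p)) (2 ^ k * (B + 1) * pert a₀ a t) := by
    intro c F A hF hA hc
    refine h.nc.mono (h.nc.mul h.kappa (h.nc.smul _ hF)) ?_
    calc 2 ^ k * (‖c‖ * A) ≤ 2 ^ k * (‖c‖ * (B + 1)) := by gcongr
      _ ≤ 2 ^ k * (pert a₀ a t * (B + 1)) := by gcongr
      _ = _ := by ring
  have hone : N (fun _ => (1 : ℂ)) 1 := by simpa using h.nc.const 1
  fin_cases i <;> fin_cases j
  · refine h.nc.congr (h1 _ _ _ h.winv (by linarith)
      (show ‖((rho a : ℝ) : ℂ)⁻¹ * exp (t * I) - ((rho a₀ : ℝ) : ℂ)⁻¹‖ ≤ _ from ?_)) ?_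
    · unfold pert; linarith [norm_nonneg (((rho a : ℝ) : ℂ)⁻¹ * exp (-(t * I)) -
        ((rho a₀ : ℝ) : ℂ)⁻¹), norm_nonneg (((rho a : ℝ) : ℂ)⁻¹ * a - ((rho a₀ : ℝ) : ℂ)⁻¹ * a₀)]
    · intro p _
      simp [Ym, Ti]
      left
      ring
  · refine h.nc.congr (h1 _ _ _ hone (by linarith)
      (show ‖-(((rho a : ℝ) : ℂ)⁻¹ * a - ((rho a₀ : ℝ) : ℂ)⁻¹ * a₀)‖ ≤ _ from ?_)) ?_
    · rw [norm_neg]; unfold pert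
      linarith [norm_nonneg (((rho a : ℝ) : ℂ)⁻¹ * exp (-(t * I)) -
        ((rho a₀ : ℝ) : ℂ)⁻¹), norm_nonneg (((rho a : ℝ) : ℂ)⁻¹ * exp (t * I) -
        ((rho a₀ : ℝ) : ℂ)⁻¹)]
    · intro p _
      simp [Ym, Ti]
      left
      ring
  · refine h.nc.congr (h1 _ _ _ hone (by linarith)
      (show ‖-((starRingEnd ℂ) (((rho a : ℝ) : ℂ)⁻¹ * a - ((rho a₀ : ℝ) : ℂ)⁻¹ * a₀))‖ ≤ _
        from ?_)) ?_
    · rw [norm_neg, Complex.norm_conj]; unfold pert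
      linarith [norm_nonneg (((rho a : ℝ) : ℂ)⁻¹ * exp (-(t * I)) -
        ((rho a₀ : ℝ) : ℂ)⁻¹), norm_nonneg (((rho a : ℝ) : ℂ)⁻¹ * exp (t * I) -
        ((rho a₀ : ℝ) : ℂ)⁻¹)]
    · intro p _
      simp [Ym, Ti]
      left
      ring
  · refine h.nc.congr (h1 _ _ _ h.w (by linarith)
      (show ‖((rho a : ℝ) : ℂ)⁻¹ * exp (-(t * I)) - ((rho a₀ : ℝ) : ℂ)⁻¹‖ ≤ _ from ?_)) ?_
    · unfold pert; linarith [norm_nonneg (((rho a : ℝ) : ℂ)⁻¹ * exp (t * I) -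
        ((rho a₀ : ℝ) : ℂ)⁻¹), norm_nonneg (((rho a : ℝ) : ℂ)⁻¹ * a - ((rho a₀ : ℝ) : ℂ)⁻¹ * a₀)]
    · intro p _
      simp [Ym, Ti]
      left
      ring

theorem Xpow_entry (h : MC (rho a₀) S N k B) (ha : ‖a₀‖ < 1) (n : ℕ) (i j : Fin 2) :
    N (fun p => (Xm a₀ p ^ n) i j)
      ((1 + 2 ^ k * (2 ^ k * (rho a₀)⁻¹ * (B + 1) + 1)) * (n + 1) ^ (k + 1)) := by
  have hr := rho_pos ha
  have hB := h.B_nonneg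
  have hone : N (fun _ => (1 : Matrix (Fin 2) (Fin 2) ℂ) i j) 1 := by
    refine h.nc.mono (h.nc.const _) ?_
    rw [Matrix.one_apply]
    split_ifs <;> simp
  refine h.nc.congr (h.nc.mono (h.nc.add hone (h.nc.mul (h.geo n)
    (h.nc.sub (h.Xm_entry ha i j) hone))) ?_) (G := fun p => (Xm a₀ p ^ n) i j) ?_
  · have : (1 : ℝ) ≤ (n + 1) ^ (k + 1) := one_le_pow₀ (by linarith [n.cast_nonneg (α := ℝ)])
    nlinarith
  · intro p hp
    rw [Xm_pow ha (h.sub hp)]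
    simp

end MC

/-- Kernels of the Volterra equation for the walk. -/
def Gm (a₀ : ℂ) (α : ℤ → ℂ) (θ : ℤ → ℝ) (p : ℂ × ℂ) (n y : ℕ) : Matrix (Fin 2) (Fin 2) ℂ :=
  Xm a₀ p ^ n * Ym a₀ (α y) (θ y) p

/-- The normalized Jost solution on the right half-line. -/
def mj (a₀ : ℂ) (α : ℤ → ℂ) (θ : ℤ → ℝ) (p : ℂ × ℂ) (x : ℕ) : Fin 2 → ℂ :=
  jost (Gm a₀ α θ p) (ev a₀ p) x

/-- The continuation of the Jost solution to the left half-line. -/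
def vneg (a₀ : ℂ) (α : ℤ → ℂ) (θ : ℤ → ℝ) (p : ℂ × ℂ) : ℕ → Fin 2 → ℂ
  | 0 => mj a₀ α θ p 0
  | n + 1 => (Ti (α (-(n + 1 : ℕ))) (θ (-(n + 1 : ℕ))) p.1).mulVec (vneg a₀ α θ p n)

/-- The right Jost solution. -/
def vp (a₀ : ℂ) (α : ℤ → ℂ) (θ : ℤ → ℝ) (p : ℂ × ℂ) (x : ℤ) : Fin 2 → ℂ :=
  if 0 ≤ x then p.2 ^ x.toNat • mj a₀ α θ p x.toNat else vneg a₀ α θ p (-x).toNat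

theorem vp_natCast (a₀ : ℂ) (α : ℤ → ℂ) (θ : ℤ → ℝ) (p : ℂ × ℂ) (x : ℕ) :
    vp a₀ α θ p x = p.2 ^ x • mj a₀ α θ p x := by
  simp [vp]

theorem vp_neg (a₀ : ℂ) (α : ℤ → ℂ) (θ : ℤ → ℝ) (p : ℂ × ℂ) (n : ℕ) :
    vp a₀ α θ p (-(n : ℤ)) = vneg a₀ α θ p n := by
  rcases n with _ | n
  · simp [vp, vneg]
  · rw [vp, if_neg (by push_cast; omega)]
    simp

section
variable {a₀ : ℂ} {α : ℤ → ℂ} {θ : ℤ → ℝ} {S : Set (ℂ × ℂ)} {N : (ℂ × ℂ → ℂ) → ℝ → Prop}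
  {k : ℕ} {B : ℝ} (h : MC (rho a₀) S N k B) (ha : ‖a₀‖ < 1)
  (hs : Summable fun y : ℕ => ((y : ℝ) + 1) ^ (k + 1) * pert a₀ (α y) (θ y))
include h ha hs

theorem jost_setup : ∃ (φ : ℕ → ℝ) (E : ℝ), (∀ n, 0 ≤ φ n) ∧ Summable φ ∧ 0 ≤ E ∧
    (∀ n y i j, n ≤ y → N (fun p => Gm a₀ α θ p n y i j) (φ y / 2)) ∧
    ∀ i, N (fun p => ev a₀ p i) E := by
  have hr := rho_pos ha
  have hB := h.B_nonneg
  set CX := 1 + 2 ^ k * (2 ^ k * (rho a₀)⁻¹ * (B + 1) + 1) with hCX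
  have hCX0 : 0 ≤ CX := by positivity
  refine ⟨fun y => 4 * CX * (2 ^ k * (B + 1)) * (((y : ℝ) + 1) ^ (k + 1) * pert a₀ (α y) (θ y)),
    1 + 2 ^ k + B, fun n => ?_, hs.mul_left _, by positivity, ?_, ?_⟩
  · have := pert_nonneg a₀ (α n) (θ n)
    positivity
  · intro n y i j hny
    have hp := pert_nonneg a₀ (α y) (θ y)
    refine h.nc.congr (h.nc.mono (h.nc.sum Finset.univ fun l _ =>
      h.nc.mul (h.Xpow_entry ha n i l) (MC.Ym_entry (a₀ := a₀) h (α y) (θ y) l j)) ?_)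
      (G := fun p => Gm a₀ α θ p n y i j) ?_
    · rw [Finset.sum_const, Finset.card_univ, Fintype.card_fin, nsmul_eq_mul, ← hCX]
      have : (n : ℝ) ≤ y := by exact_mod_cast hny
      calc ((2 : ℕ) : ℝ) * (CX * (n + 1) ^ (k + 1) * (2 ^ k * (B + 1) * pert a₀ (α y) (θ y)))
          ≤ ((2 : ℕ) : ℝ) * (CX * (y + 1) ^ (k + 1) * (2 ^ k * (B + 1) * pert a₀ (α y) (θ y))) := by
            gcongr
        _ = _ := by push_cast; ring
    · intro p _
      rw [Gm, Matrix.mul_apply]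
  · intro i
    fin_cases i
    · refine h.nc.mono (h.nc.const a₀) ?_
      have : (0 : ℝ) ≤ 2 ^ k := by positivity
      linarith
    · refine h.nc.mono (h.nc.sub (h.nc.smul _ h.kappa) h.w) ?_
      rw [Complex.norm_real, Real.norm_eq_abs, abs_of_pos hr]
      have := rho_le_one a₀
      have h2 : (0 : ℝ) ≤ 2 ^ k := by positivity
      nlinarith

theorem mj_bound : ∃ C, 0 ≤ C ∧ ∀ x i, N (fun p => mj a₀ α θ p x i) C := by
  obtain ⟨φ, E, h0, hφ, hE, hG, he⟩ := jost_setup h ha hs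
  exact ⟨_, by unfold vwt; positivity, jost_bound h.nc h0 hφ hE hG he⟩

theorem mj_tendsto {p : ℂ × ℂ} (hp : p ∈ S) (i : Fin 2) :
    Filter.Tendsto (fun x => mj a₀ α θ p x i) Filter.atTop (nhds (ev a₀ p i)) := by
  obtain ⟨φ, E, h0, hφ, hE, hG, he⟩ := jost_setup h ha hs
  exact tendsto_jost h.nc h0 hφ hE hG he hp i

theorem mj_rec {p : ℂ × ℂ} (hp : p ∈ S) (x : ℕ) :
    mj a₀ α θ p x = (p.2 • Ti (α x) (θ x) p.1).mulVec (mj a₀ α θ p (x + 1)) := by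
  obtain ⟨φ, E, h0, hφ, hE, hG, he⟩ := jost_setup h ha hs
  have := jost_rec h.nc h0 hφ hE hG he (X := Xm a₀)
    (fun p n y => by rw [Gm, pow_succ', Matrix.mul_assoc]; rfl) hp
    (Xm_mulVec_ev ha (h.sub hp)) x
  rw [mj, this, Gm, pow_zero, Matrix.one_mul]
  congr 1
  rw [Xm, Ym, ← smul_add, add_sub_cancel]

theorem vp_rec {p : ℂ × ℂ} (hp : p ∈ S) (x : ℤ) :
    vp a₀ α θ p x = (Ti (α x) (θ x) p.1).mulVec (vp a₀ α θ p (x + 1)) := by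
  rcases le_or_gt 0 x with hx | hx
  · lift x to ℕ using hx
    have h1 := vp_natCast a₀ α θ p (x + 1)
    push_cast at h1
    rw [vp_natCast, h1, mj_rec h ha hs hp, Matrix.smul_mulVec, Matrix.mulVec_smul, smul_smul,
      pow_succ]
  · obtain ⟨n, rfl⟩ : ∃ n : ℕ, x = -((n + 1 : ℕ) : ℤ) := ⟨(-x - 1).toNat, by omega⟩
    rw [vp_neg, show -((n + 1 : ℕ) : ℤ) + 1 = -(n : ℤ) by push_cast; ring, vp_neg]
    rfl

theorem vp_bound (x : ℤ) : ∃ C, ∀ i, N (fun p => vp a₀ α θ p x i) C := by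
  obtain ⟨C, hC, hm⟩ := mj_bound h ha hs
  rcases le_or_gt 0 x with hx | hx
  · lift x to ℕ using hx
    refine ⟨(1 + x) ^ k * C, fun i => ?_⟩
    simp only [vp_natCast, Pi.smul_apply, smul_eq_mul]
    exact h.nc.mul (h.pow x) (hm x i)
  · obtain ⟨n, rfl⟩ : ∃ n : ℕ, x = -(n : ℤ) := ⟨(-x).toNat, by omega⟩
    simp only [vp_neg]
    clear hx
    induction n with
    | zero => exact ⟨C, hm 0⟩
    | succ n ih =>
      obtain ⟨D, hD⟩ := ih
      set a := α (-(n + 1 : ℕ))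
      set t := θ (-(n + 1 : ℕ))
      have hD0 : 0 ≤ |D| := abs_nonneg _
      have hB := h.B_nonneg
      have hT : ∀ i j, N (fun p => Ti a t p.1 i j) (‖((rho a : ℝ) : ℂ)⁻¹‖ * (B + ‖a‖)) := by
        have hc1 := h.nc.smul (((rho a : ℝ) : ℂ)⁻¹) (h.nc.mul h.winv (h.nc.const (exp (t * I))))
        have hc2 := h.nc.smul (((rho a : ℝ) : ℂ)⁻¹) (h.nc.mul h.w (h.nc.const (exp (-(t * I)))))
        have he1 : ‖exp (t * I)‖ = 1 := Complex.norm_exp_ofReal_mul_I t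
        have he2 : ‖exp (-(t * I))‖ = 1 := by
          simpa using Complex.norm_exp_ofReal_mul_I (-t)
        rw [he1] at hc1
        rw [he2] at hc2
        intro i j
        fin_cases i <;> fin_cases j
        · exact h.nc.mono hc1 (by gcongr; linarith [norm_nonneg a])
        · exact h.nc.mono (h.nc.smul (((rho a : ℝ) : ℂ)⁻¹) (h.nc.neg (h.nc.const a)))
            (by gcongr; linarith)
        · exact h.nc.mono (h.nc.smul (((rho a : ℝ) : ℂ)⁻¹)
            (h.nc.neg (h.nc.const ((starRingEnd ℂ) a)))) (by rw [Complex.norm_conj]; gcongr; linarith)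
        · exact h.nc.mono hc2 (by gcongr; linarith [norm_nonneg a])
      exact ⟨_, fun i => h.nc.sum Finset.univ fun j _ => h.nc.mul (hT i j) (hD j)⟩

end

/-- Continuous functions on the spectral curve form a class of order `0`. -/
theorem mc_continuousOn (r : ℝ) : MC r (Sg r)
    (fun F M => 0 ≤ M ∧ ContinuousOn F (Sg r) ∧ ∀ p ∈ Sg r, ‖F p‖ ≤ M) 0 2 where
  nc := nc_continuousOn _
  sub := subset_rfl
  pow n := ⟨by simp, by fun_prop, fun p hp => by
    simpa using pow_le_one₀ (norm_nonneg _) hp.2.2.1⟩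
  w := ⟨by simp, by fun_prop, fun p hp => hp.2.2.2.2.1.trans one_le_two⟩
  winv := ⟨by simp, continuousOn_fst.inv₀ fun p hp => hp.1, fun p hp => by
    rw [norm_inv]
    exact inv_le_of_inv_le₀ two_pos (by simpa using hp.2.2.2.1)⟩
  B_nonneg := zero_le_two

theorem ch_pow (n : ℤ) (m : ℕ) (ξ : ℝ) : ch n ξ ^ m = ch (m * n) ξ := by
  rw [ch, ch, ← Complex.exp_nat_mul]
  congr 1
  push_cast
  ring

theorem ch_one_eq (ξ : ℝ) : ch 1 ξ = Real.cos ξ + I * Real.sin ξ := by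
  rw [ch, mul_comm I, Complex.exp_mul_I]
  push_cast
  rw [one_mul]
  ring

theorem ch_neg_one_eq (ξ : ℝ) : ch (-1) ξ = Real.cos ξ - I * Real.sin ξ := by
  rw [← ch_neg_right, ch_one_eq, Real.cos_neg, Real.sin_neg]
  push_cast
  ring

theorem cos_eq_ch (ξ : ℝ) : ((Real.cos ξ : ℝ) : ℂ) = 2⁻¹ * (ch 1 ξ + ch (-1) ξ) := by
  rw [ch_one_eq, ch_neg_one_eq]
  ring

namespace IsW

theorem congr {k : ℕ} {F G : ℝ → ℂ} {A : ℝ} (h : IsW k F A) (hFG : ∀ ξ, F ξ = G ξ) :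
    IsW k G A := by
  rwa [← funext hFG]

theorem ncu (k : ℕ) : NC (Set.univ : Set ℝ) (IsW k) := by
  simpa using nc k (id : ℝ → ℝ)

theorem cos_pow (k n : ℕ) : IsW k (fun ξ => ((Real.cos ξ : ℝ) : ℂ) ^ n) ((1 + n) ^ k) := by
  have hsum := (ncu k).sum (Finset.range (n + 1))
    (F := fun m ξ => ((2⁻¹ : ℂ) ^ n * n.choose m) * ch (m * 1 + (n - m : ℕ) * (-1)) ξ)
    (fun m _ => char (k := k) _ _)
  refine (hsum.congr ?_).mono ?_
  · intro ξ
    change (∑ m ∈ Finset.range (n + 1), _) = ((Real.cos ξ : ℝ) : ℂ) ^ n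
    rw [cos_eq_ch, mul_pow, add_pow, Finset.mul_sum]
    refine Finset.sum_congr rfl fun m _ => ?_
    rw [ch_pow, ch_pow, ch_add]
    ring
  · have h1 : ∀ m ∈ Finset.range (n + 1), ‖((2⁻¹ : ℂ) ^ n * n.choose m)‖ *
        (1 + |((m * 1 + (n - m : ℕ) * (-1) : ℤ) : ℝ)|) ^ k ≤
        ((2⁻¹ : ℝ) ^ n * n.choose m) * (1 + n) ^ k := by
      intro m hm
      have hmn : m ≤ n := Nat.lt_succ_iff.1 (Finset.mem_range.1 hm)
      have hmr : (m : ℝ) ≤ n := by exact_mod_cast hmn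
      have hm0 : (0 : ℝ) ≤ m := m.cast_nonneg
      have h2 : ‖((2⁻¹ : ℂ) ^ n * n.choose m)‖ = (2⁻¹ : ℝ) ^ n * n.choose m := by simp
      rw [h2]
      gcongr
      push_cast [Nat.cast_sub hmn]
      rw [abs_le]
      constructor <;> linarith
    refine (Finset.sum_le_sum h1).trans ?_
    rw [← Finset.sum_mul, ← Finset.mul_sum, ← Nat.cast_sum, Nat.sum_range_choose]
    have h3 : (2⁻¹ : ℝ) ^ n * ((2 ^ n : ℕ) : ℝ) = 1 := by
      push_cast
      rw [← mul_pow]; norm_num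
    rw [h3, one_mul]

theorem of_differentiableOn (k : ℕ) {g : ℂ → ℂ} (hg : DifferentiableOn ℂ g (Metric.ball 0 1))
    {r : ℝ} (h0 : 0 ≤ r) (h1 : r < 1) :
    ∃ M, IsW k (fun ξ => g ((r * Real.cos ξ : ℝ) : ℂ)) M := by
  obtain ⟨R, hrR, hR1⟩ := exists_between h1
  obtain ⟨ρ, hrρ, hρR⟩ := exists_between hrR
  have hρ0 : 0 < ρ := h0.trans_lt hrρ
  lift R to NNReal using (h0.trans hrR.le)
  lift ρ to NNReal using hρ0.le
  have hf := DifferentiableOn.hasFPowerSeriesOnBall (c := 0) (R := R)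
    (hg.mono (Metric.closedBall_subset_ball hR1)) (by exact_mod_cast hρ0.trans hρR)
  set p := cauchyPowerSeries g 0 R
  have hlt : (ρ : ENNReal) < p.radius :=
    lt_of_lt_of_le (by exact_mod_cast hρR) hf.r_le
  obtain ⟨C, hC, hp⟩ := p.norm_mul_pow_le_of_lt_radius hlt
  have hx : r / ρ < 1 := (div_lt_one hρ0).2 hrρ
  have hx0 : 0 ≤ r / ρ := by positivity
  have hs : Summable fun n : ℕ => C * ((1 + (n : ℝ)) ^ k * (r / ρ) ^ n) := by
    refine Summable.mul_left _ ?_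
    have h4 := summable_pow_mul_geometric_of_norm_lt_one (R := ℝ) k (r := r / ρ)
      (by rwa [Real.norm_eq_abs, abs_of_nonneg hx0])
    have h5 := summable_geometric_of_lt_one hx0 hx
    refine Summable.of_nonneg_of_le (fun n => by positivity) (fun n => ?_)
      ((h4.mul_left (2 ^ k)).add (h5.mul_left 1))
    rcases Nat.eq_zero_or_pos n with rfl | hn
    · simp
    · have : (1 : ℝ) ≤ n := by exact_mod_cast hn
      have h6 : (1 + (n : ℝ)) ^ k ≤ 2 ^ k * n ^ k := by
        rw [← mul_pow]; gcongr; linarith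
      have h7 : 0 ≤ (r / ρ) ^ n := by positivity
      nlinarith
  refine ⟨_, congr ((ncu k).tsum
    (F := fun n ξ => (p.coeff n * r ^ n) * ((Real.cos ξ : ℝ) : ℂ) ^ n)
    (fun n => (ncu k).mono ((ncu k).smul _ (cos_pow k n)) ?_) hs) ?_⟩
  · have h8 := hp n
    rw [p.norm_apply_eq_norm_coef] at h8
    have h9 : ‖p.coeff n‖ * r ^ n ≤ C * (r / ρ) ^ n := by
      calc ‖p.coeff n‖ * r ^ n = (‖p.coeff n‖ * ρ ^ n) * (r / ρ) ^ n := by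
            rw [div_pow]; field_simp
        _ ≤ _ := by gcongr
    have h10 : ‖p.coeff n * (r : ℂ) ^ n‖ = ‖p.coeff n‖ * r ^ n := by
      rw [norm_mul, norm_pow, Complex.norm_real, Real.norm_eq_abs, abs_of_nonneg h0]
    rw [h10]
    calc ‖p.coeff n‖ * r ^ n * (1 + (n : ℝ)) ^ k ≤ C * (r / ρ) ^ n * (1 + (n : ℝ)) ^ k := by gcongr
      _ = _ := by ring
  · intro ξ
    have hmem : ((r * Real.cos ξ : ℝ) : ℂ) ∈ Metric.eball (0 : ℂ) R := by
      rw [Metric.eball_coe, mem_ball_zero_iff, Complex.norm_real, Real.norm_eq_abs, abs_mul,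
        abs_of_nonneg h0]
      calc r * |Real.cos ξ| ≤ r * 1 := by gcongr; exact Real.abs_cos_le_one ξ
        _ < R := by linarith
    have h11 := hf.hasSum hmem
    rw [zero_add] at h11
    rw [← h11.tsum_eq]
    refine tsum_congr fun n => ?_
    rw [p.apply_eq_pow_smul_coeff]
    push_cast
    rw [smul_eq_mul]
    ring

end IsW

theorem one_sub_sq_mem_slitPlane {z : ℂ} (hz : z ∈ Metric.ball (0 : ℂ) 1) :
    1 - z ^ 2 ∈ slitPlane := by
  left
  rw [mem_ball_zero_iff] at hz
  have h1 : ‖z ^ 2‖ < 1 := by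
    rw [norm_pow]; exact pow_lt_one₀ (norm_nonneg _) hz two_ne_zero
  have := (abs_lt.1 ((abs_re_le_norm (z ^ 2)).trans_lt h1)).2
  simpa using this

theorem isW_rpow (k : ℕ) (e : ℝ) {r : ℝ} (h0 : 0 < r) (h1 : r < 1) :
    ∃ M, IsW k (fun ξ => (((1 - (r * Real.cos ξ) ^ 2) ^ e : ℝ) : ℂ)) M := by
  obtain ⟨M, hM⟩ := IsW.of_differentiableOn k (g := fun z => (1 - z ^ 2) ^ (e : ℂ))
    (fun z hz => by
      have := one_sub_sq_mem_slitPlane hz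
      exact (DifferentiableAt.cpow_const (f := fun z : ℂ => 1 - z ^ 2) (by fun_prop) this).differentiableWithinAt)
    h0.le h1
  refine ⟨M, IsW.congr hM fun ξ => ?_⟩
  rw [Complex.ofReal_cpow (one_sub_sq_pos h0 h1 ξ).le]
  push_cast
  rfl

theorem isW_sdisp (k : ℕ) {r : ℝ} (h0 : 0 < r) (h1 : r < 1) :
    ∃ M, IsW k (fun ξ => ((sdisp r ξ : ℝ) : ℂ)) M := by
  obtain ⟨M, hM⟩ := isW_rpow k (1 / 2) h0 h1
  refine ⟨M, IsW.congr hM fun ξ => ?_⟩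
  rw [sdisp, Real.sqrt_eq_rpow]

theorem isW_inv_sdisp (k : ℕ) {r : ℝ} (h0 : 0 < r) (h1 : r < 1) :
    ∃ M, IsW k (fun ξ => (((sdisp r ξ)⁻¹ : ℝ) : ℂ)) M := by
  obtain ⟨M, hM⟩ := isW_rpow k (-(1 / 2)) h0 h1
  refine ⟨M, IsW.congr hM fun ξ => ?_⟩
  rw [sdisp, Real.sqrt_eq_rpow, Real.rpow_neg (one_sub_sq_pos h0 h1 ξ).le]

/-- The parametrization of the boundary of the spectral curve; `s = ±1`. -/
def bc (r : ℝ) (s : ℤ) (ξ : ℝ) : ℂ × ℂ := (r * Real.cos ξ + I * s * sdisp r ξ, ch s ξ)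

section
variable {r : ℝ} {s : ℤ}

theorem intCast_sq_of_sign (hs : s = 1 ∨ s = -1) : (s : ℂ) ^ 2 = 1 := by
  rcases hs with rfl | rfl <;> norm_num

theorem bc_conj_mul (h0 : 0 < r) (h1 : r < 1) (hs : s = 1 ∨ s = -1) (ξ : ℝ) :
    (starRingEnd ℂ) (bc r s ξ).1 * (bc r s ξ).1 = 1 := by
  have h2 : ((sdisp r ξ : ℝ) : ℂ) ^ 2 = 1 - (r * Real.cos ξ) ^ 2 := by
    exact_mod_cast congrArg ((↑) : ℝ → ℂ) (sdisp_sq h0 h1 ξ)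
  simp only [bc, map_add, map_mul, conj_ofReal, conj_I, map_intCast]
  linear_combination ((s : ℂ) ^ 2 * (sdisp r ξ : ℂ) ^ 2) * (-I_sq) + h2 +
    (sdisp r ξ : ℂ) ^ 2 * (intCast_sq_of_sign hs)

theorem norm_bc_fst (h0 : 0 < r) (h1 : r < 1) (hs : s = 1 ∨ s = -1) (ξ : ℝ) :
    ‖(bc r s ξ).1‖ = 1 := by
  have := congrArg norm (bc_conj_mul h0 h1 hs ξ)
  rw [norm_mul, norm_conj, norm_one] at this
  nlinarith [norm_nonneg (bc r s ξ).1]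

theorem bc_fst_inv (h0 : 0 < r) (h1 : r < 1) (hs : s = 1 ∨ s = -1) (ξ : ℝ) :
    (bc r s ξ).1⁻¹ = (starRingEnd ℂ) (bc r s ξ).1 :=
  (eq_inv_of_mul_eq_one_left (bc_conj_mul h0 h1 hs ξ)).symm

theorem bc_mem (h0 : 0 < r) (h1 : r < 1) (hs : s = 1 ∨ s = -1) (ξ : ℝ) : bc r s ξ ∈ Sg r := by
  have h2 := norm_bc_fst h0 h1 hs ξ
  refine ⟨fun h => by rw [h] at h2; simp at h2, ch_ne_zero _ _, (norm_ch _ _).le, by rw [h2]; norm_num,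
    h2.le, ?_⟩
  rw [bc_fst_inv h0 h1 hs]
  have h3 : (ch s ξ)⁻¹ = (starRingEnd ℂ) (ch s ξ) := by
    rw [conj_ch]
    apply inv_eq_of_mul_eq_one_left
    rw [← ch_add]; simp
  change _ = (r : ℂ) * (ch s ξ + (ch s ξ)⁻¹)
  rw [h3]
  have h4 : ch s ξ + (starRingEnd ℂ) (ch s ξ) = 2 * Real.cos ξ := by
    rw [conj_ch, cos_eq_ch]
    rcases hs with rfl | rfl
    · ring
    · rw [neg_neg]; ring
  rw [h4]
  simp only [bc, map_add, map_mul, conj_ofReal, conj_I, map_intCast]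
  ring

theorem bc_fst_eq_exp (h0 : 0 < r) (h1 : r < 1) (hs : s = 1 ∨ s = -1) (ξ : ℝ) :
    (bc r s ξ).1 = exp (I * ((s * disp r ξ : ℝ) : ℂ)) := by
  have h2 := one_sub_sq_pos h0 h1 ξ
  have hc : Real.cos (disp r ξ) = r * Real.cos ξ := by
    rw [disp, Real.cos_arccos] <;> nlinarith
  have hsn : Real.sin (disp r ξ) = sdisp r ξ := Real.sin_arccos _
  rw [mul_comm I, Complex.exp_mul_I, ← ofReal_cos, ← ofReal_sin]
  rcases hs with rfl | rfl
  · simp only [bc, Int.cast_one, one_mul, hc, hsn]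
    push_cast; ring
  · simp only [bc, Int.cast_neg, Int.cast_one, neg_mul, one_mul, Real.cos_neg, Real.sin_neg, hc,
      hsn]
    push_cast; ring

/-- The weighted Wiener algebra on the boundary of the spectral curve. -/
theorem mc_isW (h0 : 0 < r) (h1 : r < 1) (hs : s = 1 ∨ s = -1) (k : ℕ) :
    ∃ B, MC r (Set.range (bc r s)) (fun F M => IsW k (F ∘ bc r s) M) k B := by
  obtain ⟨M, hM⟩ := isW_sdisp k h0 h1
  have hc : IsW k (fun ξ => (r : ℂ) * ((Real.cos ξ : ℝ) : ℂ) ^ 1) _ :=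
    (IsW.ncu k).smul r (IsW.cos_pow k 1)
  have hw := hc.add ((IsW.ncu k).smul (I * s) hM)
  have hw' : IsW k (fun ξ => (bc r s ξ).1) _ := IsW.congr hw fun ξ => by
    simp [bc]
  refine ⟨_, IsW.nc k _, ?_, fun n => ?_, hw', ?_, hw'.nonneg⟩
  · rintro _ ⟨ξ, rfl⟩
    exact bc_mem h0 h1 hs ξ
  · refine (IsW.ncu k).congr ((IsW.char (k := k) 1 (n * s)).mono (le_of_eq ?_)) fun ξ _ => ?_
    · rcases hs with rfl | rfl <;> simp
    · change 1 * ch (n * s) ξ = ch s ξ ^ n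
      rw [ch_pow, one_mul]
  · refine IsW.congr hw'.conj fun ξ => ?_
    exact (bc_fst_inv h0 h1 hs ξ).symm

end

theorem one_le_jp (x : ℤ) : 1 ≤ jp x := by
  rw [jp, Real.one_le_sqrt]
  nlinarith [sq_nonneg (x : ℝ)]

theorem abs_add_one_le_jp (x : ℤ) : |(x : ℝ)| + 1 ≤ 2 * jp x := by
  have h1 := one_le_jp x
  have h2 : |(x : ℝ)| ≤ jp x := by
    rw [jp]
    apply Real.le_sqrt_of_sq_le
    rw [sq_abs]; linarith
  linarith

theorem norm_inv_sub_inv_le {a b D : ℝ} (ha : 0 < a) (hb : 0 < b) (hD : a⁻¹ ≤ D) :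
    |a⁻¹ - b⁻¹| ≤ D * b⁻¹ * |a - b| := by
  have : a⁻¹ - b⁻¹ = a⁻¹ * b⁻¹ * (b - a) := by field_simp
  rw [this, abs_mul, abs_of_pos (by positivity : 0 < a⁻¹ * b⁻¹), abs_sub_comm]
  gcongr

theorem abs_rho_sub_le {a b : ℂ} (ha : ‖a‖ < 1) (hb : ‖b‖ < 1) :
    |rho a - rho b| ≤ 2 * (rho b)⁻¹ * ‖a - b‖ := by
  have h1 := rho_pos ha
  have h2 := rho_pos hb
  have h3 : (rho a - rho b) * (rho a + rho b) = (‖b‖ - ‖a‖) * (‖b‖ + ‖a‖) := by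
    linear_combination rho_sq ha - rho_sq hb
  have h4 : |rho a - rho b| * (rho a + rho b) = |‖b‖ - ‖a‖| * (‖b‖ + ‖a‖) := by
    have := congrArg abs h3
    rwa [abs_mul, abs_mul, abs_of_pos (by linarith : 0 < rho a + rho b),
      abs_of_nonneg (by positivity : 0 ≤ ‖b‖ + ‖a‖)] at this
  have h5 : |‖b‖ - ‖a‖| ≤ ‖a - b‖ := by
    rw [norm_sub_rev]; exact abs_norm_sub_norm_le b a
  have h6 : |rho a - rho b| * rho b ≤ 2 * ‖a - b‖ := by
    have h7 : |‖b‖ - ‖a‖| * (‖b‖ + ‖a‖) ≤ ‖a - b‖ * 2 := by gcongr; linarith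
    nlinarith [abs_nonneg (rho a - rho b)]
  rw [mul_right_comm, ← div_eq_mul_inv, le_div_iff₀ h2]
  exact h6

theorem norm_exp_mul_I_sub_one_le (t : ℝ) : ‖exp (t * I) - 1‖ ≤ |t| := by
  have := Real.norm_exp_I_mul_ofReal_sub_one_le (x := t)
  rwa [mul_comm I, Real.norm_eq_abs] at this

theorem pert_le {a₀ a : ℂ} {t D : ℝ} (ha₀ : ‖a₀‖ < 1) (ha : ‖a‖ < 1) (hD : (rho a)⁻¹ ≤ D) :
    pert a₀ a t ≤ (3 * (D * (rho a₀)⁻¹ * (2 * (rho a₀)⁻¹)) + 2 * D) * (‖a - a₀‖ + |t|) := by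
  have h1 := rho_pos ha
  have h0 := rho_pos ha₀
  have hD0 : 0 < D := (inv_pos.2 h1).trans_le hD
  set R := D * (rho a₀)⁻¹ * (2 * (rho a₀)⁻¹ * ‖a - a₀‖) with hR
  have h2 : ‖((rho a : ℝ) : ℂ)⁻¹ - ((rho a₀ : ℝ) : ℂ)⁻¹‖ ≤ R := by
    rw [← ofReal_inv, ← ofReal_inv, ← ofReal_sub, Complex.norm_real, Real.norm_eq_abs]
    refine (norm_inv_sub_inv_le h1 h0 hD).trans ?_
    rw [hR]
    have h10 := abs_rho_sub_le ha ha₀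
    gcongr
  have h3 : ‖((rho a : ℝ) : ℂ)⁻¹‖ ≤ D := by
    rwa [← ofReal_inv, Complex.norm_real, Real.norm_eq_abs, abs_of_pos (inv_pos.2 h1)]
  have hR0 : 0 ≤ R := by positivity
  have h4 : ∀ e : ℂ, ‖e - 1‖ ≤ |t| →
      ‖((rho a : ℝ) : ℂ)⁻¹ * e - ((rho a₀ : ℝ) : ℂ)⁻¹‖ ≤ D * |t| + R := by
    intro e he
    rw [show ((rho a : ℝ) : ℂ)⁻¹ * e - ((rho a₀ : ℝ) : ℂ)⁻¹ = ((rho a : ℝ) : ℂ)⁻¹ * (e - 1) +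
      (((rho a : ℝ) : ℂ)⁻¹ - ((rho a₀ : ℝ) : ℂ)⁻¹) by ring]
    refine (norm_add_le _ _).trans ?_
    rw [norm_mul]
    gcongr
  have h5 : ‖((rho a : ℝ) : ℂ)⁻¹ * a - ((rho a₀ : ℝ) : ℂ)⁻¹ * a₀‖ ≤ D * ‖a - a₀‖ + R := by
    rw [show ((rho a : ℝ) : ℂ)⁻¹ * a - ((rho a₀ : ℝ) : ℂ)⁻¹ * a₀ = ((rho a : ℝ) : ℂ)⁻¹ * (a - a₀) +
      (((rho a : ℝ) : ℂ)⁻¹ - ((rho a₀ : ℝ) : ℂ)⁻¹) * a₀ by ring]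
    refine (norm_add_le _ _).trans ?_
    rw [norm_mul, norm_mul]
    gcongr
    calc _ ≤ R * 1 := by gcongr
      _ = R := mul_one R
  have h6 := h4 _ (norm_exp_mul_I_sub_one_le t)
  have h7 := h4 (exp (-(t * I))) (by
    have := norm_exp_mul_I_sub_one_le (-t)
    rw [abs_neg] at this
    push_cast at this
    rwa [neg_mul] at this)
  have h8 : R = D * (rho a₀)⁻¹ * (2 * (rho a₀)⁻¹) * ‖a - a₀‖ := by rw [hR]; ring
  have h9 : 0 ≤ D * (rho a₀)⁻¹ * (2 * (rho a₀)⁻¹) * |t| := by positivity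
  unfold pert
  nlinarith [norm_nonneg (a - a₀), abs_nonneg t]

theorem summable_pert {a₀ : ℂ} {α : ℤ → ℂ} {θ : ℤ → ℝ} (ha₀ : ‖a₀‖ < 1) (hα : ∀ x, ‖α x‖ < 1)
    {m : ℕ} (hs : Summable fun x : ℤ => jp x ^ m * (‖α x - a₀‖ + |θ x|)) :
    Summable fun x : ℤ => (|(x : ℝ)| + 1) ^ m * pert a₀ (α x) (θ x) := by
  have hle : ∀ x : ℤ, ‖α x - a₀‖ ≤ jp x ^ m * (‖α x - a₀‖ + |θ x|) := fun x => by
    have h1 := one_le_pow₀ (one_le_jp x) (n := m)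
    nlinarith [norm_nonneg (α x - a₀), abs_nonneg (θ x)]
  have h1 : Filter.Tendsto α Filter.cofinite (nhds a₀) := by
    rw [tendsto_iff_norm_sub_tendsto_zero]
    exact squeeze_zero (fun _ => norm_nonneg _) hle hs.tendsto_cofinite_zero
  have hcont : Continuous rho := by unfold rho; fun_prop
  have h2 : Filter.Tendsto (fun x => (rho (α x))⁻¹) Filter.cofinite (nhds (rho a₀)⁻¹) :=
    ((hcont.tendsto a₀).comp h1).inv₀ (rho_pos ha₀).ne'
  obtain ⟨D, hD⟩ := h2.bddAbove_range_of_cofinite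
  have hD' : ∀ x, (rho (α x))⁻¹ ≤ D := fun x => hD ⟨x, rfl⟩
  have hD0 : 0 < D := (inv_pos.2 (rho_pos (hα 0))).trans_le (hD' 0)
  have h0 := rho_pos ha₀
  refine Summable.of_nonneg_of_le (fun x => mul_nonneg (by positivity) (pert_nonneg _ _ _))
    (fun x => ?_) (hs.mul_left (2 ^ m * (3 * (D * (rho a₀)⁻¹ * (2 * (rho a₀)⁻¹)) + 2 * D)))
  have h3 := abs_add_one_le_jp x
  have hj := one_le_jp x
  calc (|(x : ℝ)| + 1) ^ m * pert a₀ (α x) (θ x)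
      ≤ (2 * jp x) ^ m * ((3 * (D * (rho a₀)⁻¹ * (2 * (rho a₀)⁻¹)) + 2 * D) *
        (‖α x - a₀‖ + |θ x|)) := by
        gcongr
        · exact pert_nonneg _ _ _
        · exact pert_le ha₀ (hα x) (hD' x)
    _ = _ := by rw [mul_pow]; ring

theorem summable_pert_nat {a₀ : ℂ} {α : ℤ → ℂ} {θ : ℤ → ℝ} {m : ℕ}
    (hs : Summable fun x : ℤ => (|(x : ℝ)| + 1) ^ m * pert a₀ (α x) (θ x)) :
    Summable fun y : ℕ => ((y : ℝ) + 1) ^ m * pert a₀ (α y) (θ y) := by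
  refine (hs.comp_injective Nat.cast_injective).congr fun y => ?_
  simp

theorem fourier_two_pi (n : ℤ) (x : ℝ) : (fourier n) (x : AddCircle (2 * Real.pi)) = ch n x := by
  rw [fourier_coe_apply, ch]
  congr 1
  have : (Real.pi : ℂ) ≠ 0 := ofReal_ne_zero.2 Real.pi_ne_zero
  push_cast
  field_simp

/-- Continuously differentiable periodic functions have absolutely convergent Fourier series. -/
theorem isW_of_hasDerivAt {f f' : ℝ → ℂ} {A B : ℝ} (hf : ∀ x, HasDerivAt f (f' x) x)
    (hc : Continuous f') (hp : Function.Periodic f (2 * Real.pi)) (hA : ∀ x, ‖f x‖ ≤ A)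
    (hB : ∀ x, ‖f' x‖ ≤ B) (hB0 : 0 < B) :
    IsW 0 f (A + 2⁻¹ * (B * (1 + ∑' n : ℤ, 1 / (n : ℝ) ^ 2))) := by
  have hT := Real.two_pi_pos
  have : Fact (0 < 2 * Real.pi) := ⟨hT⟩
  set K := ∑' n : ℤ, 1 / (n : ℝ) ^ 2
  have hK : Summable fun n : ℤ => 1 / (n : ℝ) ^ 2 := Real.summable_one_div_int_pow.2 (by norm_num)
  have hfc : Continuous f := continuous_iff_continuousAt.2 fun x => (hf x).continuousAt
  set c := fun n => fourierCoeffOn hT f n with hcdef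
  set d := fun n => fourierCoeffOn hT f' n with hddef
  have hL2 : MeasureTheory.MemLp f' 2
      (MeasureTheory.volume.restrict (Set.Ioc 0 (2 * Real.pi))) :=
    MeasureTheory.MemLp.of_bound hc.aestronglyMeasurable B (Filter.Eventually.of_forall hB)
  have hd := hasSum_sq_fourierCoeffOn hT hL2
  have hd2 : ∑' n, ‖d n‖ ^ 2 ≤ B ^ 2 := by
    rw [hd.tsum_eq, sub_zero, smul_eq_mul, inv_mul_le_iff₀ hT]
    have := intervalIntegral.integral_mono_on (μ := MeasureTheory.volume) hT.le
      ((hc.norm.pow 2).intervalIntegrable 0 (2 * Real.pi))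
      (continuous_const.intervalIntegrable 0 (2 * Real.pi) (u := fun _ => B ^ 2)) (fun x _ =>
        pow_le_pow_left₀ (norm_nonneg _) (hB x) 2)
    simpa using this
  have hcn : ∀ n : ℤ, n ≠ 0 → ‖c n‖ = ‖d n‖ * (1 / |(n : ℝ)|) := by
    intro n hn
    have h1 := fourierCoeffOn_of_hasDerivAt hT hn (fun x _ => hf x) (hc.intervalIntegrable _ _)
    have h2 : f (2 * Real.pi) - f 0 = 0 := by
      have := hp 0
      rw [zero_add] at this
      rw [this, sub_self]
    have hpi : (Real.pi : ℂ) ≠ 0 := ofReal_ne_zero.2 Real.pi_ne_zero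
    have hn' : (n : ℂ) ≠ 0 := Int.cast_ne_zero.2 hn
    have h3 : c n = d n * (1 / (I * n)) := by
      rw [hcdef]
      simp only []
      rw [h1, h2]
      push_cast
      field_simp
      ring
    rw [h3, norm_mul, norm_div, norm_mul, norm_I, norm_one, one_mul, Complex.norm_intCast]
  have hc0 : ‖c 0‖ ≤ A := by
    rw [hcdef]
    simp only []
    rw [fourierCoeffOn_eq_integral]
    have h1 : ‖∫ x in (0 : ℝ)..2 * Real.pi,
        (fourier (-0)) (x : AddCircle (2 * Real.pi - 0)) • f x‖ ≤ A * |2 * Real.pi - 0| := by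
      apply intervalIntegral.norm_integral_le_of_norm_le_const
      intro x _
      rw [neg_zero, fourier_zero, one_smul]
      exact hA x
    rw [norm_smul, Real.norm_eq_abs, sub_zero, abs_of_pos (by positivity)]
    rw [sub_zero, abs_of_pos hT] at h1
    calc _ ≤ 1 / (2 * Real.pi) * (A * (2 * Real.pi)) := by gcongr
      _ = A := by field_simp
  have hA0 : 0 ≤ A := (norm_nonneg _).trans hc0
  have hmaj : ∀ n, ‖c n‖ ≤ (if n = 0 then A else 0) +
      2⁻¹ * (B⁻¹ * ‖d n‖ ^ 2 + B * (1 / (n : ℝ) ^ 2)) := by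
    intro n
    split_ifs with hn
    · rw [hn]
      have : 0 ≤ 2⁻¹ * (B⁻¹ * ‖d 0‖ ^ 2 + B * (1 / ((0 : ℤ) : ℝ) ^ 2)) := by positivity
      linarith
    · rw [hcn n hn]
      have h1 : (1 / |(n : ℝ)|) ^ 2 = 1 / (n : ℝ) ^ 2 := by rw [div_pow, sq_abs, one_pow]
      rw [← h1]
      have h2 : 2⁻¹ * (B⁻¹ * ‖d n‖ ^ 2 + B * (1 / |(n : ℝ)|) ^ 2) - ‖d n‖ * (1 / |(n : ℝ)|) =
        2⁻¹ * B⁻¹ * (‖d n‖ - B * (1 / |(n : ℝ)|)) ^ 2 := by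
        field_simp
        ring
      have h3 : 0 ≤ 2⁻¹ * B⁻¹ * (‖d n‖ - B * (1 / |(n : ℝ)|)) ^ 2 := by positivity
      linarith
  have hS0 : HasSum (fun n : ℤ => if n = 0 then A else 0) A := hasSum_ite_eq 0 A
  have hS1 := hS0.add (((hd.summable.hasSum.mul_left B⁻¹).add (hK.hasSum.mul_left B)).mul_left 2⁻¹)
  have hcs : Summable fun n => ‖c n‖ :=
    Summable.of_nonneg_of_le (fun n => norm_nonneg _) hmaj hS1.summable
  refine ⟨ℤ, inferInstance, c, id, by simpa using hcs, ?_, fun ξ => ?_⟩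
  · simp only [pow_zero, mul_one]
    refine (hcs.tsum_le_tsum hmaj hS1.summable).trans ?_
    rw [hS1.tsum_eq]
    have h1 : B⁻¹ * ∑' n, ‖d n‖ ^ 2 ≤ B := by
      rw [inv_mul_le_iff₀ hB0]; linarith
    linarith
  · let g : C(AddCircle (2 * Real.pi), ℂ) := ⟨hp.lift, continuous_coinduced_dom.2 hfc⟩
    have hg : ∀ x : ℝ, g x = f x := fun x => rfl
    have hgc : fourierCoeff g = c := by
      ext n
      rw [fourierCoeff_eq_intervalIntegral _ n 0, hcdef]
      simp only []
      rw [fourierCoeffOn_eq_integral]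
      simp only [fourier_coe_apply, zero_add, sub_zero, hg]
    have h2 := has_pointwise_sum_fourier_series_of_summable (f := g)
      (by rw [hgc]; exact hcs.of_norm) ξ
    rw [hgc, hg] at h2
    rw [← h2.tsum_eq]
    refine tsum_congr fun n => ?_
    rw [fourier_two_pi]
    rfl

theorem ch_add_two_pi (n : ℤ) (ξ : ℝ) : ch n (ξ + 2 * Real.pi) = ch n ξ := by
  rw [← fourier_two_pi, ← fourier_two_pi, AddCircle.coe_add_period]

theorem hasDerivAt_ch (n : ℤ) (ξ : ℝ) : HasDerivAt (ch n) (I * n * ch n ξ) ξ := by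
  have h1 : HasDerivAt (fun ξ : ℝ => I * ((n * ξ : ℝ) : ℂ)) (I * n) ξ := by
    have := ((hasDerivAt_id ξ).const_mul (n : ℝ)).ofReal_comp.const_mul I
    refine this.congr_deriv ?_
    simp
  refine h1.cexp.congr_deriv ?_
  rw [ch, mul_comm]

namespace IsW

theorem periodic {k : ℕ} {F : ℝ → ℂ} {A : ℝ} (h : IsW k F A) :
    Function.Periodic F (2 * Real.pi) := by
  obtain ⟨ι, hι, c, s, h1, h2, h3⟩ := h
  intro ξ
  simp only [h3, ch_add_two_pi]

/-- Approximation by trigonometric polynomials. -/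
theorem exists_approx {F : ℝ → ℂ} {A δ : ℝ} (h : IsW 0 F A) (hδ : 0 < δ) :
    ∃ P P' : ℝ → ℂ, (∀ x, HasDerivAt P (P' x) x) ∧ Continuous P' ∧
      Function.Periodic P (2 * Real.pi) ∧ (∃ D, ∀ x, ‖P' x‖ ≤ D) ∧
      IsW 0 (fun ξ => P ξ - F ξ) δ := by
  obtain ⟨ι, hι, c, s, h1, h2, h3⟩ := h
  simp only [pow_zero, mul_one] at h1
  obtain ⟨t, ht⟩ := ((tendsto_order.1 (tendsto_tsum_compl_atTop_zero fun i => ‖c i‖)).2 δ hδ).exists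
  refine ⟨fun ξ => ∑ i ∈ t, c i * ch (s i) ξ, fun ξ => ∑ i ∈ t, c i * (I * s i * ch (s i) ξ),
    fun x => HasDerivAt.fun_sum fun i _ => (hasDerivAt_ch _ _).const_mul _, by fun_prop,
    fun ξ => by simp only [ch_add_two_pi], ⟨∑ i ∈ t, ‖c i * (I * s i)‖, fun x => ?_⟩, ?_⟩
  · refine (norm_sum_le _ _).trans (Finset.sum_le_sum fun i _ => ?_)
    rw [← mul_assoc, norm_mul, norm_ch, mul_one]
  · have hs : Summable fun i : {i // i ∉ t} => ‖-c i‖ := by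
      simp only [norm_neg]
      exact h1.subtype _
    refine ⟨{i // i ∉ t}, inferInstance, fun i => -c i, fun i => s i, by simpa using hs,
      by simpa using ht.le, fun ξ => ?_⟩
    have h4 := (summable_char h1 (s := s) ξ).sum_add_tsum_subtype_compl t
    change ∑ i ∈ t, c i * ch (s i) ξ - F ξ = _
    rw [h3, ← h4]
    simp only [neg_mul, tsum_neg]
    ring

/-- **Wiener's lemma**. -/
theorem inv {F : ℝ → ℂ} {A : ℝ} (h : IsW 0 F A) (h0 : ∀ ξ, F ξ ≠ 0) :
    ∃ M, IsW 0 (fun ξ => (F ξ)⁻¹) M := by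
  obtain ⟨m, hm0, hm⟩ : ∃ m, 0 < m ∧ ∀ ξ, 3 * m ≤ ‖F ξ‖ := by
    obtain ⟨x, _, hx⟩ := (isCompact_Icc (a := (0 : ℝ)) (b := 2 * Real.pi)).exists_isMinOn
      ⟨0, le_rfl, Real.two_pi_pos.le⟩ h.continuous.norm.continuousOn
    refine ⟨‖F x‖ / 3, by have := norm_pos_iff.2 (h0 x); positivity, fun ξ => ?_⟩
    obtain ⟨y, hy, hξ⟩ := h.periodic.exists_mem_Ico₀ Real.two_pi_pos ξ
    rw [hξ]
    have : ‖F x‖ ≤ ‖F y‖ := hx (Set.Ico_subset_Icc_self hy)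
    linarith
  obtain ⟨P, P', hP, hPc, hPp, ⟨D, hD⟩, hPF⟩ := h.exists_approx hm0
  have hPm : ∀ ξ, 2 * m ≤ ‖P ξ‖ := fun ξ => by
    have h1 := hPF.bound ξ
    have h2 := hm ξ
    have h3 := norm_le_norm_add_norm_sub' (F ξ) (P ξ)
    rw [norm_sub_rev] at h3
    linarith
  have hP0 : ∀ ξ, P ξ ≠ 0 := fun ξ hξ => by
    have := hPm ξ
    rw [hξ, norm_zero] at this
    linarith
  have hPcont : Continuous P := continuous_iff_continuousAt.2 fun x => (hP x).continuousAt
  have hD0 : 0 ≤ D := (norm_nonneg _).trans (hD 0)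
  set K := 1 + ∑' n : ℤ, 1 / (n : ℝ) ^ 2
  have hinv : ∀ n : ℕ, IsW 0 (fun ξ => (P ξ ^ (n + 1))⁻¹) ((2 * m)⁻¹ ^ (n + 1) +
      2⁻¹ * ((((n + 1 : ℕ) : ℝ) * (D + 1) * (2 * m)⁻¹ ^ (n + 2)) * K)) := by
    intro n
    refine isW_of_hasDerivAt (f' := fun ξ => -(((n + 1 : ℕ) : ℂ) * P ξ ^ n * P' ξ) /
      (P ξ ^ (n + 1)) ^ 2) (fun x => ?_) ?_ ?_ (fun x => ?_) (fun x => ?_) (by positivity)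
    · exact ((hP x).fun_pow (n + 1)).fun_inv (pow_ne_zero _ (hP0 x))
    · refine Continuous.div₀ (by fun_prop) (by fun_prop) fun x => ?_
      exact pow_ne_zero _ (pow_ne_zero _ (hP0 x))
    · intro x
      simp only [hPp x]
    · rw [norm_inv, norm_pow, ← inv_pow]
      gcongr
      exact hPm x
    · have h1 : -(((n + 1 : ℕ) : ℂ) * P x ^ n * P' x) / (P x ^ (n + 1)) ^ 2 =
          -(((n + 1 : ℕ) : ℂ) * P' x * (P x)⁻¹ ^ (n + 2)) := by
        have := hP0 x
        rw [inv_pow]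
        field_simp
        ring
      rw [h1, norm_neg, norm_mul, norm_mul, norm_pow, norm_inv, Complex.norm_natCast]
      have h2 := hD x
      have h3 := hPm x
      gcongr
      linarith
  have hpw : ∀ n : ℕ, IsW 0 (fun ξ => (P ξ - F ξ) ^ n) (m ^ n) := by
    intro n
    induction n with
    | zero => simpa using const (k := 0) 1
    | succ n ih => simpa only [pow_succ] using ih.mul hPF
  have hsum : Summable fun n : ℕ => m ^ n * ((2 * m)⁻¹ ^ (n + 1) +
      2⁻¹ * ((((n + 1 : ℕ) : ℝ) * (D + 1) * (2 * m)⁻¹ ^ (n + 2)) * K)) := by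
    have h1 : Summable fun n : ℕ => ((2 : ℝ)⁻¹) ^ n :=
      summable_geometric_of_lt_one (by norm_num) (by norm_num)
    have h2 : Summable fun n : ℕ => (n : ℝ) ^ 1 * ((2 : ℝ)⁻¹) ^ n :=
      summable_pow_mul_geometric_of_norm_lt_one 1 (by norm_num)
    refine ((h1.mul_left ((2 * m)⁻¹)).add
      ((h2.add h1).mul_left (2⁻¹ * (D + 1) * (2 * m)⁻¹ ^ 2 * K))).congr fun n => ?_
    have h3 : m ^ n * (2 * m)⁻¹ ^ n = (2 : ℝ)⁻¹ ^ n := by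
      rw [← mul_pow]; congr 1; field_simp
    rw [← h3]
    push_cast
    ring
  refine ⟨_, ((ncu 0).tsum (fun n => (hpw n).mul (hinv n)) hsum).congr fun ξ => ?_⟩
  have hq : ‖(P ξ - F ξ) / P ξ‖ < 1 := by
    rw [norm_div, div_lt_one (norm_pos_iff.2 (hP0 ξ))]
    have h1 := hPF.bound ξ
    have h2 := hPm ξ
    linarith
  have h1 : ∀ n : ℕ, (P ξ - F ξ) ^ n * (P ξ ^ (n + 1))⁻¹ =
      (P ξ)⁻¹ * ((P ξ - F ξ) / P ξ) ^ n := fun n => by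
    rw [div_pow, pow_succ]
    have := hP0 ξ
    field_simp
  simp only [h1]
  rw [tsum_mul_left, tsum_geometric_of_norm_lt_one hq]
  have := hP0 ξ
  have := h0 ξ
  rw [show 1 - (P ξ - F ξ) / P ξ = F ξ / P ξ by field_simp; ring]
  field_simp

end IsW

theorem ch_zpow (n : ℤ) (ξ : ℝ) : ch n ξ = ch 1 ξ ^ n := by
  rw [ch, ch, ← Complex.exp_int_mul]
  congr 1
  push_cast
  ring

theorem ch_add_right (n : ℤ) (ξ a : ℝ) : ch n (ξ + a) = ch n a * ch n ξ := by
  rw [ch, ch, ch, ← Complex.exp_add]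
  congr 1
  push_cast
  ring

theorem ch_one_pi : ch 1 Real.pi = -1 := by
  rw [ch_one_eq, Real.cos_pi, Real.sin_pi]; simp

theorem ch_one_zero : ch 1 0 = 1 := by
  rw [ch_one_eq, Real.cos_zero, Real.sin_zero]; simp

theorem ch_two_eq (ξ : ℝ) : ch 2 ξ - 1 = (ch 1 ξ - 1) * (ch 1 ξ + 1) := by
  rw [show (2 : ℤ) = 1 + 1 by rfl, ch_add]
  ring

theorem dense_ch_two : Dense {ξ : ℝ | ch 2 ξ - 1 ≠ 0} := by
  have h : {ξ : ℝ | ch 2 ξ - 1 = 0}.Countable := by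
    refine (Set.countable_range fun n : ℤ => n * Real.pi).mono fun ξ hξ => ?_
    have h1 : ch 2 ξ = 1 := sub_eq_zero.1 hξ
    rw [ch, Complex.exp_eq_one_iff] at h1
    obtain ⟨n, hn⟩ := h1
    refine ⟨n, ?_⟩
    have h2 : ((2 * ξ : ℝ) : ℂ) = ((n * (2 * Real.pi) : ℝ) : ℂ) := by
      apply mul_left_cancel₀ I_ne_zero
      push_cast at hn ⊢
      rw [hn]; ring
    have h3 := ofReal_injective h2
    simp only
    linarith
  exact h.dense_compl ℝ

namespace IsW

theorem tsum_countable {k : ℕ} {ι : Type} [Countable ι] {F : ι → ℝ → ℂ} {M : ι → ℝ}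
    (h : ∀ i, IsW k (F i) (M i)) (hM : Summable M) :
    IsW k (fun ξ => ∑' i, F i ξ) (∑' i, M i) := by
  obtain ⟨f, hf⟩ := exists_injective_nat ι
  have h1 : ∀ n, IsW k (Function.extend f F 0 n) (Function.extend f M 0 n) := by
    intro n
    by_cases hn : ∃ i, f i = n
    · obtain ⟨i, rfl⟩ := hn
      rw [hf.extend_apply, hf.extend_apply]
      exact h i
    · rw [Function.extend_apply' _ _ _ hn, Function.extend_apply' _ _ _ hn]
      have h0 := const (k := k) 0
      rw [norm_zero] at h0
      exact h0
  have h2 := tsum h1 ((summable_extend_zero hf).2 hM)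
  rw [tsum_extend_zero hf] at h2
  refine h2.congr fun ξ => ?_
  rw [← tsum_extend_zero hf]
  refine tsum_congr fun n => ?_
  by_cases hn : ∃ i, f i = n
  · obtain ⟨i, rfl⟩ := hn
    rw [hf.extend_apply, hf.extend_apply]
  · rw [Function.extend_apply' _ _ _ hn, Function.extend_apply' _ _ _ hn]
    rfl

theorem comp_add {k : ℕ} {F : ℝ → ℂ} {A : ℝ} (h : IsW k F A) (a : ℝ) :
    IsW k (fun ξ => F (ξ + a)) A := by
  obtain ⟨ι, hι, c, s, h1, h2, h3⟩ := h
  refine ⟨ι, hι, fun i => c i * ch (s i) a, s, ?_, ?_, fun ξ => ?_⟩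
  · simpa only [norm_mul, norm_ch, mul_one] using h1
  · simpa only [norm_mul, norm_ch, mul_one] using h2
  · simp only [h3, ch_add_right, mul_assoc]

theorem eq_of_ch_eq {k : ℕ} {F : ℝ → ℂ} {A : ℝ} (h : IsW k F A) {ξ η : ℝ}
    (he : ch 1 ξ = ch 1 η) : F ξ = F η := by
  obtain ⟨ι, hι, c, s, h1, h2, h3⟩ := h
  simp only [h3]
  refine tsum_congr fun i => ?_
  rw [ch_zpow, he, ← ch_zpow]

theorem exists_geom (n : ℕ) : ∃ G : ℝ → ℂ, IsW 0 G n ∧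
    ∀ ξ, ch n ξ - 1 = (ch 1 ξ - 1) * G ξ := by
  refine ⟨fun ξ => ∑ j ∈ Finset.range n, ch 1 ξ ^ j, ?_, fun ξ => ?_⟩
  · have := (ncu 0).sum (Finset.range n) (F := fun j ξ => 1 * ch j ξ)
      (fun j _ => char (k := 0) 1 j)
    refine (this.congr fun ξ => ?_).mono (by simp)
    refine Finset.sum_congr rfl fun j _ => ?_
    rw [ch_pow]; simp
  · rw [mul_geom_sum, ch_pow]; simp

theorem exists_geom_int (n : ℤ) : ∃ G : ℝ → ℂ, IsW 0 G |(n : ℝ)| ∧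
    ∀ ξ, ch n ξ - 1 = (ch 1 ξ - 1) * G ξ := by
  obtain ⟨m, rfl | rfl⟩ := n.eq_nat_or_neg
  · obtain ⟨G, hG, h⟩ := exists_geom m
    exact ⟨G, by simpa using hG, h⟩
  · obtain ⟨G, hG, h⟩ := exists_geom m
    refine ⟨fun ξ => -(1 * ch (-m) ξ) * G ξ, ?_, fun ξ => ?_⟩
    · have := ((ncu 0).neg (char (k := 0) 1 (-m))).mul hG
      simpa using this
    · have h1 : ch (-(m : ℤ)) ξ * ch m ξ = 1 := by rw [← ch_add]; simp
      linear_combination (-ch (-(m : ℤ)) ξ) * h ξ + h1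

theorem div_zero {F : ℝ → ℂ} {A : ℝ} (h : IsW 1 F A) (h0 : F 0 = 0) :
    ∃ (G : ℝ → ℂ) (M : ℝ), IsW 0 G M ∧ ∀ ξ, F ξ = (ch 1 ξ - 1) * G ξ := by
  have hF := h
  obtain ⟨ι, hι, c, s, h1, h2, h3⟩ := h
  choose g hg hgs using exists_geom_int
  have hs : Summable fun i => ‖c i‖ * |(s i : ℝ)| := by
    refine Summable.of_nonneg_of_le (fun i => by positivity) (fun i => ?_) h1
    rw [pow_one]
    gcongr
    linarith
  have h5 := fun i => (ncu 0).smul (c i) (hg (s i))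
  refine ⟨_, _, tsum_countable h5 hs, fun ξ => ?_⟩
  have hcs := summable_char (s := s) (summable_norm h1)
  have h6 : F ξ = F ξ - F 0 := by rw [h0, sub_zero]
  rw [h6, h3, h3, ← (hcs ξ).tsum_sub (hcs 0), ← tsum_mul_left]
  refine tsum_congr fun i => ?_
  have h7 : ch (s i) 0 = 1 := by simp [ch]
  rw [h7]
  linear_combination c i * hgs (s i) ξ

theorem div_pi {F : ℝ → ℂ} {A : ℝ} (h : IsW 1 F A) (h0 : F Real.pi = 0) :
    ∃ (G : ℝ → ℂ) (M : ℝ), IsW 0 G M ∧ ∀ ξ, F ξ = (ch 1 ξ + 1) * G ξ := by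
  obtain ⟨G, M, hG, hGF⟩ := (h.comp_add Real.pi).div_zero (by simpa using h0)
  refine ⟨_, _, (ncu 0).neg (hG.comp_add (-Real.pi)), fun ξ => ?_⟩
  have h1 := hGF (ξ + -Real.pi)
  simp only [neg_add_cancel_right] at h1
  have h2 : ch 1 (-Real.pi) = -1 := by
    rw [ch_one_eq, Real.cos_neg, Real.sin_neg, Real.cos_pi, Real.sin_pi]; simp
  rw [h1, ch_add_right, h2]
  ring

theorem div_both {F : ℝ → ℂ} {A : ℝ} (h : IsW 1 F A) (h0 : F 0 = 0) (h1 : F Real.pi = 0) :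
    ∃ (G : ℝ → ℂ) (M : ℝ), IsW 0 G M ∧ ∀ ξ, F ξ = (ch 2 ξ - 1) * G ξ := by
  obtain ⟨G, M, hG, hGF⟩ := h.div_zero h0
  obtain ⟨H, N, hH, hHF⟩ := h.div_pi h1
  refine ⟨_, _, (ncu 0).smul 2⁻¹ ((ncu 0).sub hG hH), fun ξ => ?_⟩
  rw [ch_two_eq]
  linear_combination (2⁻¹ * (ch 1 ξ + 1)) * hGF ξ - (2⁻¹ * (ch 1 ξ - 1)) * hHF ξ

theorem quot_of_factor {W F V G q q' : ℝ → ℂ} {A B c : ℝ} (hV : IsW 0 V A) (hG : IsW 0 G B)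
    (hW : ∀ ξ, W ξ = q ξ * V ξ) (hF : ∀ ξ, F ξ = q ξ * G ξ) (hc : 0 < c)
    (hq : ∀ ξ, ch 2 ξ - 1 = q ξ * q' ξ) (hq' : Continuous q')
    (h0 : ∀ ξ, q' ξ = 0 → W ξ ≠ 0) (hlow : ∀ ξ, c * ‖ch 2 ξ - 1‖ ≤ ‖W ξ‖) :
    ∃ (R : ℝ → ℂ) (M : ℝ), IsW 0 R M ∧ ∀ ξ, R ξ * W ξ = F ξ := by
  have hclosed : IsClosed {ξ | c * ‖q' ξ‖ ≤ ‖V ξ‖} :=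
    isClosed_le (by fun_prop) hV.continuous.norm
  have hsub : {ξ : ℝ | ch 2 ξ - 1 ≠ 0} ⊆ {ξ | c * ‖q' ξ‖ ≤ ‖V ξ‖} := by
    intro ξ hξ
    have h1 := hlow ξ
    have h2 : q ξ ≠ 0 := fun h => hξ (by rw [hq, h, zero_mul])
    rw [hq, hW, norm_mul, norm_mul] at h1
    have h3 := norm_pos_iff.2 h2
    have h4 : ‖q ξ‖ * (c * ‖q' ξ‖) ≤ ‖q ξ‖ * ‖V ξ‖ := by linarith
    exact le_of_mul_le_mul_left h4 h3
  have hall : ∀ ξ, c * ‖q' ξ‖ ≤ ‖V ξ‖ := fun ξ => by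
    have := hclosed.closure_subset_iff.2 hsub (dense_ch_two.closure_eq ▸ Set.mem_univ ξ)
    exact this
  have hV0 : ∀ ξ, V ξ ≠ 0 := by
    intro ξ hξ
    by_cases h : q' ξ = 0
    · exact h0 ξ h (by rw [hW, hξ, mul_zero])
    · have := hall ξ
      rw [hξ, norm_zero] at this
      have := norm_pos_iff.2 h
      nlinarith
  obtain ⟨M, hM⟩ := hV.inv hV0
  refine ⟨_, _, hG.mul hM, fun ξ => ?_⟩
  rw [hW, hF]
  have := hV0 ξ
  field_simp

/-- Division in the Wiener algebra, the denominator having at most simple zeros at the edges. -/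
theorem quot {W F : ℝ → ℂ} {A B c : ℝ} (hW : IsW 1 W A) (hF : IsW 1 F B) (hc : 0 < c)
    (hlow : ∀ ξ, c * ‖ch 2 ξ - 1‖ ≤ ‖W ξ‖) (h0 : W 0 = 0 → F 0 = 0)
    (hpi : W Real.pi = 0 → F Real.pi = 0) :
    ∃ (R : ℝ → ℂ) (M : ℝ), IsW 0 R M ∧ ∀ ξ, R ξ * W ξ = F ξ := by
  have e0 : ∀ ξ, ch 1 ξ - 1 = 0 → W ξ = W 0 := fun ξ hξ =>
    hW.eq_of_ch_eq (by rw [ch_one_zero]; exact sub_eq_zero.1 hξ)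
  have e1 : ∀ ξ, ch 1 ξ + 1 = 0 → W ξ = W Real.pi := fun ξ hξ =>
    hW.eq_of_ch_eq (by rw [ch_one_pi]; exact eq_neg_of_add_eq_zero_left hξ)
  by_cases a0 : W 0 = 0 <;> by_cases a1 : W Real.pi = 0
  · obtain ⟨V, _, hV, hWV⟩ := hW.div_both a0 a1
    obtain ⟨G, _, hG, hFG⟩ := hF.div_both (h0 a0) (hpi a1)
    exact quot_of_factor (q' := fun _ => 1) hV hG hWV hFG hc (fun ξ => (mul_one _).symm)
      (by fun_prop) (fun ξ h => absurd h one_ne_zero) hlow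
  · obtain ⟨V, _, hV, hWV⟩ := hW.div_zero a0
    obtain ⟨G, _, hG, hFG⟩ := hF.div_zero (h0 a0)
    exact quot_of_factor (q' := fun ξ => ch 1 ξ + 1) hV hG hWV hFG hc ch_two_eq
      (by fun_prop) (fun ξ h => by rwa [e1 ξ h]) hlow
  · obtain ⟨V, _, hV, hWV⟩ := hW.div_pi a1
    obtain ⟨G, _, hG, hFG⟩ := hF.div_pi (hpi a1)
    exact quot_of_factor (q' := fun ξ => ch 1 ξ - 1) hV hG hWV hFG hc
      (fun ξ => by rw [ch_two_eq, mul_comm]) (by fun_prop) (fun ξ h => by rwa [e0 ξ h]) hlow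
  · refine quot_of_factor (q := fun _ => 1) (q' := fun ξ => ch 2 ξ - 1) (hW.of_le zero_le_one)
      (hF.of_le zero_le_one) (by simp) (by simp) hc (by simp) (by fun_prop) (fun ξ h => ?_) hlow
    rw [ch_two_eq, mul_eq_zero] at h
    rcases h with h | h
    · rwa [e0 ξ h]
    · rwa [e1 ξ h]

theorem quot_of_ne {W F : ℝ → ℂ} {A B : ℝ} (hW : IsW 0 W A) (hF : IsW 0 F B)
    (h0 : ∀ ξ, W ξ ≠ 0) : ∃ (R : ℝ → ℂ) (M : ℝ), IsW 0 R M ∧ ∀ ξ, R ξ * W ξ = F ξ := by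
  obtain ⟨M, hM⟩ := hW.inv h0
  refine ⟨_, _, hF.mul hM, fun ξ => ?_⟩
  have := h0 ξ
  field_simp

end IsW

/-- Exchange of the two components. -/
def sw (v : Fin 2 → ℂ) : Fin 2 → ℂ := ![v 1, v 0]

/-- Reflection of the coin parameter. -/
def ra (α : ℤ → ℂ) (x : ℤ) : ℂ := -(starRingEnd ℂ) (α (-x))

/-- Reflection of the phase. -/
def rt (θ : ℤ → ℝ) (x : ℤ) : ℝ := θ (-x)

/-- The left Jost solution. -/
def vm (a₀ : ℂ) (α : ℤ → ℂ) (θ : ℤ → ℝ) (p : ℂ × ℂ) (x : ℤ) : Fin 2 → ℂ :=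
  sw (vp (-(starRingEnd ℂ) a₀) (ra α) (rt θ) p (1 - x))

/-- Solutions of the transfer recursion. -/
def IsSol (α : ℤ → ℂ) (θ : ℤ → ℝ) (w : ℂ) (v : ℤ → Fin 2 → ℂ) : Prop :=
  ∀ x, v x = (Ti (α x) (θ x) w).mulVec (v (x + 1))

/-- Short range perturbations of the free walk. -/
structure Dat (a₀ : ℂ) (α : ℤ → ℂ) (θ : ℤ → ℝ) (k : ℕ) : Prop where
  pos : 0 < ‖a₀‖
  lt_one : ‖a₀‖ < 1
  coin : ∀ x, ‖α x‖ < 1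
  summ : Summable fun x : ℤ => (|(x : ℝ)| + 1) ^ (k + 1) * pert a₀ (α x) (θ x)

@[simp] theorem ra_ra (α : ℤ → ℂ) : ra (ra α) = α := by
  ext x; simp [ra]

@[simp] theorem rt_rt (θ : ℤ → ℝ) : rt (rt θ) = θ := by
  ext x; simp [rt]

theorem pert_reflect (a₀ a : ℂ) (t : ℝ) :
    pert (-(starRingEnd ℂ) a₀) (-(starRingEnd ℂ) a) t = pert a₀ a t := by
  unfold pert
  rw [rho_neg_conj, rho_neg_conj]
  congr 1
  have h : ((rho a : ℝ) : ℂ)⁻¹ * -(starRingEnd ℂ) a -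
      ((rho a₀ : ℝ) : ℂ)⁻¹ * -(starRingEnd ℂ) a₀ =
      -(starRingEnd ℂ) (((rho a : ℝ) : ℂ)⁻¹ * a - ((rho a₀ : ℝ) : ℂ)⁻¹ * a₀) := by
    simp only [map_sub, map_mul, map_inv₀, conj_ofReal]
    ring
  rw [h, norm_neg, norm_conj]

theorem det2_mulVec (M : Matrix (Fin 2) (Fin 2) ℂ) (v u : Fin 2 → ℂ) :
    det2 (M.mulVec v) (M.mulVec u) = M.det * det2 v u := by
  simp only [det2, Matrix.det_fin_two, Matrix.mulVec, dotProduct, Fin.sum_univ_two]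
  ring

theorem det_Ti {a : ℂ} (ha : ‖a‖ < 1) (t : ℝ) {w : ℂ} (hw : w ≠ 0) : (Ti a t w).det = 1 := by
  have h1 := rho_sq_complex ha
  have h2 : ((rho a : ℝ) : ℂ) ≠ 0 := ofReal_ne_zero.2 (rho_pos ha).ne'
  have h3 : exp (t * I) * exp (-(t * I)) = 1 := by rw [← exp_add]; simp
  have h4 : w * w⁻¹ = 1 := mul_inv_cancel₀ hw
  have h5 : ((rho a : ℝ) : ℂ)⁻¹ * ((rho a : ℝ) : ℂ)⁻¹ * (1 - a * (starRingEnd ℂ) a) = 1 := by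
    rw [← h1]; field_simp
  rw [Ti, Matrix.det_smul, Matrix.det_fin_two]
  simp
  linear_combination h5 + ((rho a : ℝ) : ℂ)⁻¹ * ((rho a : ℝ) : ℂ)⁻¹ *
    (exp (t * I) * exp (-(t * I)) * h4 + h3)

theorem Tf_mulVec_sw (a : ℂ) (t : ℝ) (w : ℂ) (v : Fin 2 → ℂ) :
    (Tf a t w).mulVec (sw v) = sw ((Ti (-(starRingEnd ℂ) a) t w).mulVec v) := by
  rw [Tf, Ti, rho_neg_conj]
  ext i
  fin_cases i <;> simp [sw, Matrix.mulVec, dotProduct, Fin.sum_univ_two] <;> ring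

theorem Ti_mulVec_sw_conj (a : ℂ) (t : ℝ) {w : ℂ} (hw : (starRingEnd ℂ) w = w⁻¹)
    (v : Fin 2 → ℂ) :
    (Ti a t w).mulVec (sw (star v)) = sw (star ((Ti a t w).mulVec v)) := by
  have h2 : (starRingEnd ℂ) w⁻¹ = w := by rw [map_inv₀, hw, inv_inv]
  ext i
  fin_cases i <;> simp [Ti, sw, Matrix.mulVec, dotProduct, Fin.sum_univ_two, ← exp_conj, hw]
    <;> ring

namespace IsSol
variable {α : ℤ → ℂ} {θ : ℤ → ℝ} {w : ℂ} {v u : ℤ → Fin 2 → ℂ}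

theorem det2_eq (hα : ∀ x, ‖α x‖ < 1) (hw : w ≠ 0) (hv : IsSol α θ w v) (hu : IsSol α θ w u)
    (x y : ℤ) : det2 (v x) (u x) = det2 (v y) (u y) := by
  have h : ∀ x, det2 (v x) (u x) = det2 (v (x + 1)) (u (x + 1)) := fun x => by
    rw [hv x, hu x, det2_mulVec, det_Ti (hα x) _ hw, one_mul]
  have h2 : ∀ x, det2 (v x) (u x) = det2 (v 0) (u 0) := fun x => by
    induction x using Int.induction_on with
    | zero => rfl
    | succ n ih => rw [← h, ih]
    | pred n ih => rw [h, sub_add_cancel, ih]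
  rw [h2 x, h2 y]

theorem forward (hα : ∀ x, ‖α x‖ < 1) (hw : w ≠ 0) (hv : IsSol α θ w v) (x : ℤ) :
    v (x + 1) = (Tf (α x) (θ x) w).mulVec (v x) := by
  rw [hv x, Matrix.mulVec_mulVec, Tf_mul_Ti (hα x) _ hw, Matrix.one_mulVec]

theorem of_forward (hα : ∀ x, ‖α x‖ < 1) (hw : w ≠ 0)
    (hv : ∀ x, v (x + 1) = (Tf (α x) (θ x) w).mulVec (v x)) : IsSol α θ w v := fun x => by
  rw [hv x, Matrix.mulVec_mulVec, Ti_mul_Tf (hα x) _ hw, Matrix.one_mulVec]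

theorem smul (c : ℂ) (hv : IsSol α θ w v) : IsSol α θ w (fun x => c • v x) := fun x => by
  rw [Matrix.mulVec_smul, ← hv x]

theorem sub (hv : IsSol α θ w v) (hu : IsSol α θ w u) : IsSol α θ w (fun x => v x - u x) :=
  fun x => by rw [Matrix.mulVec_sub, ← hv x, ← hu x]

theorem sw_star (hw : (starRingEnd ℂ) w = w⁻¹) (hv : IsSol α θ w v) :
    IsSol α θ w (fun x => sw (star (v x))) := fun x => by
  simp only
  rw [Ti_mulVec_sw_conj _ _ hw, ← hv x]

theorem eq_zero (hα : ∀ x, ‖α x‖ < 1) (hw : w ≠ 0) (hv : IsSol α θ w v) {y : ℤ} (hy : v y = 0)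
    (x : ℤ) : v x = 0 := by
  have h2 : ∀ n : ℕ, v (y + n) = 0 ∧ v (y - n) = 0 := by
    intro n
    induction n with
    | zero => simpa using hy
    | succ n ih =>
      constructor
      · have := hv.forward hα hw (y + n)
        push_cast
        rw [← add_assoc, this, ih.1, Matrix.mulVec_zero]
      · have := hv (y - (n + 1 : ℕ))
        rw [this, show y - ((n + 1 : ℕ) : ℤ) + 1 = y - n by push_cast; ring, ih.2,
          Matrix.mulVec_zero]
  rcases le_total y x with h | h
  · obtain ⟨n, hn⟩ := Int.eq_ofNat_of_zero_le (sub_nonneg.2 h)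
    rw [show x = y + n by omega]; exact (h2 n).1
  · obtain ⟨n, hn⟩ := Int.eq_ofNat_of_zero_le (sub_nonneg.2 h)
    rw [show x = y - n by omega]; exact (h2 n).2

end IsSol

namespace Dat
variable {a₀ : ℂ} {α : ℤ → ℂ} {θ : ℤ → ℝ} {k : ℕ}

theorem reflect (h : Dat a₀ α θ k) : Dat (-(starRingEnd ℂ) a₀) (ra α) (rt θ) k where
  pos := by simpa using h.pos
  lt_one := by simpa using h.lt_one
  coin x := by simpa [ra] using h.coin (-x)
  summ := by
    refine (h.summ.comp_injective neg_injective).congr fun x => ?_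
    simp [ra, rt, pert_reflect]

theorem mono (h : Dat a₀ α θ k) {j : ℕ} (hj : j ≤ k) : Dat a₀ α θ j where
  pos := h.pos
  lt_one := h.lt_one
  coin := h.coin
  summ := by
    refine Summable.of_nonneg_of_le (fun x => mul_nonneg (by positivity) (pert_nonneg _ _ _))
      (fun x => ?_) h.summ
    have := pert_nonneg a₀ (α x) (θ x)
    gcongr
    linarith [abs_nonneg (x : ℝ)]

theorem summ_nat (h : Dat a₀ α θ k) :
    Summable fun y : ℕ => ((y : ℝ) + 1) ^ (k + 1) * pert a₀ (α y) (θ y) :=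
  summable_pert_nat h.summ

theorem isSol_vp (h : Dat a₀ α θ 0) {p : ℂ × ℂ} (hp : p ∈ Sg (rho a₀)) :
    IsSol α θ p.1 (vp a₀ α θ p) :=
  vp_rec (mc_continuousOn (rho a₀)) h.lt_one h.summ_nat hp

theorem isSol_vm (h : Dat a₀ α θ 0) {p : ℂ × ℂ} (hp : p ∈ Sg (rho a₀)) :
    IsSol α θ p.1 (vm a₀ α θ p) := by
  refine IsSol.of_forward h.coin hp.1 fun x => ?_
  have := h.reflect.isSol_vp (by rwa [rho_neg_conj]) (-x)
  rw [vm, vm, Tf_mulVec_sw, show 1 - (x + 1) = -x by ring, this, show -x + 1 = 1 - x by ring]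
  simp [ra, rt]

theorem mj_tendsto (h : Dat a₀ α θ 0) {p : ℂ × ℂ} (hp : p ∈ Sg (rho a₀)) (i : Fin 2) :
    Filter.Tendsto (fun x => mj a₀ α θ p x i) Filter.atTop (nhds (ev a₀ p i)) :=
  _root_.mj_tendsto (mc_continuousOn (rho a₀)) h.lt_one h.summ_nat hp i

theorem mj_bdd (h : Dat a₀ α θ 0) : ∃ C, 0 ≤ C ∧ ∀ p ∈ Sg (rho a₀), ∀ x i,
    ‖mj a₀ α θ p x i‖ ≤ C := by
  obtain ⟨C, hC, hm⟩ := mj_bound (mc_continuousOn (rho a₀)) h.lt_one h.summ_nat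
  exact ⟨C, hC, fun p hp x i => (hm x i).2.2 p hp⟩

theorem continuousOn_vp (h : Dat a₀ α θ 0) (x : ℤ) (i : Fin 2) :
    ContinuousOn (fun p => vp a₀ α θ p x i) (Sg (rho a₀)) := by
  obtain ⟨C, hC⟩ := vp_bound (mc_continuousOn (rho a₀)) h.lt_one h.summ_nat x
  exact (hC i).2.1

theorem continuousOn_vm (h : Dat a₀ α θ 0) (x : ℤ) (i : Fin 2) :
    ContinuousOn (fun p => vm a₀ α θ p x i) (Sg (rho a₀)) := by
  have := fun j => h.reflect.continuousOn_vp (1 - x) j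
  rw [rho_neg_conj] at this
  fin_cases i
  · exact this 1
  · exact this 0

end Dat

/-- The Wronskian of the two Jost solutions. -/
def Wr (a₀ : ℂ) (α : ℤ → ℂ) (θ : ℤ → ℝ) (p : ℂ × ℂ) : ℂ :=
  det2 (vp a₀ α θ p 1) (vm a₀ α θ p 1)

theorem vm_reflect (a₀ : ℂ) (α : ℤ → ℂ) (θ : ℤ → ℝ) (p : ℂ × ℂ) (x : ℤ) :
    vm (-(starRingEnd ℂ) a₀) (ra α) (rt θ) p x = sw (vp a₀ α θ p (1 - x)) := by
  simp [vm]

theorem sw_sw (v : Fin 2 → ℂ) : sw (sw v) = v := by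
  ext i; fin_cases i <;> rfl

theorem det2_sw (v u : Fin 2 → ℂ) : det2 (sw v) (sw u) = -det2 v u := by
  simp [det2, sw]

theorem det2_swap (v u : Fin 2 → ℂ) : det2 v u = -det2 u v := by
  simp [det2]; ring

namespace Dat
variable {a₀ : ℂ} {α : ℤ → ℂ} {θ : ℤ → ℝ}

theorem Wr_eq (h : Dat a₀ α θ 0) {p : ℂ × ℂ} (hp : p ∈ Sg (rho a₀)) (x : ℤ) :
    det2 (vp a₀ α θ p x) (vm a₀ α θ p x) = Wr a₀ α θ p :=
  (h.isSol_vp hp).det2_eq h.coin hp.1 (h.isSol_vm hp) _ _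

theorem Wr_reflect (h : Dat a₀ α θ 0) {p : ℂ × ℂ} (hp : p ∈ Sg (rho a₀)) :
    Wr (-(starRingEnd ℂ) a₀) (ra α) (rt θ) p = Wr a₀ α θ p := by
  rw [← h.Wr_eq hp 0, Wr, vm_reflect, det2_swap, ← det2_sw, sw_sw, vm]
  simp

theorem continuousOn_Wr (h : Dat a₀ α θ 0) : ContinuousOn (Wr a₀ α θ) (Sg (rho a₀)) := by
  unfold Wr det2
  exact ((h.continuousOn_vp 1 0).mul (h.continuousOn_vm 1 1)).sub
    ((h.continuousOn_vp 1 1).mul (h.continuousOn_vm 1 0))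

end Dat

theorem sw_star_smul (c : ℂ) (v : Fin 2 → ℂ) :
    sw (star (c • v)) = (starRingEnd ℂ) c • sw (star v) := by
  ext i; fin_cases i <;> simp [sw]

theorem det2_smul_smul (c d : ℂ) (v u : Fin 2 → ℂ) :
    det2 (c • v) (d • u) = c * d * det2 v u := by
  simp [det2]; ring

theorem tendsto_det2 {v u : ℕ → Fin 2 → ℂ} {a b : Fin 2 → ℂ}
    (hv : ∀ i, Filter.Tendsto (fun n => v n i) Filter.atTop (nhds (a i)))
    (hu : ∀ i, Filter.Tendsto (fun n => u n i) Filter.atTop (nhds (b i))) :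
    Filter.Tendsto (fun n => det2 (v n) (u n)) Filter.atTop (nhds (det2 a b)) :=
  ((hv 0).mul (hu 1)).sub ((hv 1).mul (hu 0))

theorem eq_limit_of_pow_mul {g : ℕ → ℂ} {k c l : ℂ} (h : ∀ n, c = k ^ n * g n)
    (hg : Filter.Tendsto g Filter.atTop (nhds l)) (hk : k = 1) : c = l := by
  subst hk
  simp only [one_pow, one_mul] at h
  exact tendsto_nhds_unique (tendsto_const_nhds.congr h) hg

theorem eq_zero_of_pow_mul {g : ℕ → ℂ} {k c : ℂ} (h : ∀ n, c = k ^ n * g n)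
    (hg : Filter.Tendsto g Filter.atTop (nhds 0)) (hk : ‖k‖ ≤ 1) : c = 0 := by
  have h2 : Filter.Tendsto (fun _ : ℕ => c) Filter.atTop (nhds 0) := by
    refine squeeze_zero_norm (fun n => ?_) (tendsto_zero_iff_norm_tendsto_zero.1 hg)
    rw [h n, norm_mul, norm_pow]
    exact mul_le_of_le_one_left (norm_nonneg _) (pow_le_one₀ (norm_nonneg _) hk)
  exact tendsto_nhds_unique tendsto_const_nhds h2

theorem conj_eq_inv_of_norm {z : ℂ} (h : ‖z‖ = 1) : (starRingEnd ℂ) z = z⁻¹ := by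
  rw [Complex.inv_def, normSq_eq_norm_sq, h]; simp

theorem inv_snd_mem {r : ℝ} {p : ℂ × ℂ} (hp : p ∈ Sg r) (hk : ‖p.2‖ = 1) :
    (p.1, p.2⁻¹) ∈ Sg r := by
  refine ⟨hp.1, inv_ne_zero hp.2.1, ?_, hp.2.2.2.1, hp.2.2.2.2.1, ?_⟩
  · rw [norm_inv, hk, inv_one]
  · rw [hp.2.2.2.2.2, inv_inv, add_comm p.2]

namespace Dat
variable {a₀ : ℂ} {α : ℤ → ℂ} {θ : ℤ → ℝ}

theorem tendsto_sw_star (h : Dat a₀ α θ 0) {p : ℂ × ℂ} (hp : p ∈ Sg (rho a₀)) (i : Fin 2) :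
    Filter.Tendsto (fun n => sw (star (mj a₀ α θ p n)) i) Filter.atTop
      (nhds (sw (star (ev a₀ p)) i)) := by
  have := fun j => (h.mj_tendsto hp j).star
  fin_cases i
  · exact this 1
  · exact this 0

theorem det2_vp_vp (h : Dat a₀ α θ 0) {p q : ℂ × ℂ} (hp : p ∈ Sg (rho a₀)) (hq : q ∈ Sg (rho a₀))
    (h1 : q.1 = p.1) (h2 : q.2 * p.2 = 1) :
    det2 (vp a₀ α θ q 1) (vp a₀ α θ p 1) = det2 (ev a₀ q) (ev a₀ p) := by
  refine eq_limit_of_pow_mul (fun n => ?_)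
    (tendsto_det2 (h.mj_tendsto hq) (h.mj_tendsto hp)) h2
  rw [(h1 ▸ h.isSol_vp hq : IsSol α θ p.1 _).det2_eq h.coin hp.1 (h.isSol_vp hp) 1 (n : ℤ),
    vp_natCast, vp_natCast, det2_smul_smul, mul_pow]

theorem det2_vp_star (h : Dat a₀ α θ 0) {p q : ℂ × ℂ} (hp : p ∈ Sg (rho a₀))
    (hq : q ∈ Sg (rho a₀)) (h1 : q.1 = p.1) (hw : ‖p.1‖ = 1) (n : ℕ) :
    det2 (vp a₀ α θ q 1) (sw (star (vp a₀ α θ p 1))) =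
      (q.2 * (starRingEnd ℂ) p.2) ^ n * det2 (mj a₀ α θ q n) (sw (star (mj a₀ α θ p n))) := by
  rw [(h1 ▸ h.isSol_vp hq : IsSol α θ p.1 _).det2_eq h.coin hp.1
    ((h.isSol_vp hp).sw_star (conj_eq_inv_of_norm hw)) 1 (n : ℤ),
    vp_natCast, vp_natCast, sw_star_smul, det2_smul_smul, map_pow, mul_pow]

theorem det2_vp_star_self (h : Dat a₀ α θ 0) {p : ℂ × ℂ} (hp : p ∈ Sg (rho a₀))
    (hw : ‖p.1‖ = 1) (hk : ‖p.2‖ = 1) :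
    det2 (vp a₀ α θ p 1) (sw (star (vp a₀ α θ p 1))) = det2 (ev a₀ p) (sw (star (ev a₀ p))) := by
  refine eq_limit_of_pow_mul (h.det2_vp_star hp hp rfl hw)
    (tendsto_det2 (h.mj_tendsto hp) (h.tendsto_sw_star hp)) ?_
  rw [conj_eq_inv_of_norm hk, mul_inv_cancel₀ hp.2.1]

theorem ev_mul (h : Dat a₀ α θ 0) {p : ℂ × ℂ} (hp : p ∈ Sg (rho a₀))
    (hw : ‖p.1‖ = 1) (hk : ‖p.2‖ = 1) :
    (rho a₀ * p.2⁻¹ - p.1) * (starRingEnd ℂ) (rho a₀ * p.2 - p.1) = a₀ * (starRingEnd ℂ) a₀ := by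
  have h1 := rho_sq_complex h.lt_one
  have h2 := hp.2.2.2.2.2
  have h3 := mul_inv_cancel₀ hp.1
  have h4 := mul_inv_cancel₀ hp.2.1
  simp only [map_sub, map_mul, conj_ofReal, conj_eq_inv_of_norm hk, conj_eq_inv_of_norm hw]
  linear_combination (-(rho a₀ : ℂ) * p.2⁻¹) * h2 + h3 - (rho a₀ : ℂ) ^ 2 * h4 - h1

theorem det2_vp_star_inv (h : Dat a₀ α θ 0) {p : ℂ × ℂ} (hp : p ∈ Sg (rho a₀))
    (hw : ‖p.1‖ = 1) (hk : ‖p.2‖ = 1) :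
    det2 (vp a₀ α θ (p.1, p.2⁻¹) 1) (sw (star (vp a₀ α θ p 1))) = 0 := by
  have hq := inv_snd_mem hp hk
  refine eq_zero_of_pow_mul (h.det2_vp_star hp hq rfl hw) ?_ ?_
  · have := tendsto_det2 (h.mj_tendsto hq) (h.tendsto_sw_star hp)
    convert this
    have h2 := h.ev_mul hp hw hk
    simp only [det2, sw, ev, Pi.star_apply, RCLike.star_def, Matrix.cons_val_zero,
      Matrix.cons_val_one]
    rw [h2]; simp
  · simp [hk]

/-- The coefficient of the right Jost solution in the expansion of the left one. -/
def _root_.Sc (a₀ : ℂ) (α : ℤ → ℂ) (θ : ℤ → ℝ) (p : ℂ × ℂ) : ℂ :=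
  det2 (vp a₀ α θ (p.1, p.2⁻¹) 1) (vm a₀ α θ p 1)

theorem det2_vp_inv (h : Dat a₀ α θ 0) {p : ℂ × ℂ} (hp : p ∈ Sg (rho a₀)) (hk : ‖p.2‖ = 1) :
    det2 (vp a₀ α θ (p.1, p.2⁻¹) 1) (vp a₀ α θ p 1) = a₀ * rho a₀ * (p.2 - p.2⁻¹) := by
  rw [h.det2_vp_vp hp (inv_snd_mem hp hk) rfl (inv_mul_cancel₀ hp.2.1)]
  simp [det2, ev]; ring

/-- Expansion of the left Jost solution in the right ones. -/
theorem vm_expand (h : Dat a₀ α θ 0) {p : ℂ × ℂ} (hp : p ∈ Sg (rho a₀)) (hk : ‖p.2‖ = 1) (x : ℤ)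
    (i : Fin 2) :
    a₀ * rho a₀ * (p.2 - p.2⁻¹) * vm a₀ α θ p x i =
      -Wr a₀ α θ p * vp a₀ α θ (p.1, p.2⁻¹) x i + Sc a₀ α θ p * vp a₀ α θ p x i := by
  have hq := inv_snd_mem hp hk
  rw [← h.det2_vp_inv hp hk, Sc, ← h.Wr_eq hp x,
    (h.isSol_vp hq).det2_eq h.coin hp.1 (h.isSol_vm hp) 1 x,
    (h.isSol_vp hq).det2_eq h.coin hp.1 (h.isSol_vp hp) 1 x]
  fin_cases i <;> simp [det2] <;> ring

theorem det2_vm_star_self (h : Dat a₀ α θ 0) {p : ℂ × ℂ} (hp : p ∈ Sg (rho a₀))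
    (hw : ‖p.1‖ = 1) (hk : ‖p.2‖ = 1) :
    det2 (vm a₀ α θ p 1) (sw (star (vm a₀ α θ p 1))) =
      -det2 (ev a₀ p) (sw (star (ev a₀ p))) := by
  have hr := h.reflect
  have hp' : p ∈ Sg (rho (-(starRingEnd ℂ) a₀)) := by rwa [rho_neg_conj]
  rw [(h.isSol_vm hp).det2_eq h.coin hp.1
    ((h.isSol_vm hp).sw_star (conj_eq_inv_of_norm hw)) 1 0]
  have h1 := hr.det2_vp_star_self hp' hw hk
  have h2 : ∀ v : Fin 2 → ℂ, sw (star (sw v)) = sw (sw (star v)) := fun v => by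
    ext i; fin_cases i <;> simp [sw]
  rw [vm, h2, det2_sw, sub_zero, h1]
  simp [det2, ev, sw, rho_neg_conj, mul_comm]

theorem det2_star_self (v : Fin 2 → ℂ) :
    det2 v (sw (star v)) = ((‖v 0‖ ^ 2 - ‖v 1‖ ^ 2 : ℝ) : ℂ) := by
  simp [det2, sw, Complex.mul_conj, normSq_eq_norm_sq]

theorem Wr_lower (h : Dat a₀ α θ 0) {p : ℂ × ℂ} (hp : p ∈ Sg (rho a₀))
    (hw : ‖p.1‖ = 1) (hk : ‖p.2‖ = 1) :
    ‖a₀‖ * ‖a₀ * rho a₀ * (p.2 - p.2⁻¹)‖ ≤ 2 * ‖Wr a₀ α θ p‖ := by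
  have hq := inv_snd_mem hp hk
  set a := vp a₀ α θ (p.1, p.2⁻¹) 1 with ha
  set b := vp a₀ α θ p 1 with hb
  set c := vm a₀ α θ p 1 with hc
  set W := Wr a₀ α θ p with hW
  set S := Sc a₀ α θ p with hS
  set D := a₀ * rho a₀ * (p.2 - p.2⁻¹) with hD
  set d := ‖(rho a₀ : ℂ) * p.2 - p.1‖ with hd
  set d' := ‖(rho a₀ : ℂ) * p.2⁻¹ - p.1‖ with hd'
  have hdd : d' * d = ‖a₀‖ ^ 2 := by
    have := congrArg norm (h.ev_mul hp hw hk)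
    rwa [norm_mul, norm_mul, norm_conj, norm_conj, ← sq] at this
  have hr := rho_pos h.lt_one
  have hr1 := rho_lt_one h.pos
  have hd'2 : d' ≤ 2 := by
    refine (norm_sub_le _ _).trans ?_
    rw [norm_mul, norm_inv, hk, hw, norm_real, Real.norm_of_nonneg hr.le]; linarith
  have hd0 : 0 ≤ d := norm_nonneg _
  have hd'0 : 0 ≤ d' := norm_nonneg _
  have ha0 := h.pos
  have qb : ‖b 0‖ ^ 2 - ‖b 1‖ ^ 2 = ‖a₀‖ ^ 2 - d ^ 2 := by
    have := h.det2_vp_star_self hp hw hk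
    rw [det2_star_self, det2_star_self] at this
    exact_mod_cast this
  have qa : ‖a 0‖ ^ 2 - ‖a 1‖ ^ 2 = ‖a₀‖ ^ 2 - d' ^ 2 := by
    have := h.det2_vp_star_self hq hw (by rw [norm_inv, hk, inv_one])
    rw [det2_star_self, det2_star_self] at this
    exact_mod_cast this
  have qc : ‖c 0‖ ^ 2 - ‖c 1‖ ^ 2 = -(‖a₀‖ ^ 2 - d ^ 2) := by
    have := h.det2_vm_star_self hp hw hk
    rw [det2_star_self, det2_star_self] at this
    exact_mod_cast this
  have hab : a 0 * (starRingEnd ℂ) (b 0) - a 1 * (starRingEnd ℂ) (b 1) = 0 := by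
    have := h.det2_vp_star_inv hp hw hk
    simpa [det2, sw] using this
  have hab' : b 0 * (starRingEnd ℂ) (a 0) - b 1 * (starRingEnd ℂ) (a 1) = 0 := by
    have := congrArg (starRingEnd ℂ) hab
    simp only [map_sub, map_mul, map_zero, conj_conj] at this
    linear_combination this
  have hexp := h.vm_expand hp hk 1
  have key : ‖D‖ ^ 2 * (‖c 0‖ ^ 2 - ‖c 1‖ ^ 2) =
      ‖W‖ ^ 2 * (‖a 0‖ ^ 2 - ‖a 1‖ ^ 2) + ‖S‖ ^ 2 * (‖b 0‖ ^ 2 - ‖b 1‖ ^ 2) := by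
    have e0 := hexp 0
    have e1 := hexp 1
    have f0 := congrArg (starRingEnd ℂ) e0
    have f1 := congrArg (starRingEnd ℂ) e1
    simp only [map_add, map_mul, map_neg] at f0 f1
    have hn : ∀ z : ℂ, ((‖z‖ : ℝ) : ℂ) ^ 2 = z * (starRingEnd ℂ) z := fun z => by
      rw [Complex.mul_conj, normSq_eq_norm_sq]; simp
    apply ofReal_injective
    push_cast
    simp only [hn]
    have hDc : (starRingEnd ℂ) D = (starRingEnd ℂ) a₀ * (starRingEnd ℂ) (rho a₀ : ℂ) *
        (starRingEnd ℂ) (p.2 - p.2⁻¹) := by rw [hD, map_mul, map_mul]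
    rw [← hDc] at f0 f1
    linear_combination ((starRingEnd ℂ) D * (starRingEnd ℂ) (c 0)) * e0 -
      ((starRingEnd ℂ) D * (starRingEnd ℂ) (c 1)) * e1 + (-W * a 0 + S * b 0) * f0 -
      (-W * a 1 + S * b 1) * f1 - W * (starRingEnd ℂ) S * hab - S * (starRingEnd ℂ) W * hab'
  rw [qa, qb, qc] at key
  by_cases hdeq : d = d'
  · have hD0 : D = 0 := by
      have h1 : d ^ 2 = d' ^ 2 := by rw [hdeq]
      rw [hd, hd', ← normSq_eq_norm_sq, ← normSq_eq_norm_sq, ← conj_eq_inv_of_norm hk] at h1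
      simp only [normSq_apply, sub_re, sub_im, mul_re, mul_im, ofReal_re, ofReal_im, conj_re,
        conj_im] at h1
      have h2 : rho a₀ * (p.2.im * p.1.im) = 0 := by linarith
      have h3 : p.1.im ≠ 0 := by
        intro h3
        have h4 := congrArg re hp.2.2.2.2.2
        rw [← conj_eq_inv_of_norm hk, ← conj_eq_inv_of_norm hw] at h4
        simp only [add_re, conj_re, mul_re, ofReal_re, ofReal_im, zero_mul, sub_zero] at h4
        have h5 : normSq p.1 = 1 := by rw [normSq_eq_norm_sq, hw]; norm_num
        have h6 : normSq p.2 = 1 := by rw [normSq_eq_norm_sq, hk]; norm_num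
        rw [normSq_apply] at h5 h6
        have h7 : p.1.re = rho a₀ * p.2.re := by linarith
        rw [h3, h7] at h5
        nlinarith [sq_nonneg p.2.im, sq_nonneg (p.2.re), mul_pos hr hr]
      have h4 : p.2.im = 0 := by
        rcases mul_eq_zero.1 h2 with h2 | h2
        · exact absurd h2 hr.ne'
        · exact (mul_eq_zero.1 h2).resolve_right h3
      have h5 : p.2⁻¹ = p.2 := by
        rw [← conj_eq_inv_of_norm hk]; exact conj_eq_iff_im.2 h4
      rw [hD, h5]; simp
    rw [hD0, norm_zero, mul_zero]; positivity
  · have k2 : (d - d') * (‖W‖ ^ 2 * d' - (‖S‖ ^ 2 + ‖D‖ ^ 2) * d) = 0 := by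
      rw [← hdd] at key; linear_combination -key
    have k3 : ‖W‖ ^ 2 * d' = (‖S‖ ^ 2 + ‖D‖ ^ 2) * d := by
      linarith [(mul_eq_zero.1 k2).resolve_left (sub_ne_zero.2 hdeq)]
    have k4 : (‖a₀‖ * ‖D‖) ^ 2 ≤ (2 * ‖W‖) ^ 2 := by
      calc (‖a₀‖ * ‖D‖) ^ 2 = ‖D‖ ^ 2 * (d' * d) := by rw [hdd]; ring
        _ ≤ d' * ((‖S‖ ^ 2 + ‖D‖ ^ 2) * d) := by
            nlinarith [mul_nonneg (mul_nonneg hd'0 hd0) (sq_nonneg ‖S‖)]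
        _ = ‖W‖ ^ 2 * d' ^ 2 := by rw [← k3]; ring
        _ ≤ ‖W‖ ^ 2 * 2 ^ 2 := by gcongr
        _ = _ := by ring
    exact abs_le_of_sq_le_sq' k4 (by positivity) |>.2

end Dat

theorem qw_jev {α : ℤ → ℂ} {θ : ℤ → ℝ} (hα : ∀ x, ‖α x‖ < 1) {w : ℂ} (hw : w ≠ 0)
    {v F : ℤ → Fin 2 → ℂ}
    (hv : ∀ x, v (x + 1) = (Tf (α x) (θ x) w).mulVec (v x) + F x) (x : ℤ) :
    qw (coinOf α θ) (Jev v) x = w • Jev v x +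
      ![exp (θ (x - 1) * I) * (starRingEnd ℂ) (α (x - 1)) * F (x - 1) 0 - w * F (x - 1) 1,
        exp (θ (x + 1) * I) * rho (α (x + 1)) * F (x + 1) 0] := by
  have h3 : w * w⁻¹ = 1 := mul_inv_cancel₀ hw
  have h4 : ∀ t : ℝ, exp (t * I) * exp (-(t * I)) = 1 := fun t => by rw [← exp_add]; simp
  have h5 : ∀ y, (rho (α y) : ℂ) ^ 2 = 1 - α y * (starRingEnd ℂ) (α y) :=
    fun y => rho_sq_complex (hα y)
  have h6 : ∀ y, (rho (α y) : ℂ) * (rho (α y) : ℂ)⁻¹ = 1 := fun y =>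
    mul_inv_cancel₀ (ofReal_ne_zero.2 (rho_pos (hα y)).ne')
  have e1 := hv (x - 1)
  have e2 := hv (x + 1)
  rw [sub_add_cancel] at e1
  ext i
  fin_cases i
  · have e10 := congrFun e1 0
    have e11 := congrFun e1 1
    simp [Tf, dotProduct, Fin.sum_univ_two] at e10 e11
    simp [qw, coinOf, coinMat, Jev, Matrix.mulVec, dotProduct, Fin.sum_univ_two]
    have h7 := h6 (x - 1)
    have h8 := h5 (x - 1)
    have h9 := h4 (θ (x - 1))
    generalize (rho (α (x - 1)) : ℂ)⁻¹ = s at *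
    rw [e10, e11]
    linear_combination (s * (starRingEnd ℂ) (α (x - 1)) * w * v (x - 1) 0) * h9 +
      (-v (x - 1) 1 * exp (θ (x - 1) * I) * s) * h3 +
      exp (θ (x - 1) * I) * v (x - 1) 1 * s * h8 -
      exp (θ (x - 1) * I) * v (x - 1) 1 * rho (α (x - 1)) * h7
  · have e10 := congrFun e2 0
    simp [Tf, dotProduct, Fin.sum_univ_two] at e10
    simp [qw, coinOf, coinMat, Jev, Matrix.mulVec, dotProduct, Fin.sum_univ_two]
    have h7 := h6 (x + 1)
    have h9 := h4 (θ (x + 1))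
    generalize (rho (α (x + 1)) : ℂ)⁻¹ = s at *
    rw [e10]
    linear_combination (rho (α (x + 1)) * s * w * v (x + 1) 0) * h9 +
      (w * v (x + 1) 0 + exp (θ (x + 1) * I) * α (x + 1) * v (x + 1) 1) * h7

namespace Dat
variable {a₀ : ℂ} {α : ℤ → ℂ} {θ : ℤ → ℝ}

theorem vp_ne_zero (h : Dat a₀ α θ 0) {p : ℂ × ℂ} (hp : p ∈ Sg (rho a₀)) (x : ℤ) :
    vp a₀ α θ p x ≠ 0 := by
  intro h0
  have h1 : ∀ n : ℕ, mj a₀ α θ p n = 0 := fun n => by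
    have := (h.isSol_vp hp).eq_zero h.coin hp.1 h0 n
    rw [vp_natCast] at this
    exact (smul_eq_zero.1 this).resolve_left (pow_ne_zero _ hp.2.1)
  have h2 := h.mj_tendsto hp 0
  simp only [h1] at h2
  have h3 := tendsto_nhds_unique h2 tendsto_const_nhds
  simp [ev] at h3
  have := h.pos
  rw [h3] at this
  simp at this

theorem vm_ne_zero (h : Dat a₀ α θ 0) {p : ℂ × ℂ} (hp : p ∈ Sg (rho a₀)) (x : ℤ) :
    vm a₀ α θ p x ≠ 0 := by
  intro h0
  refine h.reflect.vp_ne_zero (by rwa [rho_neg_conj]) (1 - x) ?_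
  rw [← sw_sw (vp _ _ _ _ _)]
  change sw (vm a₀ α θ p x) = 0
  rw [h0]; ext i; fin_cases i <;> rfl

theorem vp_le (h : Dat a₀ α θ 0) : ∃ C, 0 ≤ C ∧ ∀ p ∈ Sg (rho a₀), ∀ (x : ℤ) (i : Fin 2), 0 ≤ x →
    ‖vp a₀ α θ p x i‖ ≤ C * ‖p.2‖ ^ x.natAbs := by
  obtain ⟨C, hC, hm⟩ := h.mj_bdd
  refine ⟨C, hC, fun p hp x i hx => ?_⟩
  obtain ⟨n, rfl⟩ := Int.eq_ofNat_of_zero_le hx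
  rw [vp_natCast, Pi.smul_apply, smul_eq_mul, norm_mul, norm_pow, Int.natAbs_natCast, mul_comm]
  exact mul_le_mul_of_nonneg_right (hm p hp n i) (by positivity)

theorem vm_le (h : Dat a₀ α θ 0) : ∃ C, 0 ≤ C ∧ ∀ p ∈ Sg (rho a₀), ∀ (x : ℤ) (i : Fin 2), x ≤ 1 →
    ‖vm a₀ α θ p x i‖ ≤ C * ‖p.2‖ ^ (1 - x).natAbs := by
  obtain ⟨C, hC, hm⟩ := h.reflect.vp_le
  rw [rho_neg_conj] at hm
  refine ⟨C, hC, fun p hp x i hx => ?_⟩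
  have := fun j => hm p hp (1 - x) j (by omega)
  fin_cases i
  · exact this 1
  · exact this 0

theorem exists_smul_of_Wr (h : Dat a₀ α θ 0) {p : ℂ × ℂ} (hp : p ∈ Sg (rho a₀))
    (h0 : Wr a₀ α θ p = 0) : ∃ c : ℂ, c ≠ 0 ∧ ∀ x, vp a₀ α θ p x = c • vm a₀ α θ p x := by
  have hvp := h.vp_ne_zero hp 1
  have hvm := h.vm_ne_zero hp 1
  have hex : ∃ c : ℂ, vp a₀ α θ p 1 = c • vm a₀ α θ p 1 := by
    rw [Wr, det2, sub_eq_zero] at h0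
    by_cases hm : vm a₀ α θ p 1 0 = 0
    · have hm1 : vm a₀ α θ p 1 1 ≠ 0 := fun hm1 => hvm (by ext i; fin_cases i <;> assumption)
      refine ⟨vp a₀ α θ p 1 1 / vm a₀ α θ p 1 1, ?_⟩
      rw [hm, mul_zero] at h0
      have := (mul_eq_zero.1 h0).resolve_right hm1
      ext i; fin_cases i
      · simp [hm, this]
      · simp [div_mul_cancel₀ _ hm1]
    · refine ⟨vp a₀ α θ p 1 0 / vm a₀ α θ p 1 0, ?_⟩
      ext i; fin_cases i
      · simp [div_mul_cancel₀ _ hm]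
      · simp only [Fin.mk_one, Pi.smul_apply, smul_eq_mul]
        field_simp
        linear_combination -h0
  obtain ⟨c, hc⟩ := hex
  refine ⟨c, ?_, fun x => ?_⟩
  · rintro rfl
    rw [zero_smul] at hc
    exact hvp hc
  · have := ((h.isSol_vp hp).sub ((h.isSol_vm hp).smul c)).eq_zero h.coin hp.1
      (y := 1) (by simp [hc]) x
    exact sub_eq_zero.1 this

theorem exists_of_Wr (h : Dat a₀ α θ 0) {p : ℂ × ℂ} (hp : p ∈ Sg (rho a₀))
    (h0 : Wr a₀ α θ p = 0) : ∃ u : ℤ → Fin 2 → ℂ, (∃ x, u x ≠ 0) ∧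
      (∀ x, qw (coinOf α θ) u x = p.1 • u x) ∧
      ∃ C, ∀ x i, ‖u x i‖ ≤ C * ‖p.2‖ ^ x.natAbs := by
  obtain ⟨c, hc, hcv⟩ := h.exists_smul_of_Wr hp h0
  obtain ⟨A, hA, hvp⟩ := h.vp_le
  obtain ⟨B, hB, hvm⟩ := h.vm_le
  have hk0 := norm_pos_iff.2 hp.2.1
  have hk1 := hp.2.2.1
  have hb : ∀ x i, ‖vp a₀ α θ p x i‖ ≤ (A + ‖c‖ * B) * ‖p.2‖ ^ x.natAbs := fun x i => by
    have hpos : 0 ≤ ‖p.2‖ ^ x.natAbs := by positivity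
    rcases le_total 0 x with hx | hx
    · refine (hvp p hp x i hx).trans ?_
      gcongr
      nlinarith [norm_nonneg c]
    · rw [hcv x, Pi.smul_apply, smul_eq_mul, norm_mul]
      have h2 : ‖p.2‖ ^ (1 - x).natAbs ≤ ‖p.2‖ ^ x.natAbs :=
        pow_le_pow_of_le_one hk0.le hk1 (by omega)
      have h3 := hvm p hp x i (by omega)
      have h4 : B * ‖p.2‖ ^ (1 - x).natAbs ≤ B * ‖p.2‖ ^ x.natAbs := by gcongr
      nlinarith [norm_nonneg c, mul_nonneg hA hpos,
        mul_le_mul_of_nonneg_left (h3.trans h4) (norm_nonneg c)]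
  have hC : 0 ≤ A + ‖c‖ * B := by positivity
  refine ⟨Jev (vp a₀ α θ p), ?_, fun x => ?_, (A + ‖c‖ * B) * ‖p.2‖⁻¹, fun x i => ?_⟩
  · by_contra! hcon
    refine h.vp_ne_zero hp 1 ?_
    have h1 := congrFun (hcon 1) 0
    have h2 := congrFun (hcon 0) 1
    ext i; fin_cases i
    · simpa [Jev] using h2
    · simpa [Jev] using h1
  · rw [qw_jev h.coin hp.1 (F := 0)]
    · ext i; fin_cases i <;> simp
    · intro x
      rw [(h.isSol_vp hp).forward h.coin hp.1 x]; simp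
  · have key : ∀ n m : ℕ, n ≤ m + 1 → ‖p.2‖ ^ m ≤ ‖p.2‖⁻¹ * ‖p.2‖ ^ n := fun n m hnm => by
      rw [← div_eq_inv_mul, le_div_iff₀ hk0, ← pow_succ]
      exact pow_le_pow_of_le_one hk0.le hk1 hnm
    rw [mul_assoc]
    fin_cases i
    · exact (hb x 1).trans (mul_le_mul_of_nonneg_left (key _ _ (by omega)) hC)
    · exact (hb (x + 1) 0).trans (mul_le_mul_of_nonneg_left (key _ _ (by omega)) hC)

theorem isResonance_of_Wr (h : Dat a₀ α θ 0) {p : ℂ × ℂ} (hp : p ∈ Sg (rho a₀))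
    (h0 : Wr a₀ α θ p = 0) (hk : ‖p.2‖ = 1) : IsResonance α θ p.1 := by
  obtain ⟨u, hu, hq, C, hC⟩ := h.exists_of_Wr hp h0
  refine ⟨u, hu, ⟨Real.sqrt (C ^ 2 + C ^ 2), fun x => ?_⟩, hq⟩
  simp only [hk, one_pow, mul_one] at hC
  unfold nrm2
  gcongr <;> apply hC

end Dat

theorem summable_pow_natAbs {q : ℝ} (h0 : 0 ≤ q) (h1 : q < 1) :
    Summable fun x : ℤ => q ^ x.natAbs := by
  refine Summable.of_nat_of_neg ?_ ?_ <;> simpa using summable_geometric_of_lt_one h0 h1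

theorem exists_lp {u : ℤ → Fin 2 → ℂ} {C q : ℝ} (h0 : 0 ≤ q) (h1 : q < 1)
    (hu : ∀ x i, ‖u x i‖ ≤ C * q ^ x.natAbs) :
    ∃ U : Hsp, ∀ x i, (U : ∀ _ : ℤ, EuclideanSpace ℂ (Fin 2)) x i = u x i := by
  refine ⟨⟨fun x => WithLp.toLp 2 (u x), memℓp_gen ?_⟩, fun x i => rfl⟩
  have hs := (summable_pow_natAbs (sq_nonneg q) (by nlinarith)).mul_left (2 * C ^ 2)
  refine Summable.of_nonneg_of_le (fun x => by positivity) (fun x => ?_) hs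
  have e : (2 : ENNReal).toReal = ((2 : ℕ) : ℝ) := by norm_num
  rw [e, Real.rpow_natCast, EuclideanSpace.norm_sq_eq, Fin.sum_univ_two]
  have h2 : ∀ i, ‖u x i‖ ^ 2 ≤ C ^ 2 * (q ^ 2) ^ x.natAbs := fun i => by
    rw [← pow_mul, mul_comm 2, pow_mul, ← mul_pow]
    exact pow_le_pow_left₀ (norm_nonneg _) (hu x i) 2
  have := h2 0
  have := h2 1
  simp only at *
  linarith

theorem bc_neg (r : ℝ) (s : ℤ) (ξ : ℝ) : bc r s (-ξ) = ((bc r s ξ).1, (bc r s ξ).2⁻¹) := by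
  have h : ch s (-ξ) = (ch s ξ)⁻¹ := by
    refine eq_inv_of_mul_eq_one_left ?_
    rw [ch_neg_right, ← ch_add]; simp
  simp [bc, sdisp, h]

/-- Data on the boundary of the spectral curve for which the amplitudes are regular. -/
structure Reg (a₀ : ℂ) (α : ℤ → ℂ) (θ : ℤ → ℝ) (k : ℕ) (s : ℤ) : Prop where
  dat : Dat a₀ α θ k
  sign : s = 1 ∨ s = -1
  reg : k = 1 ∨ k = 0 ∧ ∀ ξ, Wr a₀ α θ (bc (rho a₀) s ξ) ≠ 0

namespace Reg
variable {a₀ : ℂ} {α : ℤ → ℂ} {θ : ℤ → ℝ} {k : ℕ} {s : ℤ}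

theorem dat0 (h : Reg a₀ α θ k s) : Dat a₀ α θ 0 := h.dat.mono (Nat.zero_le _)

theorem mem (h : Reg a₀ α θ k s) (ξ : ℝ) : bc (rho a₀) s ξ ∈ Sg (rho a₀) :=
  bc_mem (rho_pos h.dat.lt_one) (rho_lt_one h.dat.pos) h.sign ξ

theorem mc (h : Reg a₀ α θ k s) (j : ℕ) : ∃ B, MC (rho a₀) (Set.range (bc (rho a₀) s))
    (fun F M => IsW j (F ∘ bc (rho a₀) s) M) j B :=
  mc_isW (rho_pos h.dat.lt_one) (rho_lt_one h.dat.pos) h.sign j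

theorem reflect (h : Reg a₀ α θ k s) : Reg (-(starRingEnd ℂ) a₀) (ra α) (rt θ) k s where
  dat := h.dat.reflect
  sign := h.sign
  reg := by
    rw [rho_neg_conj]
    refine h.reg.imp_right fun hr => ⟨hr.1, fun ξ => ?_⟩
    rw [h.dat0.Wr_reflect (h.mem ξ)]
    exact hr.2 ξ

theorem norm_fst (h : Reg a₀ α θ k s) (ξ : ℝ) : ‖(bc (rho a₀) s ξ).1‖ = 1 :=
  norm_bc_fst (rho_pos h.dat.lt_one) (rho_lt_one h.dat.pos) h.sign ξ

theorem norm_snd (ξ : ℝ) : ‖(bc (rho a₀) s ξ).2‖ = 1 := norm_ch _ _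

theorem isW_vp (h : Reg a₀ α θ k s) (x : ℤ) (i : Fin 2) :
    ∃ C, IsW k (fun ξ => vp a₀ α θ (bc (rho a₀) s ξ) x i) C := by
  obtain ⟨B, hB⟩ := h.mc k
  obtain ⟨C, hC⟩ := vp_bound hB h.dat.lt_one h.dat.summ_nat x
  exact ⟨C, hC i⟩

theorem isW_vm (h : Reg a₀ α θ k s) (x : ℤ) (i : Fin 2) :
    ∃ C, IsW k (fun ξ => vm a₀ α θ (bc (rho a₀) s ξ) x i) C := by
  have := fun i => h.reflect.isW_vp (1 - x) i
  rw [rho_neg_conj] at this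
  fin_cases i
  · exact this 1
  · exact this 0

theorem vp_le (h : Reg a₀ α θ k s) : ∃ C, 0 ≤ C ∧ ∀ (x : ℤ) (i : Fin 2), 0 ≤ x →
    IsW 0 (fun ξ => vp a₀ α θ (bc (rho a₀) s ξ) x i) C := by
  obtain ⟨B, hB⟩ := h.mc 0
  obtain ⟨C, hC0, hC⟩ := mj_bound hB h.dat.lt_one h.dat0.summ_nat
  refine ⟨C, hC0, fun x i hx => ?_⟩
  lift x to ℕ using hx
  refine (IsW.congr (IsW.mul (hB.pow x) (hC x i)) fun ξ => ?_).mono (by simp)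
  simp [vp_natCast]

theorem vm_le (h : Reg a₀ α θ k s) : ∃ C, 0 ≤ C ∧ ∀ (x : ℤ) (i : Fin 2), x ≤ 1 →
    IsW 0 (fun ξ => vm a₀ α θ (bc (rho a₀) s ξ) x i) C := by
  obtain ⟨C, hC0, hC⟩ := h.reflect.vp_le
  rw [rho_neg_conj] at hC
  refine ⟨C, hC0, fun x i hx => ?_⟩
  have := fun i => hC (1 - x) i (by omega)
  fin_cases i
  · exact this 1
  · exact this 0

theorem isW_Wr (h : Reg a₀ α θ k s) : ∃ C, IsW k (fun ξ => Wr a₀ α θ (bc (rho a₀) s ξ)) C := by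
  obtain ⟨_, h1⟩ := h.isW_vp 1 0
  obtain ⟨_, h2⟩ := h.isW_vp 1 1
  obtain ⟨_, h3⟩ := h.isW_vm 1 0
  obtain ⟨_, h4⟩ := h.isW_vm 1 1
  exact ⟨_, (IsW.ncu k).sub (h1.mul h4) (h2.mul h3)⟩

theorem isW_Sc (h : Reg a₀ α θ k s) : ∃ C, IsW k (fun ξ => Sc a₀ α θ (bc (rho a₀) s ξ)) C := by
  obtain ⟨_, h1⟩ := h.isW_vp 1 0
  obtain ⟨_, h2⟩ := h.isW_vp 1 1
  obtain ⟨_, h3⟩ := h.isW_vm 1 0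
  obtain ⟨_, h4⟩ := h.isW_vm 1 1
  refine ⟨_, IsW.congr ((IsW.ncu k).sub (h1.comp_neg.mul h4) (h2.comp_neg.mul h3)) fun ξ => ?_⟩
  rw [bc_neg]
  rfl

theorem Wr_lower (h : Reg a₀ α θ k s) (ξ : ℝ) :
    ‖a₀‖ * ‖a₀‖ * rho a₀ / 2 * ‖ch 2 ξ - 1‖ ≤ ‖Wr a₀ α θ (bc (rho a₀) s ξ)‖ := by
  have h1 := h.dat0.Wr_lower (h.mem ξ) (h.norm_fst ξ) (norm_snd ξ)
  have h2 : ‖(bc (rho a₀) s ξ).2 - (bc (rho a₀) s ξ).2⁻¹‖ = ‖ch 2 ξ - 1‖ := by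
    change ‖ch s ξ - (ch s ξ)⁻¹‖ = _
    rw [ch_two_eq]
    have h3 := ch_ne_zero 1 ξ
    rcases h.sign with rfl | rfl
    · rw [show ch 1 ξ - (ch 1 ξ)⁻¹ = (ch 1 ξ)⁻¹ * ((ch 1 ξ - 1) * (ch 1 ξ + 1)) by
        field_simp; ring, norm_mul, norm_inv, norm_ch, inv_one, one_mul]
    · rw [ch_zpow, _root_.zpow_neg_one, inv_inv, show (ch 1 ξ)⁻¹ - ch 1 ξ =
        -(ch 1 ξ)⁻¹ * ((ch 1 ξ - 1) * (ch 1 ξ + 1)) by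
        field_simp; ring, norm_mul, norm_neg, norm_inv, norm_ch, inv_one, one_mul]
  rw [norm_mul, norm_mul, h2, norm_real, Real.norm_of_nonneg (rho_pos h.dat.lt_one).le] at h1
  linarith

theorem quot (h : Reg a₀ α θ k s) {F : ℝ → ℂ} {A : ℝ} (hF : IsW k F A)
    (h0 : Wr a₀ α θ (bc (rho a₀) s 0) = 0 → F 0 = 0)
    (hpi : Wr a₀ α θ (bc (rho a₀) s Real.pi) = 0 → F Real.pi = 0) :
    ∃ (R : ℝ → ℂ) (M : ℝ), IsW 0 R M ∧ ∀ ξ, R ξ * Wr a₀ α θ (bc (rho a₀) s ξ) = F ξ := by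
  obtain ⟨A, hA⟩ := h.isW_Wr
  have ha := h.dat.pos
  have hr := rho_pos h.dat.lt_one
  rcases h.reg with rfl | ⟨rfl, hr⟩
  · exact hA.quot hF (by positivity) h.Wr_lower h0 hpi
  · exact hA.quot_of_ne hF hr

theorem snd_pi (h : Reg a₀ α θ k s) : ch s Real.pi = -1 := by
  rw [ch_zpow, ch_one_pi]
  rcases h.sign with rfl | rfl <;> norm_num

theorem snd_zero : ch s 0 = 1 := by
  rw [ch_zpow, ch_one_zero, _root_.one_zpow]

theorem exists_T (h : Reg a₀ α θ k s) : ∃ (T : ℝ → ℂ) (M : ℝ), IsW 0 T M ∧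
    ∀ ξ, T ξ * Wr a₀ α θ (bc (rho a₀) s ξ) = ch s ξ ^ 2 - 1 := by
  have hF : IsW k (fun ξ => ch s ξ ^ 2 - 1) _ :=
    IsW.congr ((IsW.ncu k).sub (IsW.char 1 (2 * s)) (IsW.const 1)) fun ξ => by
      rw [ch_zpow, mul_comm 2 s, _root_.zpow_mul, ← ch_zpow, one_mul]; rfl
  exact h.quot hF (fun _ => by rw [snd_zero]; ring) (fun _ => by rw [h.snd_pi]; ring)

theorem exists_R (h : Reg a₀ α θ k s) : ∃ (R : ℝ → ℂ) (M : ℝ), IsW 0 R M ∧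
    ∀ ξ, R ξ * Wr a₀ α θ (bc (rho a₀) s ξ) = Sc a₀ α θ (bc (rho a₀) s ξ) := by
  obtain ⟨A, hA⟩ := h.isW_Sc
  have key : ∀ ξ, (ch s ξ)⁻¹ = ch s ξ → Sc a₀ α θ (bc (rho a₀) s ξ) = Wr a₀ α θ (bc (rho a₀) s ξ) :=
    fun ξ hξ => by
      have : ((bc (rho a₀) s ξ).1, (bc (rho a₀) s ξ).2⁻¹) = bc (rho a₀) s ξ := by
        rw [show (bc (rho a₀) s ξ).2⁻¹ = (bc (rho a₀) s ξ).2 from hξ]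
      rw [Sc, this, Wr]
  exact h.quot hA (fun h0 => by rw [key _ (by rw [snd_zero, inv_one]), h0])
    (fun h0 => by rw [key _ (by rw [h.snd_pi]; norm_num), h0])

/-- Regularized amplitudes exist with uniform bounds. -/
def _root_.Amp (a₀ : ℂ) (α : ℤ → ℂ) (θ : ℤ → ℝ) (s : ℤ) (F : ℂ × ℂ → ℂ) (C : ℝ) : Prop :=
  ∃ H, IsW 0 H C ∧ ∀ ξ, H ξ * Wr a₀ α θ (bc (rho a₀) s ξ) =
    (ch s ξ ^ 2 - 1) * F (bc (rho a₀) s ξ)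

theorem amp_right (h : Reg a₀ α θ k s) : ∃ C, ∀ (x y : ℤ) (i j : Fin 2), 0 ≤ y → 0 ≤ x →
    Amp a₀ α θ s (fun p => vp a₀ α θ p x i * vm a₀ α θ p y j) C := by
  obtain ⟨C, hC0, hC⟩ := h.vp_le
  obtain ⟨R, M, hR, hRW⟩ := h.exists_R
  refine ⟨_, fun x y i j hy hx => ⟨_, (((IsW.char (k := 0) ((a₀ * rho a₀ : ℂ)⁻¹) s).mul (hC x i hx)).mul
    ((IsW.ncu 0).sub (hR.mul (hC y j hy)) (hC y j hy).comp_neg)), fun ξ => ?_⟩⟩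
  have h1 := h.dat0.vm_expand (h.mem ξ) (norm_snd ξ) y j
  rw [← hRW ξ] at h1
  rw [bc_neg]
  have h2 : (a₀ * rho a₀ : ℂ)⁻¹ * (a₀ * rho a₀) = 1 := by
    refine inv_mul_cancel₀ (mul_ne_zero (norm_pos_iff.1 h.dat.pos) ?_)
    exact ofReal_ne_zero.2 (rho_pos h.dat.lt_one).ne'
  have h3 : ch s ξ * (ch s ξ)⁻¹ = 1 := mul_inv_cancel₀ (ch_ne_zero _ _)
  have h4 : (bc (rho a₀) s ξ).2 = ch s ξ := rfl
  rw [h4] at h1 ⊢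
  generalize (a₀ * rho a₀ : ℂ)⁻¹ = e at *
  linear_combination (-e * ch s ξ * vp a₀ α θ (bc (rho a₀) s ξ) x i) * h1 +
    (ch s ξ * (ch s ξ - (ch s ξ)⁻¹) * vp a₀ α θ (bc (rho a₀) s ξ) x i *
      vm a₀ α θ (bc (rho a₀) s ξ) y j) * h2 -
    vp a₀ α θ (bc (rho a₀) s ξ) x i * vm a₀ α θ (bc (rho a₀) s ξ) y j * h3

theorem amp_mid (h : Reg a₀ α θ k s) : ∃ C, ∀ (x y : ℤ) (i j : Fin 2), y ≤ 1 → 0 ≤ x →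
    Amp a₀ α θ s (fun p => vp a₀ α θ p x i * vm a₀ α θ p y j) C := by
  obtain ⟨C, hC0, hC⟩ := h.vp_le
  obtain ⟨C', hC0', hC'⟩ := h.vm_le
  obtain ⟨T, M, hT, hTW⟩ := h.exists_T
  refine ⟨_, fun x y i j hy hx => ⟨_, hT.mul ((hC x i hx).mul (hC' y j hy)), fun ξ => ?_⟩⟩
  rw [← hTW]; ring

theorem amp_left (h : Reg a₀ α θ k s) : ∃ C, ∀ (x y : ℤ) (i j : Fin 2), y ≤ 1 → x ≤ 1 →
    Amp a₀ α θ s (fun p => vp a₀ α θ p x i * vm a₀ α θ p y j) C := by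
  obtain ⟨C, hC⟩ := h.reflect.amp_right
  have h1 : ∀ (v : Fin 2 → ℂ) (i : Fin 2), sw v (1 - i) = v i := fun v i => by
    fin_cases i <;> rfl
  refine ⟨C, fun x y i j hy hx => ?_⟩
  obtain ⟨H, hH, hW⟩ := hC (1 - y) (1 - x) (1 - j) (1 - i) (by omega) (by omega)
  refine ⟨H, hH, fun ξ => ?_⟩
  have := hW ξ
  simp only at this ⊢
  rw [rho_neg_conj, h.dat0.Wr_reflect (h.mem ξ), vm_reflect, h1, sub_sub_cancel] at this
  rw [this, vm]
  conv_rhs => rw [← h1 (sw _) j, sw_sw]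
  ring

theorem amp (h : Reg a₀ α θ k s) : ∃ C, ∀ (x y : ℤ) (i j : Fin 2), y ≤ x →
    Amp a₀ α θ s (fun p => vp a₀ α θ p x i * vm a₀ α θ p y j) C := by
  obtain ⟨A, hA⟩ := h.amp_right
  obtain ⟨B, hB⟩ := h.amp_mid
  obtain ⟨D, hD⟩ := h.amp_left
  have mono : ∀ {F : ℂ × ℂ → ℂ} {c c' : ℝ}, Amp a₀ α θ s F c → c ≤ c' → Amp a₀ α θ s F c' :=
    fun ⟨H, h1, h2⟩ hc => ⟨H, h1.mono hc, h2⟩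
  refine ⟨max A (max B D), fun x y i j hxy => ?_⟩
  rcases lt_or_ge 1 y with hy | hy
  · exact mono (hA x y i j (by omega) (by omega)) (le_max_left _ _)
  · rcases lt_or_ge x 0 with hx | hx
    · exact mono (hD x y i j hy (by omega)) (by simp)
    · exact mono (hB x y i j hy hx) (by simp)

end Reg

/-- The site of the transfer recursion at which a unit source at `(y, j)` acts. -/
def sn (y : ℤ) (j : Fin 2) : ℤ := if j = 0 then y - 1 else y + 1

/-- The source vector of the transfer recursion for a unit source at `(y, j)`. -/
def sv (α : ℤ → ℂ) (θ : ℤ → ℝ) (w : ℂ) (y : ℤ) (j : Fin 2) : Fin 2 → ℂ :=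
  if j = 0 then ![0, -w⁻¹] else
    ((rho (α (y + 1)) : ℝ) : ℂ)⁻¹ • ![exp (-(θ (y + 1) * I)), w⁻¹ * (starRingEnd ℂ) (α (y + 1))]

/-- The Green function of the transfer recursion, multiplied by the Wronskian. -/
def gn (a₀ : ℂ) (α : ℤ → ℂ) (θ : ℤ → ℝ) (p : ℂ × ℂ) (n : ℤ) (F : Fin 2 → ℂ) (x : ℤ) : Fin 2 → ℂ :=
  if n + 1 ≤ x then det2 F (vm a₀ α θ p (n + 1)) • vp a₀ α θ p x
  else -det2 (vp a₀ α θ p (n + 1)) F • vm a₀ α θ p x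

/-- The Green function of the walk, multiplied by the Wronskian. -/
def gk (a₀ : ℂ) (α : ℤ → ℂ) (θ : ℤ → ℝ) (p : ℂ × ℂ) (y : ℤ) (j : Fin 2) : ℤ → Fin 2 → ℂ :=
  Jev (gn a₀ α θ p (sn y j) (sv α θ p.1 y j))

namespace Dat
variable {a₀ : ℂ} {α : ℤ → ℂ} {θ : ℤ → ℝ}

theorem gn_rec (h : Dat a₀ α θ 0) {p : ℂ × ℂ} (hp : p ∈ Sg (rho a₀)) (n : ℤ) (F : Fin 2 → ℂ)
    (x : ℤ) : gn a₀ α θ p n F (x + 1) = (Tf (α x) (θ x) p.1).mulVec (gn a₀ α θ p n F x) +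
      if x = n then Wr a₀ α θ p • F else 0 := by
  have h1 := (h.isSol_vp hp).forward h.coin hp.1 x
  have h2 := (h.isSol_vm hp).forward h.coin hp.1 x
  rcases lt_trichotomy x n with hx | rfl | hx
  · rw [gn, gn, if_neg (by omega), if_neg (by omega), if_neg (by omega), h2, Matrix.mulVec_smul,
      add_zero]
  · rw [gn, gn, if_pos le_rfl, if_neg (by omega), if_pos rfl, Matrix.mulVec_smul, ← h2,
      ← h.Wr_eq hp (x + 1)]
    ext i
    fin_cases i <;> simp [det2] <;> ring
  · rw [gn, gn, if_pos (by omega), if_pos (by omega), if_neg (by omega), h1, Matrix.mulVec_smul,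
      add_zero]

theorem qw_gk (h : Dat a₀ α θ 0) {p : ℂ × ℂ} (hp : p ∈ Sg (rho a₀)) (y : ℤ) (j : Fin 2) (x : ℤ) :
    qw (coinOf α θ) (gk a₀ α θ p y j) x = p.1 • gk a₀ α θ p y j x +
      Wr a₀ α θ p • (if x = y then Pi.single j 1 else 0) := by
  rw [gk, qw_jev h.coin hp.1 (h.gn_rec hp _ _)]
  congr 1
  have hw := mul_inv_cancel₀ hp.1
  have h4 : ∀ t : ℝ, exp (t * I) * exp (-(t * I)) = 1 := fun t => by rw [← exp_add]; simp
  have h6 : ∀ y, (rho (α y) : ℂ) * (rho (α y) : ℂ)⁻¹ = 1 := fun y =>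
    mul_inv_cancel₀ (ofReal_ne_zero.2 (rho_pos (h.coin y)).ne')
  fin_cases j
  · simp only [sn, sv, Fin.zero_eta, if_true]
    by_cases hx : x = y
    · subst hx
      ext i; fin_cases i
      · simp; linear_combination Wr a₀ α θ p * hw
      · rw [if_neg (show ¬x + 1 = x - 1 by omega)]; simp
    · rw [if_neg (show ¬x - 1 = y - 1 by omega), if_neg hx]
      ext i; fin_cases i
      · simp
      · simp; right; split_ifs <;> simp
  · simp only [sn, sv, Fin.mk_one, one_ne_zero, if_false]
    have e1 : ∀ x, (exp (θ x * I)) * rho (α x) * ((rho (α x) : ℂ)⁻¹ * exp (-(θ x * I))) = 1 :=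
      fun x => by linear_combination h4 (θ x) + exp (θ x * I) * exp (-(θ x * I)) * h6 x
    by_cases hx : x = y
    · subst hx
      rw [if_neg (show ¬x - 1 = x + 1 by omega)]
      ext i; fin_cases i
      · simp
      · simp; linear_combination Wr a₀ α θ p * e1 (x + 1)
    · by_cases hx2 : x = y + 2
      · subst hx2
        rw [if_neg hx, if_pos (by omega), if_neg (by omega), show y + 2 - 1 = y + 1 by ring]
        ext i; fin_cases i
        · simp
          linear_combination (Wr a₀ α θ p * (rho (α (y + 1)) : ℂ)⁻¹ * (starRingEnd ℂ) (α (y + 1))) *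
            (h4 (θ (y + 1)) - hw)
        · simp
      · rw [if_neg (by omega), if_neg hx, if_neg (by omega)]
        ext i; fin_cases i <;> simp

theorem extend_bound {f : ℤ → ℝ} {C q : ℝ} (hq : 0 < q) (hC : 0 ≤ C) (hf : ∀ x, 0 ≤ f x)
    (h : ∀ x, 0 ≤ x → f x ≤ C * q ^ x.natAbs) (N : ℤ) :
    ∃ D, 0 ≤ D ∧ ∀ x, N ≤ x → f x ≤ D * q ^ x.natAbs := by
  have hg : ∀ z ∈ Finset.Icc N 0, 0 ≤ f z / q ^ z.natAbs := fun z _ =>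
    div_nonneg (hf z) (by positivity)
  have hs := Finset.sum_nonneg hg
  refine ⟨C + ∑ z ∈ Finset.Icc N 0, f z / q ^ z.natAbs, by positivity, fun x hx => ?_⟩
  rcases le_total 0 x with h0 | h0
  · refine (h x h0).trans ?_
    gcongr
    linarith
  · rw [← div_le_iff₀ (by positivity)]
    have := Finset.single_le_sum hg (Finset.mem_Icc.2 ⟨hx, h0⟩)
    linarith

theorem vp_le_from (h : Dat a₀ α θ 0) {p : ℂ × ℂ} (hp : p ∈ Sg (rho a₀)) (N : ℤ) :
    ∃ D, 0 ≤ D ∧ ∀ x i, N ≤ x → ‖vp a₀ α θ p x i‖ ≤ D * ‖p.2‖ ^ x.natAbs := by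
  obtain ⟨C, hC, hm⟩ := h.vp_le
  have := fun i => extend_bound (norm_pos_iff.2 hp.2.1) hC (f := fun x => ‖vp a₀ α θ p x i‖)
    (fun x => norm_nonneg _) (fun x hx => hm p hp x i hx) N
  obtain ⟨D, hD, h0⟩ := this 0
  obtain ⟨E, hE, h1⟩ := this 1
  refine ⟨max D E, le_max_of_le_left hD, fun x i hx => ?_⟩
  fin_cases i
  · exact (h0 x hx).trans (by gcongr; exact le_max_left _ _)
  · exact (h1 x hx).trans (by gcongr; exact le_max_right _ _)

theorem vm_le_to (h : Dat a₀ α θ 0) {p : ℂ × ℂ} (hp : p ∈ Sg (rho a₀)) (N : ℤ) :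
    ∃ D, 0 ≤ D ∧ ∀ x i, x ≤ N → ‖vm a₀ α θ p x i‖ ≤ D * ‖p.2‖ ^ x.natAbs := by
  obtain ⟨D, hD, hv⟩ := h.reflect.vp_le_from (p := p) (by rwa [rho_neg_conj]) (1 - N)
  have hk := norm_pos_iff.2 hp.2.1
  refine ⟨D * ‖p.2‖⁻¹, by positivity, fun x i hx => ?_⟩
  have h2 : ‖p.2‖ ^ (1 - x).natAbs ≤ ‖p.2‖⁻¹ * ‖p.2‖ ^ x.natAbs := by
    rw [← div_eq_inv_mul, le_div_iff₀ hk, ← pow_succ]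
    exact pow_le_pow_of_le_one hk.le hp.2.2.1 (by omega)
  have h3 := fun i => (hv (1 - x) i (by omega)).trans (mul_le_mul_of_nonneg_left h2 hD)
  rw [mul_assoc]
  fin_cases i
  · exact h3 1
  · exact h3 0

theorem gk_le (h : Dat a₀ α θ 0) {p : ℂ × ℂ} (hp : p ∈ Sg (rho a₀)) (y : ℤ) (j : Fin 2) :
    ∃ C, ∀ x i, ‖gk a₀ α θ p y j x i‖ ≤ C * ‖p.2‖ ^ x.natAbs := by
  have hk := norm_pos_iff.2 hp.2.1
  obtain ⟨D, hD, hvp⟩ := h.vp_le_from hp (sn y j + 1)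
  obtain ⟨E, hE, hvm⟩ := h.vm_le_to hp (sn y j + 1)
  set A := ‖det2 (sv α θ p.1 y j) (vm a₀ α θ p (sn y j + 1))‖ with hA
  set B := ‖det2 (vp a₀ α θ p (sn y j + 1)) (sv α θ p.1 y j)‖ with hB
  have hA0 : 0 ≤ A := norm_nonneg _
  have hB0 : 0 ≤ B := norm_nonneg _
  have hg : ∀ x i, ‖gn a₀ α θ p (sn y j) (sv α θ p.1 y j) x i‖ ≤ (A * D + B * E) * ‖p.2‖ ^ x.natAbs := by
    intro x i
    have hpos : 0 ≤ ‖p.2‖ ^ x.natAbs := by positivity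
    have e1 := mul_nonneg (mul_nonneg hA0 hD) hpos
    have e2 := mul_nonneg (mul_nonneg hB0 hE) hpos
    unfold gn
    split_ifs with hx
    · rw [Pi.smul_apply, smul_eq_mul, norm_mul, ← hA]
      have := mul_le_mul_of_nonneg_left (hvp x i hx) hA0
      linarith
    · rw [Pi.smul_apply, smul_eq_mul, norm_mul, norm_neg, ← hB]
      have := mul_le_mul_of_nonneg_left (hvm x i (by omega)) hB0
      linarith
  refine ⟨(A * D + B * E) * ‖p.2‖⁻¹, fun x i => ?_⟩
  have hC : 0 ≤ A * D + B * E := by positivity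
  have key : ∀ n m : ℕ, n ≤ m + 1 → ‖p.2‖ ^ m ≤ ‖p.2‖⁻¹ * ‖p.2‖ ^ n := fun n m hnm => by
    rw [← div_eq_inv_mul, le_div_iff₀ hk, ← pow_succ]
    exact pow_le_pow_of_le_one hk.le hp.2.2.1 hnm
  rw [mul_assoc]
  fin_cases i
  · exact (hg x 1).trans (mul_le_mul_of_nonneg_left (key _ _ (by omega)) hC)
  · exact (hg (x + 1) 0).trans (mul_le_mul_of_nonneg_left (key _ _ (by omega)) hC)

theorem continuousOn_sv (α : ℤ → ℂ) (θ : ℤ → ℝ) (r : ℝ) (y : ℤ) (j l : Fin 2) :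
    ContinuousOn (fun p : ℂ × ℂ => sv α θ p.1 y j l) (Sg r) := by
  have h1 : ContinuousOn (fun p : ℂ × ℂ => p.1⁻¹) (Sg r) :=
    continuousOn_fst.inv₀ fun p hp => hp.1
  fin_cases j <;> fin_cases l
  · exact (continuousOn_const : ContinuousOn (fun _ : ℂ × ℂ => (0 : ℂ)) _)
  · exact h1.neg
  · exact (continuousOn_const : ContinuousOn
      (fun _ : ℂ × ℂ => ((rho (α (y + 1)) : ℝ) : ℂ)⁻¹ * exp (-(θ (y + 1) * I))) _)
  · exact (continuousOn_const (c := ((rho (α (y + 1)) : ℝ) : ℂ)⁻¹)).mul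
      (h1.mul (continuousOn_const (c := (starRingEnd ℂ) (α (y + 1)))))

theorem continuousOn_gk (h : Dat a₀ α θ 0) (y : ℤ) (j : Fin 2) (x : ℤ) (i : Fin 2) :
    ContinuousOn (fun p => gk a₀ α θ p y j x i) (Sg (rho a₀)) := by
  have hsv := continuousOn_sv α θ (rho a₀) y j
  have hg : ∀ x i, ContinuousOn (fun p => gn a₀ α θ p (sn y j) (sv α θ p.1 y j) x i)
      (Sg (rho a₀)) := by
    intro x i
    unfold gn det2
    split_ifs with hx
    · exact (((hsv 0).mul (h.continuousOn_vm _ 1)).sub ((hsv 1).mul (h.continuousOn_vm _ 0))).mul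
        (h.continuousOn_vp x i)
    · exact (((h.continuousOn_vp _ 0).mul (hsv 1)).sub ((h.continuousOn_vp _ 1).mul (hsv 0))).neg.mul
        (h.continuousOn_vm x i)
  fin_cases i
  · exact hg x 1
  · exact hg (x + 1) 0

theorem inv_rho_le (h : Dat a₀ α θ 0) : ∃ D, ∀ x, (rho (α x))⁻¹ ≤ D := by
  refine ⟨∑' x : ℤ, (|(x : ℝ)| + 1) ^ 1 * pert a₀ (α x) (θ x) + (rho a₀)⁻¹, fun x => ?_⟩
  have hn : ∀ x : ℤ, 0 ≤ (|(x : ℝ)| + 1) ^ 1 * pert a₀ (α x) (θ x) := fun x =>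
    mul_nonneg (by positivity) (pert_nonneg _ _ _)
  have h1 := h.summ.le_tsum x fun y _ => hn y
  have h2 : pert a₀ (α x) (θ x) ≤ (|(x : ℝ)| + 1) ^ (0 + 1) * pert a₀ (α x) (θ x) :=
    le_mul_of_one_le_left (pert_nonneg _ _ _) (by simp)
  have h3 : ‖((rho (α x) : ℝ) : ℂ)⁻¹ * exp (θ x * I)‖ = (rho (α x))⁻¹ := by
    rw [norm_mul, norm_exp_ofReal_mul_I, mul_one, norm_inv, norm_real,
      Real.norm_of_nonneg (rho_pos (h.coin x)).le]
  have h4 : ‖((rho a₀ : ℝ) : ℂ)⁻¹‖ = (rho a₀)⁻¹ := by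
    rw [norm_inv, norm_real, Real.norm_of_nonneg (rho_pos h.lt_one).le]
  have h5 := norm_sub_norm_le (((rho (α x) : ℝ) : ℂ)⁻¹ * exp (θ x * I)) ((rho a₀ : ℝ) : ℂ)⁻¹
  have h6 : ‖((rho (α x) : ℝ) : ℂ)⁻¹ * exp (θ x * I) - ((rho a₀ : ℝ) : ℂ)⁻¹‖ ≤
      pert a₀ (α x) (θ x) := by unfold pert; linarith [norm_nonneg (((rho (α x) : ℝ) : ℂ)⁻¹ * exp (-(θ x * I)) - ((rho a₀ : ℝ) : ℂ)⁻¹), norm_nonneg (((rho (α x) : ℝ) : ℂ)⁻¹ * α x - ((rho a₀ : ℝ) : ℂ)⁻¹ * a₀)]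
  simp only [zero_add] at *
  linarith

end Dat

namespace Amp
variable {a₀ : ℂ} {α : ℤ → ℂ} {θ : ℤ → ℝ} {s : ℤ} {F G : ℂ × ℂ → ℂ} {A B : ℝ}

theorem mono (h : Amp a₀ α θ s F A) (hab : A ≤ B) : Amp a₀ α θ s F B :=
  let ⟨H, h1, h2⟩ := h
  ⟨H, h1.mono hab, h2⟩

theorem sub (hF : Amp a₀ α θ s F A) (hG : Amp a₀ α θ s G B) :
    Amp a₀ α θ s (fun p => F p - G p) (A + B) := by
  obtain ⟨H, h1, h2⟩ := hF
  obtain ⟨K, h3, h4⟩ := hG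
  exact ⟨_, (IsW.ncu 0).sub h1 h3, fun ξ => by rw [sub_mul, h2, h4]; ring⟩

theorem neg (hF : Amp a₀ α θ s F A) : Amp a₀ α θ s (fun p => -F p) A := by
  obtain ⟨H, h1, h2⟩ := hF
  exact ⟨_, (IsW.ncu 0).neg h1, fun ξ => by rw [neg_mul, h2]; ring⟩

theorem mul_left (hF : Amp a₀ α θ s F A) (hG : IsW 0 (fun ξ => G (bc (rho a₀) s ξ)) B) :
    Amp a₀ α θ s (fun p => G p * F p) (B * A) := by
  obtain ⟨H, h1, h2⟩ := hF
  exact ⟨_, hG.mul h1, fun ξ => by rw [mul_assoc, h2]; ring⟩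

end Amp

theorem Reg.isW_sv {a₀ : ℂ} {α : ℤ → ℂ} {θ : ℤ → ℝ} {k : ℕ} {s : ℤ} (h : Reg a₀ α θ k s) :
    ∃ C, ∀ y j l, IsW 0 (fun ξ => sv α θ (bc (rho a₀) s ξ).1 y j l) C := by
  obtain ⟨B, hB⟩ := h.mc 0
  obtain ⟨D, hD⟩ := h.dat0.inv_rho_le
  have hB0 := hB.B_nonneg
  have hD0 : 0 ≤ D := (inv_nonneg.2 (rho_pos (h.dat.coin 0)).le).trans (hD 0)
  have hn : ∀ x, ‖((rho (α x) : ℝ) : ℂ)⁻¹‖ ≤ D := fun x => by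
    rw [norm_inv, norm_real, Real.norm_of_nonneg (rho_pos (h.dat.coin x)).le]
    exact hD x
  refine ⟨B + D + D * B, fun y j l => ?_⟩
  have hw := hB.winv
  have hDB := mul_nonneg hD0 hB0
  fin_cases j <;> fin_cases l
  · exact (IsW.const 0).mono (by rw [norm_zero]; linarith)
  · exact ((IsW.ncu 0).neg hw).mono (by linarith)
  · change IsW 0 (fun _ => ((rho (α (y + 1)) : ℝ) : ℂ)⁻¹ * exp (-(θ (y + 1) * I))) _
    refine (IsW.const _).mono ?_
    rw [norm_mul, ← neg_mul, ← ofReal_neg, norm_exp_ofReal_mul_I, mul_one]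
    linarith [hn (y + 1)]
  · refine (IsW.congr ((IsW.ncu 0).smul (((rho (α (y + 1)) : ℝ) : ℂ)⁻¹ *
      (starRingEnd ℂ) (α (y + 1))) hw) fun ξ => ?_).mono (?_ : _ ≤ B + D + D * B)
    · simp [sv]; ring
    · rw [norm_mul, norm_conj]
      have : ‖((rho (α (y + 1)) : ℝ) : ℂ)⁻¹‖ * ‖α (y + 1)‖ ≤ D * 1 :=
        mul_le_mul (hn _) (h.dat.coin _).le (norm_nonneg _) hD0
      nlinarith

theorem Reg.amp_gk {a₀ : ℂ} {α : ℤ → ℂ} {θ : ℤ → ℝ} {k : ℕ} {s : ℤ} (h : Reg a₀ α θ k s) :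
    ∃ C, 0 ≤ C ∧ ∀ y j x i, Amp a₀ α θ s (fun p => gk a₀ α θ p y j x i) C := by
  obtain ⟨A, hA⟩ := h.amp
  obtain ⟨B, hB⟩ := h.isW_sv
  have key : ∀ y j x i, Amp a₀ α θ s
      (fun p => gn a₀ α θ p (sn y j) (sv α θ p.1 y j) x i) (B * A + B * A) := by
    intro y j x i
    by_cases hx : sn y j + 1 ≤ x
    · simp only [gn, if_pos hx]
      obtain ⟨H, h1, h2⟩ := ((hA x _ i 1 hx).mul_left (G := fun p => sv α θ p.1 y j 0) (hB y j 0)).sub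
        ((hA x _ i 0 hx).mul_left (G := fun p => sv α θ p.1 y j 1) (hB y j 1))
      refine ⟨H, h1, fun ξ => ?_⟩
      rw [h2]; simp [det2]; left; ring
    · have hx' : x ≤ sn y j + 1 := by omega
      simp only [gn, if_neg hx]
      obtain ⟨H, h1, h2⟩ := ((hA _ x 1 i hx').mul_left (G := fun p => sv α θ p.1 y j 0) (hB y j 0)).sub
        ((hA _ x 0 i hx').mul_left (G := fun p => sv α θ p.1 y j 1) (hB y j 1))
      refine ⟨H, h1, fun ξ => ?_⟩
      rw [h2]; simp [det2]; left; ring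
  have hnn : 0 ≤ B * A + B * A := by
    obtain ⟨H, h1, -⟩ := key 0 0 0 0
    exact h1.nonneg
  refine ⟨_, hnn, fun y j x i => ?_⟩
  fin_cases i
  · exact key y j x 1
  · exact key y j (x + 1) 0

section
open Filter Topology

/-- The unit circle as a subset of the complex plane. -/
abbrev S1 : Set ℂ := Metric.sphere (0 : ℂ) 1

/-- The point `exp (i φ)` of the unit circle. -/
def cpt (φ : ℝ) : S1 := ⟨exp (φ * I), by simp [norm_exp_ofReal_mul_I]⟩

theorem coe_cpt (φ : ℝ) : (cpt φ : ℂ) = exp (φ * I) := rfl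

theorem continuous_cpt : Continuous cpt := by
  unfold cpt
  fun_prop

theorem norm_S1 (x : S1) : ‖(x : ℂ)‖ = 1 := by simp

theorem S1_ne_zero (x : S1) : (x : ℂ) ≠ 0 := norm_pos_iff.1 (by rw [norm_S1]; exact one_pos)

theorem S1_mul_conj (x : S1) : (x : ℂ) * (starRingEnd ℂ) x = 1 := by
  rw [mul_conj, normSq_eq_norm_sq, norm_S1]; simp

theorem S1_sub_ne {z : ℂ} (hz : ‖z‖ < 1) (x : S1) : (x : ℂ) - z ≠ 0 := by
  intro h
  have := norm_S1 x
  rw [sub_eq_zero.1 h] at this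
  exact hz.ne this

/-- The function `x ↦ (x - z)⁻¹` on the unit circle, for `‖z‖ < 1`. -/
def rk (z : ℂ) : C(S1, ℂ) :=
  if hz : ‖z‖ < 1 then
    ⟨fun x => ((x : ℂ) - z)⁻¹, (by fun_prop : Continuous fun x : S1 => (x : ℂ) - z).inv₀ (S1_sub_ne hz)⟩
  else 0

theorem rk_apply {z : ℂ} (hz : ‖z‖ < 1) (x : S1) : rk z x = ((x : ℂ) - z)⁻¹ := by
  rw [rk, dif_pos hz]; rfl

/-- The Poisson kernel `x ↦ 1 + 2 Re (z / (x - z))` on the unit circle. -/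
def pk (z : ℂ) : C(S1, ℂ) := 1 + z • rk z + star (z • rk z)

theorem pk_apply {z : ℂ} (hz : ‖z‖ < 1) (x : S1) :
    pk z x = (((1 - ‖z‖ ^ 2) / ‖(x : ℂ) - z‖ ^ 2 : ℝ) : ℂ) := by
  have h1 := S1_sub_ne hz x
  have h2 : (starRingEnd ℂ) (x : ℂ) - (starRingEnd ℂ) z ≠ 0 := by
    rw [← map_sub]; exact (map_ne_zero _).2 h1
  have hx := S1_mul_conj x
  simp only [pk, ContinuousMap.add_apply, ContinuousMap.one_apply, ContinuousMap.smul_apply,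
    ContinuousMap.star_apply, rk_apply hz, smul_eq_mul, star_mul', RCLike.star_def, map_inv₀]
  push_cast
  rw [← conj_mul', ← conj_mul', map_sub]
  field_simp
  linear_combination hx

theorem cpt_add_two_pi (φ : ℝ) : cpt (φ + 2 * Real.pi) = cpt φ := by
  ext
  rw [coe_cpt, coe_cpt]; push_cast
  rw [add_mul, exp_add, exp_two_pi_mul_I, mul_one]

theorem cpt_surjective : Function.Surjective cpt := fun x => ⟨arg x, by
  ext
  have := norm_mul_exp_arg_mul_I (x : ℂ)
  rwa [norm_S1, ofReal_one, one_mul] at this⟩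

theorem norm_mul_cpt {r : ℝ} (h0 : 0 ≤ r) (φ : ℝ) : ‖(r : ℂ) * cpt φ‖ = r := by
  rw [norm_mul, norm_S1, norm_real, Real.norm_of_nonneg h0, mul_one]

theorem pk_real {r : ℝ} (h0 : 0 ≤ r) (h1 : r < 1) (φ : ℝ) (x : S1) :
    pk (r * cpt φ) x = (((1 - r ^ 2) / ‖(x : ℂ) - r * cpt φ‖ ^ 2 : ℝ) : ℂ) := by
  rw [pk_apply (by rwa [norm_mul_cpt h0]), norm_mul_cpt h0]

theorem norm_sub_symm (r : ℝ) (x y : S1) : ‖(x : ℂ) - r * y‖ = ‖(y : ℂ) - r * x‖ := by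
  have h : (x : ℂ) - r * y = x * y * (starRingEnd ℂ) ((y : ℂ) - r * x) := by
    rw [map_sub, map_mul, conj_ofReal]
    linear_combination -(x : ℂ) * S1_mul_conj y + (r : ℂ) * y * S1_mul_conj x
  rw [h, norm_mul, norm_mul, norm_conj, norm_S1, norm_S1, one_mul, one_mul]

theorem continuous_pk_real {r : ℝ} (h0 : 0 ≤ r) (h1 : r < 1) :
    Continuous fun φ : ℝ => pk (r * cpt φ) := by
  have hne : ∀ q : ℝ × S1, ‖(q.2 : ℂ) - r * cpt q.1‖ ^ 2 ≠ 0 := fun q =>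
    pow_ne_zero _ (norm_ne_zero_iff.2 (S1_sub_ne (by rwa [norm_mul_cpt h0]) _))
  have hc := continuous_cpt
  let F : C(ℝ × S1, ℂ) := ⟨fun q => (((1 - r ^ 2) / ‖(q.2 : ℂ) - r * cpt q.1‖ ^ 2 : ℝ) : ℂ),
    continuous_ofReal.comp (continuous_const.div (by fun_prop) hne)⟩
  have : (fun φ : ℝ => pk (r * cpt φ)) = F.curry := by
    ext φ x
    rw [pk_real h0 h1]; rfl
  rw [this]
  exact F.curry.continuous

theorem integral_pk {r : ℝ} (h0 : 0 ≤ r) (h1 : r < 1) (x : S1) :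
    ∫ φ in -Real.pi..Real.pi, (1 - r ^ 2) / ‖(x : ℂ) - r * cpt φ‖ ^ 2 = 2 * Real.pi := by
  have hw : (r : ℂ) * x ∈ Metric.ball (0 : ℂ) 1 := by
    rw [mem_ball_zero_iff, norm_mul, norm_S1, norm_real, Real.norm_of_nonneg h0, mul_one]
    exact h1
  have h := (diffContOnCl_const (𝕜 := ℂ) (c := (1 : ℂ))).circleAverage_poissonKernel_smul' hw
  rw [Real.circleAverage] at h
  simp only [sub_zero, real_smul, mul_one, intervalIntegral.integral_ofReal] at h
  norm_cast at h
  have hp : Function.Periodic (fun φ => (1 - r ^ 2) / ‖(x : ℂ) - r * cpt φ‖ ^ 2) (2 * Real.pi) :=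
    fun φ => by simp only [cpt_add_two_pi]
  have h2 := hp.intervalIntegral_add_eq (-Real.pi) 0
  rw [show -Real.pi + 2 * Real.pi = Real.pi by ring, zero_add] at h2
  refine h2.trans (Eq.trans ?_ ((inv_mul_eq_one₀ (by positivity)).1 h).symm)
  refine intervalIntegral.integral_congr fun φ _ => ?_
  have hc : circleMap 0 1 φ = cpt φ := by simp [circleMap, coe_cpt]
  simp only [hc, norm_S1, one_pow]
  rw [norm_sub_symm, norm_mul, norm_real, norm_S1, mul_one, Real.norm_of_nonneg h0]

/-- The Poisson integral of `ψ` as a function on the unit circle. -/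
theorem integral_pk_apply (ψ : C(S1, ℂ)) {r : ℝ} (h0 : 0 ≤ r) (h1 : r < 1) (x : S1) :
    (∫ φ in -Real.pi..Real.pi, ψ (cpt φ) • pk (r * cpt φ)) x =
      ∫ φ in -Real.pi..Real.pi, ψ (cpt φ) *
        (((1 - r ^ 2) / ‖(x : ℂ) - r * cpt φ‖ ^ 2 : ℝ) : ℂ) := by
  have hc : Continuous fun φ => ψ (cpt φ) • pk (r * cpt φ) :=
    (ψ.continuous.comp continuous_cpt).smul (continuous_pk_real h0 h1)
  have := (ContinuousMap.evalCLM ℂ x).intervalIntegral_comp_comm (μ := MeasureTheory.volume)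
    (hc.intervalIntegrable (-Real.pi) Real.pi)
  rw [ContinuousMap.evalCLM_apply] at this
  rw [← this]
  refine intervalIntegral.integral_congr fun φ _ => ?_
  simp only [ContinuousMap.evalCLM_apply, ContinuousMap.smul_apply, smul_eq_mul, pk_real h0 h1]

theorem continuous_poisson {r : ℝ} (h0 : 0 ≤ r) (h1 : r < 1) (x : S1) :
    Continuous fun φ : ℝ => (1 - r ^ 2) / ‖(x : ℂ) - r * cpt φ‖ ^ 2 := by
  have hne : ∀ φ : ℝ, ‖(x : ℂ) - r * cpt φ‖ ^ 2 ≠ 0 := fun q =>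
    pow_ne_zero _ (norm_ne_zero_iff.2 (S1_sub_ne (by rwa [norm_mul_cpt h0]) _))
  have hc := continuous_cpt
  exact continuous_const.div (by fun_prop) hne

theorem tendsto_poisson (ψ : C(S1, ℂ)) :
    Tendsto (fun r : ℝ => ((2 * Real.pi : ℝ) : ℂ)⁻¹ • ∫ φ in -Real.pi..Real.pi, ψ (cpt φ) • pk (r * cpt φ))
      (𝓝[<] 1) (𝓝 ψ) := by
  rw [Metric.tendsto_nhds]
  intro ε hε
  obtain ⟨δ, hδ, hu⟩ := Metric.uniformContinuous_iff.1
    (CompactSpace.uniformContinuous_of_continuous ψ.continuous) (ε / 2) (by positivity)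
  set M := 2 * ‖ψ‖ with hM
  have hM0 : 0 ≤ M := by positivity
  have e1 : ∀ᶠ r : ℝ in 𝓝[<] 1, 0 ≤ r ∧ r < 1 ∧ 1 - r ≤ δ / 2 := by
    have : ∀ᶠ r : ℝ in 𝓝[<] 1, r ∈ Set.Ioo (max 0 (1 - δ / 2)) 1 :=
      Ioo_mem_nhdsLT (by simp [hδ])
    filter_upwards [this] with r hr
    have := max_lt_iff.1 hr.1
    exact ⟨this.1.le, hr.2, by linarith [this.2]⟩
  have e2 : ∀ᶠ r : ℝ in 𝓝[<] 1, M * ((1 - r ^ 2) / (δ / 2) ^ 2) < ε / 4 := by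
    have hc : Continuous fun r : ℝ => M * ((1 - r ^ 2) / (δ / 2) ^ 2) := by fun_prop
    have := (hc.tendsto 1).mono_left (nhdsWithin_le_nhds (s := Set.Iio 1))
    simp only [one_pow, sub_self, zero_div, mul_zero] at this
    exact this.eventually_lt_const (by positivity)
  filter_upwards [e1, e2] with r ⟨h0, h1, h3⟩ h4
  rw [dist_eq_norm]
  have hb : ‖((2 * Real.pi : ℝ) : ℂ)⁻¹ • (∫ φ in -Real.pi..Real.pi, ψ (cpt φ) • pk (r * cpt φ)) - ψ‖ ≤
      ε / 2 + ε / 4 := by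
    rw [ContinuousMap.norm_le _ (by positivity)]
    intro x
    have hP := continuous_poisson h0 h1 x
    set P := fun φ : ℝ => (1 - r ^ 2) / ‖(x : ℂ) - r * cpt φ‖ ^ 2 with hPd
    have hψ : Continuous fun φ => ψ (cpt φ) := ψ.continuous.comp continuous_cpt
    have hpos : 0 < 1 - r ^ 2 := by nlinarith
    have hPn : ∀ φ, 0 ≤ P φ := fun φ => by simp only [hPd]; positivity
    have key : (((2 * Real.pi : ℝ) : ℂ)⁻¹ •
        (∫ φ in -Real.pi..Real.pi, ψ (cpt φ) • pk (r * cpt φ)) - ψ) x =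
        ((2 * Real.pi : ℝ) : ℂ)⁻¹ * ∫ φ in -Real.pi..Real.pi, (ψ (cpt φ) - ψ x) * (P φ : ℂ) := by
      have h5 : ∫ φ in -Real.pi..Real.pi, (P φ : ℂ) = ((2 * Real.pi : ℝ) : ℂ) := by
        rw [intervalIntegral.integral_ofReal, integral_pk h0 h1]
      have hP' : Continuous fun φ => (P φ : ℂ) := continuous_ofReal.comp hP
      have i1 : IntervalIntegrable (fun φ => ψ (cpt φ) * (P φ : ℂ)) MeasureTheory.volume
        (-Real.pi) Real.pi := (hψ.mul hP').intervalIntegrable _ _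
      have i2 : IntervalIntegrable (fun φ => ψ x * (P φ : ℂ)) MeasureTheory.volume
        (-Real.pi) Real.pi := (continuous_const.mul hP').intervalIntegrable _ _
      simp only [sub_mul]
      rw [intervalIntegral.integral_sub i1 i2, intervalIntegral.integral_const_mul, h5,
        ContinuousMap.sub_apply, ContinuousMap.smul_apply, integral_pk_apply ψ h0 h1, mul_sub,
        smul_eq_mul, mul_left_comm, inv_mul_cancel₀ (by simp [Real.pi_ne_zero]), mul_one]
    have hpt : ∀ φ, ‖(ψ (cpt φ) - ψ x) * (P φ : ℂ)‖ ≤ ε / 2 * P φ + ε / 4 := by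
      intro φ
      rw [norm_mul, norm_real, Real.norm_of_nonneg (hPn φ)]
      by_cases hd : dist (cpt φ) x < δ
      · have := hu hd
        rw [dist_eq_norm] at this
        nlinarith [hPn φ, mul_le_mul_of_nonneg_right this.le (hPn φ)]
      · have h6 : δ / 2 ≤ ‖(x : ℂ) - r * cpt φ‖ := by
          have h7 : δ ≤ ‖(x : ℂ) - cpt φ‖ := by
            rw [not_lt, Subtype.dist_eq, dist_eq_norm, norm_sub_rev] at hd
            exact hd
          have h8 : ‖(r : ℂ) * cpt φ - cpt φ‖ = 1 - r := by
            rw [← sub_one_mul, norm_mul, norm_S1, mul_one, norm_sub_rev, ← ofReal_one, ← ofReal_sub,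
              norm_real, Real.norm_of_nonneg (by linarith)]
          have h9 := norm_sub_le_norm_sub_add_norm_sub (x : ℂ) (r * cpt φ) (cpt φ)
          linarith
        have h7 : P φ ≤ (1 - r ^ 2) / (δ / 2) ^ 2 := by
          simp only [hPd]
          gcongr
        have h8 : ‖ψ (cpt φ) - ψ x‖ ≤ M := (norm_sub_le _ _).trans (by
          linarith [ψ.norm_coe_le_norm (cpt φ), ψ.norm_coe_le_norm x])
        have := mul_le_mul h8 h7 (hPn φ) hM0
        nlinarith [hPn φ]
    rw [key, norm_mul, norm_inv, norm_real, Real.norm_of_nonneg (by positivity),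
      inv_mul_le_iff₀ (by positivity)]
    refine (intervalIntegral.norm_integral_le_of_norm_le (by linarith [Real.pi_pos])
      (Eventually.of_forall fun φ _ => hpt φ)
      (((continuous_const.mul hP).add continuous_const).intervalIntegrable _ _)).trans (le_of_eq ?_)
    have i1 : IntervalIntegrable (fun φ => ε / 2 * P φ) MeasureTheory.volume
      (-Real.pi) Real.pi := (continuous_const.mul hP).intervalIntegrable _ _
    rw [intervalIntegral.integral_add i1 (continuous_const.intervalIntegrable _ _), intervalIntegral.integral_const_mul,
      integral_pk h0 h1, intervalIntegral.integral_const, smul_eq_mul]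
    ring
  linarith

/-- Boundary representation of a functional whose Poisson transform has boundary values. -/
theorem eq_integral_boundary (l : C(S1, ℂ) →L[ℂ] ℂ) (ψ : C(S1, ℂ)) (D : ℝ → ℂ)
    (hD : ∀ φ, cpt φ ∈ tsupport ψ →
      Tendsto (fun z => l (pk z)) (𝓝[Metric.ball 0 1] (cpt φ : ℂ)) (𝓝 (D φ))) :
    l ψ = ((2 * Real.pi : ℝ) : ℂ)⁻¹ * ∫ φ in -Real.pi..Real.pi, ψ (cpt φ) * D φ := by
  have h1 : Tendsto (fun r : ℝ => ((2 * Real.pi : ℝ) : ℂ)⁻¹ *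
      ∫ φ in -Real.pi..Real.pi, ψ (cpt φ) * l (pk (r * cpt φ))) (𝓝[<] 1) (𝓝 (l ψ)) := by
    refine ((l.continuous.tendsto ψ).comp (tendsto_poisson ψ)).congr' ?_
    filter_upwards [Ioo_mem_nhdsLT (zero_lt_one' ℝ)] with r hr
    have hc : Continuous fun φ => ψ (cpt φ) • pk (r * cpt φ) :=
      (ψ.continuous.comp continuous_cpt).smul (continuous_pk_real hr.1.le hr.2)
    rw [Function.comp_apply, map_smul, smul_eq_mul, ← l.intervalIntegral_comp_comm
      (hc.intervalIntegrable _ _)]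
    simp
  have h2 : ∃ M : ℝ, 0 ≤ M ∧ ∀ᶠ r : ℝ in 𝓝[<] 1, ∀ x ∈ tsupport ψ, ‖l (pk (r * (x : ℂ)))‖ ≤ M := by
    have hK : IsCompact (tsupport ψ) := (isClosed_tsupport _).isCompact
    refine hK.induction_on (p := fun S => ∃ M : ℝ, 0 ≤ M ∧ ∀ᶠ r : ℝ in 𝓝[<] 1, ∀ x ∈ S,
      ‖l (pk (r * (x : ℂ)))‖ ≤ M) ⟨0, le_rfl, by simp⟩ ?_ ?_ ?_
    · rintro s t hst ⟨M, hM0, hM⟩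
      exact ⟨M, hM0, hM.mono fun r hr x hx => hr x (hst hx)⟩
    · rintro s t ⟨M, hM0, hM⟩ ⟨N, -, hN⟩
      refine ⟨max M N, le_max_of_le_left hM0, (hM.and hN).mono fun r hr x hx => ?_⟩
      rcases hx with hx | hx
      · exact (hr.1 x hx).trans (le_max_left _ _)
      · exact (hr.2 x hx).trans (le_max_right _ _)
    · intro x hx
      obtain ⟨φ, rfl⟩ := cpt_surjective x
      have h3 := (hD φ hx).norm.eventually_lt_const (lt_add_one ‖D φ‖)
      have h4 : Tendsto (fun q : ℝ × S1 => (q.1 : ℂ) * (q.2 : ℂ)) (𝓝[<] 1 ×ˢ 𝓝 (cpt φ))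
          (𝓝[Metric.ball 0 1] (cpt φ : ℂ)) := by
        refine tendsto_nhdsWithin_iff.2 ⟨?_, ?_⟩
        · have hc : Continuous fun q : ℝ × S1 => (q.1 : ℂ) * (q.2 : ℂ) := by fun_prop
          have := hc.tendsto (1, cpt φ)
          rw [ofReal_one, one_mul, nhds_prod_eq] at this
          exact this.mono_left (Filter.prod_mono_left _ nhdsWithin_le_nhds)
        · have : ∀ᶠ r : ℝ in 𝓝[<] 1, r ∈ Set.Ioo (0 : ℝ) 1 := Ioo_mem_nhdsLT one_pos
          filter_upwards [this.prod_inl (𝓝 (cpt φ))] with q hq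
          rw [mem_ball_zero_iff, norm_mul, norm_S1, mul_one, norm_real,
            Real.norm_of_nonneg hq.1.le]
          exact hq.2
      obtain ⟨pa, ha, pb, hb, hab⟩ := Filter.eventually_prod_iff.1 (h4.eventually h3)
      exact ⟨{x | pb x}, mem_nhdsWithin_of_mem_nhds hb, ‖D φ‖ + 1, by positivity,
        ha.mono fun r hr x hx => (hab hr hx).le⟩
  obtain ⟨M, hM0, hM⟩ := h2
  refine tendsto_nhds_unique h1 (Tendsto.const_mul _ ?_)
  refine intervalIntegral.tendsto_integral_filter_of_dominated_convergence (fun _ => ‖ψ‖ * M)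
    ?_ ?_ intervalIntegrable_const ?_
  · filter_upwards [Ioo_mem_nhdsLT (zero_lt_one' ℝ)] with r hr
    exact ((ψ.continuous.comp continuous_cpt).mul (l.continuous.comp
      (continuous_pk_real hr.1.le hr.2))).aestronglyMeasurable
  · filter_upwards [hM] with r hr
    refine Eventually.of_forall fun φ _ => ?_
    rw [norm_mul]
    by_cases hφ : cpt φ ∈ tsupport ψ
    · exact mul_le_mul (ψ.norm_coe_le_norm _) (hr _ hφ) (norm_nonneg _) (norm_nonneg _)
    · rw [image_eq_zero_of_notMem_tsupport hφ, norm_zero, zero_mul]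
      exact mul_nonneg (norm_nonneg _) hM0
  · refine Eventually.of_forall fun φ _ => ?_
    by_cases hφ : cpt φ ∈ tsupport ψ
    · refine ((hD φ hφ).comp ?_).const_mul _
      refine tendsto_nhdsWithin_iff.2 ⟨?_, ?_⟩
      · have hc : Continuous fun r : ℝ => (r : ℂ) * (cpt φ : ℂ) := by fun_prop
        have := hc.tendsto 1
        rw [ofReal_one, one_mul] at this
        exact this.mono_left nhdsWithin_le_nhds
      · filter_upwards [Ioo_mem_nhdsLT (zero_lt_one' ℝ)] with r hr
        rw [mem_ball_zero_iff, norm_mul_cpt hr.1.le]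
        exact hr.2
    · simp [image_eq_zero_of_notMem_tsupport hφ]

end

section
open Filter Topology MeasureTheory

namespace Spec
variable {H : Type*} [NormedAddCommGroup H] [InnerProductSpace ℂ H] [CompleteSpace H]

/-- The continuous linear map underlying a unitary operator. -/
abbrev op (U : H ≃ₗᵢ[ℂ] H) : H →L[ℂ] H := U.toContinuousLinearEquiv

theorem op_mem (U : H ≃ₗᵢ[ℂ] H) : op U ∈ unitary (H →L[ℂ] H) := by
  have h := (Unitary.linearIsometryEquiv.symm U).2
  rwa [Unitary.coe_symm_linearIsometryEquiv_apply] at h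

theorem op_normal (U : H ≃ₗᵢ[ℂ] H) : IsStarNormal (op U) :=
  ⟨(Unitary.star_mul_self_of_mem (op_mem U)).trans (Unitary.mul_star_self_of_mem (op_mem U)).symm⟩

/-- The continuous functional calculus of a unitary operator, on functions on the circle. -/
def fc (U : H ≃ₗᵢ[ℂ] H) : C(S1, ℂ) →⋆ₐ[ℂ] (H →L[ℂ] H) :=
  cfcHomSuperset (op_normal U) (spectrum.subset_circle_of_unitary (op_mem U))

variable (U : H ≃ₗᵢ[ℂ] H)

theorem continuous_fc : Continuous (fc U) := cfcHomSuperset_continuous _ _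

/-- The coordinate function on the circle. -/
def zid : C(S1, ℂ) := ContinuousMap.restrict S1 (.id ℂ)

theorem zid_apply (x : S1) : zid x = x := rfl

theorem fc_zid : fc U zid = op U := cfcHomSuperset_id _ _

theorem fc_zid_apply (f : H) : fc U zid f = U f := by rw [fc_zid]; rfl

theorem inner_fc_star (ψ : C(S1, ℂ)) (a b : H) : inner ℂ a (fc U (star ψ) b) = inner ℂ (fc U ψ a) b := by
  rw [map_star, ContinuousLinearMap.star_eq_adjoint, ContinuousLinearMap.adjoint_inner_right]

theorem fc_mul_apply (ψ χ : C(S1, ℂ)) (f : H) : fc U (ψ * χ) f = fc U ψ (fc U χ f) := by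
  rw [map_mul]; rfl

/-- The matrix element `⟪a, ψ(U) b⟫` as a functional of `ψ`. -/
def fl (a b : H) : C(S1, ℂ) →L[ℂ] ℂ where
  toFun ψ := inner ℂ a (fc U ψ b)
  map_add' := by simp
  map_smul' := by simp
  cont := by
    have := continuous_fc U
    fun_prop

theorem fl_apply (a b : H) (ψ : C(S1, ℂ)) : fl U a b ψ = inner ℂ a (fc U ψ b) := rfl

/-- The resolvent `(U - z)⁻¹ b`. -/
def rs (z : ℂ) (b : H) : H := fc U (rk z) b

theorem rs_eq {z : ℂ} (hz : ‖z‖ < 1) (b : H) : U (rs U z b) = z • rs U z b + b := by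
  have h : zid * rk z = z • rk z + 1 := by
    ext x
    have := S1_sub_ne hz x
    simp only [ContinuousMap.mul_apply, ContinuousMap.add_apply, ContinuousMap.smul_apply,
      ContinuousMap.one_apply, rk_apply hz, zid_apply, smul_eq_mul]
    field_simp
    ring
  rw [rs, ← fc_zid_apply, ← fc_mul_apply, h]
  simp

theorem fl_pk {z : ℂ} (a b : H) : fl U a b (pk z) =
    inner ℂ a b + z * inner ℂ a (rs U z b) + (starRingEnd ℂ) (z * inner ℂ b (rs U z a)) := by
  rw [fl_apply, pk, map_add, map_add, map_one, _root_.add_apply,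
    _root_.add_apply, inner_add_right, inner_add_right, inner_fc_star]
  simp [rs, inner_smul_right, mul_comm]

/-- The monomial `x ↦ x ^ t` on the circle. -/
def zc (t : ℤ) : C(S1, ℂ) :=
  ⟨fun x => (x : ℂ) ^ t, continuous_subtype_val.zpow₀ t fun x => Or.inl (S1_ne_zero x)⟩

theorem zc_apply (t : ℤ) (x : S1) : zc t x = (x : ℂ) ^ t := rfl

theorem zc_succ (t : ℤ) : zc (t + 1) = zid * zc t := by
  ext x
  rw [ContinuousMap.mul_apply, zc_apply, zc_apply, zid_apply, zpow_add_one₀ (S1_ne_zero x), mul_comm]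

theorem fc_zc (t : ℤ) (f : H) : fc U (zc t) f = (U ^ t) f := by
  have hs : ∀ t : ℤ, (U ^ (t + 1)) f = U ((U ^ t) f) := fun t => by
    rw [add_comm, _root_.zpow_add, zpow_one]; rfl
  induction t with
  | zero =>
    have : zc 0 = 1 := by ext x; simp [zc_apply]
    simp [this]
  | succ n ih => rw [zc_succ, fc_mul_apply, ih, fc_zid_apply, hs]
  | pred n ih =>
    apply U.injective
    rw [← hs, ← fc_zid_apply, ← fc_mul_apply, ← zc_succ, sub_add_cancel, ih]

theorem fc_eigen {x : S1} {φ : H} (h : U φ = (x : ℂ) • φ) (ψ : C(S1, ℂ)) : fc U ψ φ = ψ x • φ := by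
  have hstar : fc U (star zid) φ = star (zid x) • φ := by
    have h1 : fc U (star zid * zid) φ = φ := by
      have : star zid * zid = 1 := by
        ext y
        rw [ContinuousMap.mul_apply, ContinuousMap.star_apply, zid_apply, mul_comm]
        exact S1_mul_conj y
      rw [this]; simp
    rw [fc_mul_apply, fc_zid_apply, h, map_smul] at h1
    conv_rhs => rw [← h1]
    rw [smul_smul, zid_apply, mul_comm, RCLike.star_def, S1_mul_conj, one_smul]
  induction ψ using ContinuousMap.induction_on_of_compact with
  | const r =>
    have : ContinuousMap.const S1 r = r • 1 := by ext; simp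
    rw [this]; simp
  | id => exact (fc_zid_apply U φ).trans h
  | star_id => exact hstar
  | add f g hf hg => rw [map_add, _root_.add_apply, hf, hg, ContinuousMap.add_apply, add_smul]
  | mul f g hf hg =>
    rw [fc_mul_apply, hg, map_smul, hf, ContinuousMap.mul_apply, smul_smul, mul_comm]
  | frequently f hf =>
    have hc : IsClosed {g : C(S1, ℂ) | fc U g φ = g x • φ} := by
      have := continuous_fc U
      have h2 : Continuous fun g : C(S1, ℂ) => g x := by fun_prop
      exact isClosed_eq (by fun_prop) (by fun_prop)
    exact hc.closure_subset (mem_closure_iff_frequently.2 hf)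

end Spec
end

section
open Filter Topology MeasureTheory
open scoped CompactlySupported

namespace Spec
variable {H : Type*} [NormedAddCommGroup H] [InnerProductSpace ℂ H] [CompleteSpace H]
variable (U : H ≃ₗᵢ[ℂ] H)

/-- A real continuous function on the circle, regarded as complex-valued. -/
def toC (ψ : C(S1, ℝ)) : C(S1, ℂ) := ⟨fun x => (ψ x : ℂ), by fun_prop⟩

theorem toC_apply (ψ : C(S1, ℝ)) (x : S1) : toC ψ x = (ψ x : ℂ) := rfl

theorem norm_fc_sq (ψ : C(S1, ℂ)) (g : H) :
    ‖fc U ψ g‖ ^ 2 = (inner ℂ g (fc U (star ψ * ψ) g)).re := by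
  rw [fc_mul_apply, inner_fc_star, ← inner_self_eq_norm_sq (𝕜 := ℂ)]
  rfl

theorem toC_eq_star_mul {ψ : C(S1, ℝ)} (h : ∀ x, 0 ≤ ψ x) :
    ∃ χ : C(S1, ℝ), toC ψ = star (toC χ) * toC χ ∧ ∀ x, χ x ^ 2 = ψ x := by
  refine ⟨⟨fun x => Real.sqrt (ψ x), by fun_prop⟩, ?_, fun x => Real.sq_sqrt (h x)⟩
  ext x
  simp only [toC_apply, ContinuousMap.mul_apply, ContinuousMap.star_apply, ContinuousMap.coe_mk,
    RCLike.star_def, conj_ofReal]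
  rw [← ofReal_mul, Real.mul_self_sqrt (h x)]

/-- The spectral measure of a unitary operator at a vector. -/
theorem exists_measure (g : H) : ∃ μ : Measure S1, IsFiniteMeasure μ ∧
    ∀ ψ : C(S1, ℂ), ‖fc U ψ g‖ ^ 2 = ∫ x, ‖ψ x‖ ^ 2 ∂μ := by
  let L : C_c(S1, ℝ) →ₗ[ℝ] ℝ :=
    { toFun := fun ψ => (inner ℂ g (fc U (toC ψ) g)).re
      map_add' := fun a b => by
        have : toC ((a + b : C_c(S1, ℝ)) : C(S1, ℝ)) = toC a + toC b := by
          ext x; simp [toC_apply]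
        rw [this, map_add, _root_.add_apply, inner_add_right, add_re]
      map_smul' := fun r a => by
        have : toC ((r • a : C_c(S1, ℝ)) : C(S1, ℝ)) = (r : ℂ) • toC a := by
          ext x; simp [toC_apply]
        rw [this, map_smul, _root_.smul_apply, inner_smul_right, re_ofReal_mul]
        rfl }
  let Λ : C_c(S1, ℝ) →ₚ[ℝ] ℝ := PositiveLinearMap.mk₀ L fun ψ hψ => by
    obtain ⟨χ, h, -⟩ := toC_eq_star_mul (ψ := (ψ : C(S1, ℝ))) hψ
    change 0 ≤ (inner ℂ g (fc U (toC ψ) g)).re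
    rw [h, ← norm_fc_sq]
    positivity
  refine ⟨RealRMK.rieszMeasure Λ, inferInstance, fun ψ => ?_⟩
  let f : C(S1, ℝ) := ⟨fun x => ‖ψ x‖ ^ 2, by fun_prop⟩
  have h1 := RealRMK.integral_rieszMeasure Λ (CompactlySupportedContinuousMap.continuousMapEquiv f)
  have h2 : star ψ * ψ = toC f := by
    ext x
    simp only [ContinuousMap.mul_apply, ContinuousMap.star_apply, RCLike.star_def, conj_mul']
    simp [toC_apply, f]
  rw [norm_fc_sq, h2]
  exact h1.symm

theorem measure_singleton {g : H} {μ : Measure S1} [IsFiniteMeasure μ]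
    (hμ : ∀ ψ : C(S1, ℂ), ‖fc U ψ g‖ ^ 2 = ∫ x, ‖ψ x‖ ^ 2 ∂μ)
    (hg : ∀ (φ : H) (w : ℂ), U φ = w • φ → inner ℂ φ g = 0) (ζ : S1) : μ {ζ} = 0 := by
  set T : C(S1, ℂ) := (starRingEnd ℂ) ζ • zid with hT
  set f : H →L[ℂ] H := fc U T with hf
  have hfa : ∀ v, f v = (starRingEnd ℂ) (ζ : ℂ) • U v := fun v => by
    rw [hf, hT, map_smul, _root_.smul_apply, fc_zid_apply]
  have hf1 : ‖f‖ ≤ 1 := by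
    refine ContinuousLinearMap.opNorm_le_bound _ zero_le_one fun v => ?_
    rw [hfa, norm_smul, RCLike.norm_conj, norm_S1, U.norm_map]
  have key := f.tendsto_birkhoffAverage_orthogonalProjection hf1 g
  have hp : (f.eqLocus (1 : H →L[ℂ] H)).orthogonalProjectionOnto g = 0 := by
    rw [Submodule.orthogonalProjectionOnto_eq_zero_iff, Submodule.mem_orthogonal]
    intro φ hφ
    refine hg φ ζ ?_
    have h1 : f φ = φ := hφ
    rw [hfa] at h1
    conv_rhs => rw [← h1]
    rw [smul_smul, S1_mul_conj, one_smul]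
  rw [hp] at key
  let χ : ℕ → C(S1, ℂ) := fun N => (N : ℂ)⁻¹ • ∑ k ∈ Finset.range N, T ^ k
  have hχ : ∀ N, fc U (χ N) g = birkhoffAverage ℂ f _root_.id N g := fun N => by
    simp only [χ, map_smul, map_sum, map_pow, _root_.smul_apply, birkhoffAverage, birkhoffSum, ← hf,
      _root_.sum_apply, FunLike.coe_pow_eq_iterate, id]
  have hone : ∀ N : ℕ, 0 < N → χ N ζ = 1 := fun N hN => by
    have : T ζ = 1 := by
      rw [hT, ContinuousMap.smul_apply, zid_apply, smul_eq_mul, mul_comm, S1_mul_conj]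
    simp only [χ, ContinuousMap.smul_apply, ContinuousMap.coe_sum, Finset.sum_apply, ContinuousMap.pow_apply,
      this, one_pow, Finset.sum_const, Finset.card_range, nsmul_eq_mul, mul_one, smul_eq_mul]
    exact inv_mul_cancel₀ (by exact_mod_cast hN.ne')
  have hle : ∀ N : ℕ, 0 < N → μ.real {ζ} ≤ ‖fc U (χ N) g‖ ^ 2 := fun N hN => by
    rw [hμ]
    have hi : Integrable (fun x => ‖χ N x‖ ^ 2) μ :=
      (by fun_prop : Continuous fun x => ‖χ N x‖ ^ 2).integrable_of_hasCompactSupport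
        (HasCompactSupport.of_compactSpace _)
    calc μ.real {ζ} = ∫ x in {ζ}, ‖χ N x‖ ^ 2 ∂μ := by
          rw [integral_singleton, hone N hN]; simp
      _ ≤ _ := setIntegral_le_integral hi (ae_of_all _ fun x => by positivity)
  have hlim : Tendsto (fun N => ‖fc U (χ N) g‖ ^ 2) atTop (𝓝 0) := by
    have := (key.norm.pow 2)
    simpa [hχ] using this
  have h0 : μ.real {ζ} ≤ 0 := ge_of_tendsto hlim ((eventually_gt_atTop 0).mono hle)
  exact (measureReal_eq_zero_iff).1 (le_antisymm h0 measureReal_nonneg)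

theorem tendsto_fc {g : H} (hg : ∀ (φ : H) (w : ℂ), U φ = w • φ → inner ℂ φ g = 0)
    {B Z : Set S1} (hZ : Z.Countable)
    (h : ∀ x ∉ B, x ∈ Z ∨ ∃ ψ : C(S1, ℂ), ψ x ≠ 0 ∧ fc U ψ g = 0)
    (χ : ℕ → C(S1, ℂ)) (hχ : ∀ n x, ‖χ n x - 1‖ ≤ 1)
    (hl : ∀ x ∈ B, Tendsto (fun n => χ n x) atTop (𝓝 1)) :
    Tendsto (fun n => fc U (χ n) g) atTop (𝓝 g) := by
  obtain ⟨μ, hfin, hμ⟩ := exists_measure U g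
  have hnull : ∀ ψ : C(S1, ℂ), fc U ψ g = 0 → μ {x | ψ x ≠ 0} = 0 := fun ψ hψ => by
    have h1 := hμ ψ
    rw [hψ, norm_zero, zero_pow two_ne_zero] at h1
    have hi : Integrable (fun x => ‖ψ x‖ ^ 2) μ :=
      (by fun_prop : Continuous fun x => ‖ψ x‖ ^ 2).integrable_of_hasCompactSupport
        (HasCompactSupport.of_compactSpace _)
    have h2 := (integral_eq_zero_iff_of_nonneg (fun x => by positivity) hi).1 h1.symm
    refine measure_mono_null (fun x hx => ?_) (ae_iff.1 h2)
    simpa using hx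
  have hB : ∀ᵐ x ∂μ, x ∈ B := by
    rw [ae_iff]
    have hs : {x | x ∉ B} ⊆ Z ∪ {x | ∃ ψ : C(S1, ℂ), ψ x ≠ 0 ∧ fc U ψ g = 0} := fun x hx => h x hx
    refine measure_mono_null hs (measure_union_null ?_ ?_)
    · exact (measure_null_iff_singleton hZ).2 fun x _ => measure_singleton U hμ hg x
    · refine measure_null_of_locally_null _ fun x hx => ?_
      obtain ⟨ψ, h1, h2⟩ := hx
      refine ⟨{y | ψ y ≠ 0}, mem_nhdsWithin_of_mem_nhds ?_, hnull ψ h2⟩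
      exact (isOpen_ne_fun (by fun_prop) continuous_const).mem_nhds h1
  have hlim : Tendsto (fun n => ∫ x, ‖χ n x - 1‖ ^ 2 ∂μ) atTop (𝓝 (∫ x : S1, (0 : ℝ) ∂μ)) := by
    refine tendsto_integral_of_dominated_convergence (fun _ => 1) (fun n => ?_) (integrable_const _)
      (fun n => ae_of_all _ fun x => ?_) (hB.mono fun x hx => ?_)
    · exact (by fun_prop : Continuous fun x => ‖χ n x - 1‖ ^ 2).aestronglyMeasurable
    · rw [Real.norm_of_nonneg (by positivity)]
      exact pow_le_one₀ (norm_nonneg _) (hχ n x)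
    · have := (((hl x hx).sub_const 1).norm).pow 2
      simpa using this
  rw [tendsto_iff_norm_sub_tendsto_zero]
  have h2 : ∀ n, ‖fc U (χ n) g - g‖ = Real.sqrt (∫ x, ‖χ n x - 1‖ ^ 2 ∂μ) := fun n => by
    have := hμ (χ n - 1)
    simp only [map_sub, map_one, _root_.sub_apply, one_apply_eq_self,
      ContinuousMap.sub_apply, ContinuousMap.one_apply] at this
    rw [← this, Real.sqrt_sq (norm_nonneg _)]
  simp only [h2]
  have := (Real.continuous_sqrt.tendsto _).comp hlim
  simpa [Function.comp_def] using this

end Spec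
end

theorem Reg.of_hyp {a₀ : ℂ} {α : ℤ → ℂ} {θ : ℤ → ℝ} (h₀ : 0 < ‖a₀‖) (h₁ : ‖a₀‖ < 1)
    (hα : ∀ x : ℤ, ‖α x‖ < 1)
    (hsum :
      (Generic a₀ α θ ∧ Summable fun x : ℤ => jp x * (‖α x - a₀‖ + |θ x|)) ∨
      (¬ Generic a₀ α θ ∧ Summable fun x : ℤ => jp x ^ 2 * (‖α x - a₀‖ + |θ x|)))
    {s : ℤ} (hs : s = 1 ∨ s = -1) : ∃ k, Reg a₀ α θ k s := by
  rcases hsum with ⟨hg, hS⟩ | ⟨-, hS⟩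
  · have hd : Dat a₀ α θ 0 := ⟨h₀, h₁, hα, summable_pert h₁ hα (m := 1) (by simpa using hS)⟩
    have hr0 := rho_pos h₁
    have hr1 := rho_lt_one h₀
    refine ⟨0, hd, hs, Or.inr ⟨rfl, fun ξ h0 => ?_⟩⟩
    have hp := bc_mem hr0 hr1 hs ξ
    have hw := norm_bc_fst hr0 hr1 hs ξ
    have hk : ‖(bc (rho a₀) s ξ).2‖ = 1 := norm_ch _ _
    have h1 := hd.Wr_lower hp hw hk
    rw [h0, norm_zero, mul_zero] at h1
    have h2 : ‖a₀ * rho a₀ * ((bc (rho a₀) s ξ).2 - (bc (rho a₀) s ξ).2⁻¹)‖ = 0 :=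
      le_antisymm (nonpos_of_mul_nonpos_right h1 h₀) (norm_nonneg _)
    have h3 : (bc (rho a₀) s ξ).2 - (bc (rho a₀) s ξ).2⁻¹ = 0 := by
      rw [norm_eq_zero] at h2
      have : (rho a₀ : ℂ) ≠ 0 := by exact_mod_cast hr0.ne'
      simpa [this, norm_pos_iff.1 h₀] using h2
    have hcos : Real.cos ξ ^ 2 = 1 := by
      have hs2 : Real.sin ξ = 0 := by
        have h4 : ch s ξ = ch (-s) ξ := by
          rw [sub_eq_zero] at h3
          have : ch s ξ = (ch s ξ)⁻¹ := h3
          rw [this, ch_zpow s, ch_zpow (-s), _root_.zpow_neg]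
        have h5 : ch 1 ξ = ch (-1) ξ := by
          rcases hs with rfl | rfl
          · exact h4
          · simpa using h4.symm
        rw [ch_one_eq, ch_neg_one_eq] at h5
        have := congrArg Complex.im h5
        simp [-ofReal_sin, -ofReal_cos] at this
        linarith
      nlinarith [Real.sin_sq_add_cos_sq ξ]
    refine hg (s * disp (rho a₀) ξ) ?_ ?_
    · have h5 : Real.cos (s * disp (rho a₀) ξ) = rho a₀ * Real.cos ξ := by
        have h6 : |rho a₀ * Real.cos ξ| ≤ 1 := by
          rw [abs_mul, abs_of_pos hr0]
          exact mul_le_one₀ hr1.le (abs_nonneg _) (Real.abs_cos_le_one _)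
        have h7 := Real.cos_arccos (neg_le_of_abs_le h6) (le_of_abs_le h6)
        rcases hs with rfl | rfl
        · simpa [disp] using h7
        · simpa [disp] using h7
      rw [h5, abs_mul, abs_of_pos hr0, ← Real.sqrt_sq_eq_abs, hcos, Real.sqrt_one, mul_one]
    · rw [← bc_fst_eq_exp hr0 hr1 hs]
      exact hd.isResonance_of_Wr hp h0 hk
  · exact ⟨1, ⟨h₀, h₁, hα, summable_pert h₁ hα (m := 2) hS⟩, hs, Or.inl rfl⟩

theorem exists_kap {r : ℝ} (hr : 0 < r) (z : ℂ) :
    ∃ κ : ℂ, κ ≠ 0 ∧ ‖κ‖ ≤ 1 ∧ z + z⁻¹ = r * (κ + κ⁻¹) := by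
  set b : ℂ := (z + z⁻¹) / (2 * r) with hb
  have hrc : (r : ℂ) ≠ 0 := by exact_mod_cast hr.ne'
  obtain ⟨q, hq⟩ := IsAlgClosed.exists_pow_nat_eq (b ^ 2 - 1) two_pos
  have hmul : (b + q) * (b - q) = 1 := by linear_combination -hq
  have h1 : b + q ≠ 0 := left_ne_zero_of_mul_eq_one hmul
  have hinv : (b + q)⁻¹ = b - q := inv_eq_of_mul_eq_one_right hmul
  have hzz : z + z⁻¹ = r * ((b + q) + (b + q)⁻¹) := by
    rw [hinv, hb]; field_simp; ring
  rcases le_total ‖b + q‖ 1 with h | h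
  · exact ⟨b + q, h1, h, hzz⟩
  · refine ⟨(b + q)⁻¹, inv_ne_zero h1, ?_, ?_⟩
    · rw [norm_inv]; exact inv_le_one_of_one_le₀ h
    · rw [inv_inv, hzz, add_comm]

/-- The root `κ` of `z + z⁻¹ = r (κ + κ⁻¹)` in the closed unit disc. -/
def kap (r : ℝ) (z : ℂ) : ℂ :=
  if h : 0 < r then (exists_kap h z).choose else 1

section
variable {r : ℝ} (h0 : 0 < r) (h1 : r < 1)
include h0

theorem kap_spec (z : ℂ) :
    kap r z ≠ 0 ∧ ‖kap r z‖ ≤ 1 ∧ z + z⁻¹ = r * (kap r z + (kap r z)⁻¹) := by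
  rw [kap, dif_pos h0]
  exact (exists_kap h0 z).choose_spec

theorem kap_mem {z : ℂ} (hz : 1 / 2 ≤ ‖z‖) (hz1 : ‖z‖ ≤ 1) : (z, kap r z) ∈ Sg r :=
  ⟨norm_pos_iff.1 (by linarith), (kap_spec h0 z).1, (kap_spec h0 z).2.1, hz, hz1, (kap_spec h0 z).2.2⟩

omit h0 in
theorem add_inv_of_norm_one {κ : ℂ} (hκ : ‖κ‖ = 1) : κ + κ⁻¹ = (2 * κ.re : ℝ) := by
  rw [inv_eq_conj hκ, add_conj]

include h1 in
theorem norm_kap_lt {z : ℂ} (hz : z ≠ 0) (hz1 : ‖z‖ < 1) : ‖kap r z‖ < 1 := by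
  obtain ⟨-, hle, heq⟩ := kap_spec h0 z
  refine lt_of_le_of_ne hle fun hκ => ?_
  rw [add_inv_of_norm_one hκ] at heq
  set c := r * (kap r z).re with hc
  have habs : |(kap r z).re| ≤ 1 := (abs_re_le_norm _).trans hle
  have hc1 : c ^ 2 < 1 := by
    rw [hc, mul_pow]
    have : (kap r z).re ^ 2 ≤ 1 := (sq_le_one_iff_abs_le_one _).2 habs
    nlinarith [sq_nonneg (kap r z).re]
  have h2 : z * z + 1 = (2 * c : ℝ) * z := by
    have : z * (z + z⁻¹) = z * z + 1 := by field_simp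
    rw [← this, heq, hc]; push_cast; ring
  have hre := congrArg Complex.re h2
  have him := congrArg Complex.im h2
  simp only [add_re, mul_re, one_re, add_im, mul_im, one_im, ofReal_re, ofReal_im] at hre him
  have hn : z.re ^ 2 + z.im ^ 2 < 1 := by
    have : ‖z‖ ^ 2 < 1 := by nlinarith [norm_nonneg z]
    rw [← normSq_eq_norm_sq, normSq_apply] at this
    linarith
  have h3 : z.im * (z.re - c) = 0 := by linarith
  rcases mul_eq_zero.1 h3 with h | h
  · rw [h] at hre
    nlinarith [sq_nonneg (z.re - c)]
  · have h4 : z.re = c := by linarith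
    rw [h4] at hre hn
    nlinarith

theorem norm_kap_lt_of_gap {z : ℂ} (hz : ‖z‖ = 1) (hg : r < |z.re|) : ‖kap r z‖ < 1 := by
  obtain ⟨-, hle, heq⟩ := kap_spec h0 z
  refine lt_of_le_of_ne hle fun hκ => ?_
  rw [add_inv_of_norm_one hκ, add_inv_of_norm_one hz] at heq
  have h2 : z.re = r * (kap r z).re := by
    have : 2 * z.re = r * (2 * (kap r z).re) := by exact_mod_cast heq
    linarith
  have habs : |(kap r z).re| ≤ 1 := (abs_re_le_norm _).trans hle
  rw [h2, abs_mul, abs_of_pos h0] at hg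
  nlinarith

omit h0 in
theorem add_inv_im {z : ℂ} (hz : z ≠ 0) : (z + z⁻¹).im * ‖z‖ ^ 2 = z.im * (‖z‖ ^ 2 - 1) := by
  have : normSq z ≠ 0 := fun h => hz (normSq_eq_zero.1 h)
  rw [add_im, inv_im, ← normSq_eq_norm_sq]
  field_simp
  ring

include h1 in
theorem kap_im_pos {z : ℂ} (hz : z ≠ 0) (hz1 : ‖z‖ < 1) {s : ℝ} (hs : 0 < s * z.im) :
    0 < s * (kap r z).im := by
  have hk1 := norm_kap_lt h0 h1 hz hz1
  obtain ⟨hk0, -, heq⟩ := kap_spec h0 z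
  have e1 := add_inv_im hz
  have e2 := add_inv_im hk0
  rw [heq, im_ofReal_mul] at e1
  set m := (kap r z + (kap r z)⁻¹).im
  have hz2 : 0 < ‖z‖ ^ 2 := by positivity
  have hk2 : 0 < ‖kap r z‖ ^ 2 := by positivity
  have hz3 : ‖z‖ ^ 2 < 1 := by nlinarith [norm_nonneg z]
  have hk3 : ‖kap r z‖ ^ 2 < 1 := by nlinarith [norm_nonneg (kap r z)]
  have h4 : s * m < 0 := by
    have : (s * m) * (r * ‖z‖ ^ 2) = (s * z.im) * (‖z‖ ^ 2 - 1) := by linear_combination s * e1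
    by_contra! hcon
    have h5 := mul_nonneg hcon (mul_pos h0 hz2).le
    nlinarith
  by_contra! hcon
  have : (s * m) * ‖kap r z‖ ^ 2 = (s * (kap r z).im) * (‖kap r z‖ ^ 2 - 1) := by
    linear_combination s * e2
  nlinarith

open Filter Topology in
theorem tendsto_kap {z₀ κ₀ : ℂ} (hz₀ : z₀ ≠ 0) (hκ₀ : κ₀ ≠ 0) (heq : z₀ + z₀⁻¹ = r * (κ₀ + κ₀⁻¹))
    {l : Filter ℂ} (hl : l ≤ 𝓝 z₀) {δ : ℝ} (hδ : 0 < δ) (hev : ∀ᶠ z in l, δ ≤ ‖kap r z - κ₀⁻¹‖) :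
    Tendsto (fun z => (z, kap r z)) l (𝓝 (z₀, κ₀)) := by
  refine Tendsto.prodMk_nhds (tendsto_id.mono_left hl) ?_
  rw [tendsto_iff_norm_sub_tendsto_zero]
  have hlim : Tendsto (fun z : ℂ => ‖(z + z⁻¹) - (z₀ + z₀⁻¹)‖ / (r * δ)) l (𝓝 0) := by
    have h1 : Tendsto (fun z : ℂ => z + z⁻¹) l (𝓝 (z₀ + z₀⁻¹)) :=
      (tendsto_id.mono_left hl).add ((tendsto_id.mono_left hl).inv₀ hz₀)
    have := ((h1.sub_const (z₀ + z₀⁻¹)).norm).div_const (r * δ)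
    simpa using this
  refine squeeze_zero' (Eventually.of_forall fun _ => norm_nonneg _) (hev.mono fun z hz => ?_) hlim
  obtain ⟨hk0, hk1, hk⟩ := kap_spec h0 z
  rw [le_div_iff₀ (by positivity)]
  have hmul : (r : ℂ) * ((kap r z - κ₀) * (kap r z - κ₀⁻¹)) =
      ((z + z⁻¹) - (z₀ + z₀⁻¹)) * kap r z := by
    rw [hk, heq]; field_simp; ring
  have hn := congrArg norm hmul
  rw [norm_mul, norm_mul, norm_mul, norm_real, Real.norm_of_nonneg h0.le] at hn
  calc ‖kap r z - κ₀‖ * (r * δ) ≤ r * (‖kap r z - κ₀‖ * ‖kap r z - κ₀⁻¹‖) := by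
        nlinarith [mul_le_mul_of_nonneg_left hz (mul_nonneg h0.le (norm_nonneg (kap r z - κ₀)))]
    _ ≤ _ := by
        rw [hn]
        exact mul_le_of_le_one_right (norm_nonneg _) hk1

open Filter Topology in
theorem tendsto_kap_gap {z₀ κ₀ : ℂ} (hz₀ : z₀ ≠ 0) (hκ₀ : κ₀ ≠ 0) (hκ1 : ‖κ₀‖ < 1)
    (heq : z₀ + z₀⁻¹ = r * (κ₀ + κ₀⁻¹)) :
    Tendsto (fun z => (z, kap r z)) (𝓝 z₀) (𝓝 (z₀, κ₀)) := by
  have hκp : 0 < ‖κ₀‖ := norm_pos_iff.2 hκ₀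
  refine tendsto_kap h0 hz₀ hκ₀ heq le_rfl (δ := ‖κ₀‖⁻¹ - 1)
    (sub_pos.2 ((one_lt_inv₀ hκp).2 hκ1)) (Eventually.of_forall fun z => ?_)
  have h2 := norm_sub_norm_le κ₀⁻¹ (kap r z)
  rw [norm_sub_rev, norm_inv] at h2
  linarith [(kap_spec h0 z).2.1]

include h1 in
open Filter Topology in
theorem tendsto_kap_bulk {s : ℤ} (hs : s = 1 ∨ s = -1) {ξ : ℝ} (hξ : 0 < Real.sin ξ) :
    Tendsto (fun z => (z, kap r z)) (𝓝[Metric.ball 0 1] (bc r s ξ).1) (𝓝 (bc r s ξ)) := by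
  have hp := bc_mem h0 h1 hs ξ
  have him : (bc r s ξ).1.im = s * sdisp r ξ := by simp [bc]
  have hs2 : (s : ℝ) * s = 1 := by rcases hs with rfl | rfl <;> norm_num
  have hev : ∀ᶠ z : ℂ in 𝓝 (bc r s ξ).1, 0 < (s : ℝ) * z.im := by
    refine (by fun_prop : Continuous fun z : ℂ => (s : ℝ) * z.im).continuousAt.eventually_const_lt ?_
    change 0 < (s : ℝ) * (bc r s ξ).1.im
    rw [him, ← mul_assoc, hs2, one_mul]
    exact sdisp_pos h0 h1 ξ
  have hne : ∀ᶠ z : ℂ in 𝓝 (bc r s ξ).1, z ≠ 0 := continuousAt_id.eventually_ne hp.1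
  refine tendsto_kap h0 hp.1 hp.2.1 hp.2.2.2.2.2 nhdsWithin_le_nhds hξ ?_
  filter_upwards [nhdsWithin_le_nhds hev, nhdsWithin_le_nhds hne, self_mem_nhdsWithin] with z h2 h3 h4
  have h5 := kap_im_pos h0 h1 h3 (mem_ball_zero_iff.1 h4) h2
  have h6 : ((bc r s ξ).2⁻¹).im = -(s * Real.sin ξ) := by
    have : (bc r s ξ).2 = ch s ξ := rfl
    rw [this, inv_eq_conj (norm_ch _ _), conj_im]
    rcases hs with rfl | rfl
    · rw [ch_one_eq]; simp [-ofReal_sin, -ofReal_cos]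
    · rw [ch_neg_one_eq]; simp [-ofReal_sin, -ofReal_cos]
  calc Real.sin ξ ≤ s * (kap r z).im + Real.sin ξ := by linarith
    _ = s * (kap r z - (bc r s ξ).2⁻¹).im := by
        rw [sub_im, h6]; linear_combination -Real.sin ξ * hs2
    _ ≤ |s * (kap r z - (bc r s ξ).2⁻¹).im| := le_abs_self _
    _ = |(kap r z - (bc r s ξ).2⁻¹).im| := by
        rw [abs_mul]
        rcases hs with rfl | rfl <;> simp
    _ ≤ _ := abs_im_le_norm _

end

section
open Filter Topology Spec

/-- The standard basis vector of `l²(ℤ, ℂ²)` indexed by a site and a spin. -/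
def dl (b : ℤ × Fin 2) : Hsp := lp.single 2 b.1 (EuclideanSpace.single b.2 1)

/-- The coordinate of a vector of `l²(ℤ, ℂ²)`. -/
def co (u : Hsp) (a : ℤ × Fin 2) : ℂ := (u : ∀ _ : ℤ, EuclideanSpace ℂ (Fin 2)) a.1 a.2

theorem inner_dl (a : ℤ × Fin 2) (u : Hsp) : inner ℂ (dl a) u = co u a := by
  rw [dl, lp.inner_single_left, EuclideanSpace.inner_single_left]
  simp [co]

theorem ext_co {u v : Hsp} (h : ∀ a, co u a = co v a) : u = v := by
  ext x i
  exact h (x, i)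

theorem co_dl (a b : ℤ × Fin 2) : co (dl b) a = if a = b then 1 else 0 := by
  obtain ⟨x, i⟩ := a
  obtain ⟨y, j⟩ := b
  simp only [co, dl, Prod.mk.injEq]
  by_cases hxy : x = y
  · subst hxy
    rw [lp.single_apply_self]
    by_cases hij : i = j <;> simp [hij]
  · rw [lp.single_apply_ne _ _ _ hxy]
    simp [hxy]

theorem norm_dl (a : ℤ × Fin 2) : inner ℂ (dl a) (dl a) = 1 := by
  rw [inner_dl, co_dl, if_pos rfl]

theorem hasSum_dl (u : Hsp) : HasSum (fun x : ℤ => ∑ j, co u (x, j) • dl (x, j)) u := by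
  have h := lp.hasSum_single (p := 2) (by norm_num) u
  have e : ∀ x : ℤ, ∑ j, co u (x, j) • dl (x, j) =
      lp.single 2 x ((u : ∀ _ : ℤ, EuclideanSpace ℂ (Fin 2)) x) := fun x => by
    have e1 : (u : ∀ _ : ℤ, EuclideanSpace ℂ (Fin 2)) x =
        ∑ j, co u (x, j) • EuclideanSpace.single j (1 : ℂ) := by
      ext j
      fin_cases j <;> simp [co]
    conv_rhs => rw [e1]
    exact (Finset.sum_congr rfl fun j _ => ((lp.lsingle (𝕜 := ℂ) 2 x).map_smul _ _).symm).trans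
      (map_sum (lp.lsingle (𝕜 := ℂ) 2 x) _ _).symm
  simpa only [e] using h

theorem eq_zero_of_inner_dl {u : Hsp} (h : ∀ a, inner ℂ (dl a) u = 0) : u = 0 :=
  ext_co fun a => by rw [← inner_dl, h]; simp [co]

/-- `U` is the quantum walk with coin `coinOf α θ`. -/
def IsQW (α : ℤ → ℂ) (θ : ℤ → ℝ) (U : Hsp ≃ₗᵢ[ℂ] Hsp) : Prop :=
  ∀ u : Hsp, ∀ x : ℤ, ∀ i : Fin 2,
    (U u : ∀ _ : ℤ, EuclideanSpace ℂ (Fin 2)) x i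
      = qw (coinOf α θ)
          (fun y : ℤ => fun j : Fin 2 => (u : ∀ _ : ℤ, EuclideanSpace ℂ (Fin 2)) y j) x i

/-- The resolvent kernel. -/
def gq (a₀ : ℂ) (α : ℤ → ℂ) (θ : ℤ → ℝ) (p : ℂ × ℂ) (a b : ℤ × Fin 2) : ℂ :=
  gk a₀ α θ p b.1 b.2 a.1 a.2 / Wr a₀ α θ p

/-- The spectral density kernel. -/
def ds (a₀ : ℂ) (α : ℤ → ℂ) (θ : ℤ → ℝ) (p : ℂ × ℂ) (a b : ℤ × Fin 2) : ℂ :=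
  inner ℂ (dl a) (dl b) + p.1 * gq a₀ α θ p a b + (starRingEnd ℂ) (p.1 * gq a₀ α θ p b a)

theorem rs_unique {H : Type*} [NormedAddCommGroup H] [InnerProductSpace ℂ H] [CompleteSpace H]
    (U : H ≃ₗᵢ[ℂ] H) {z : ℂ} (hz : ‖z‖ < 1) {b u : H} (h : U u = z • u + b) : u = rs U z b := by
  have h1 : U (u - rs U z b) = z • (u - rs U z b) := by
    rw [map_sub, h, rs_eq U hz, smul_sub]; abel
  have h2 := congrArg norm h1
  rw [U.norm_map, norm_smul] at h2
  refine sub_eq_zero.1 (norm_eq_zero.1 ?_)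
  nlinarith [norm_nonneg (u - rs U z b)]

namespace IsQW
variable {a₀ : ℂ} {α : ℤ → ℂ} {θ : ℤ → ℝ} {U : Hsp ≃ₗᵢ[ℂ] Hsp}

theorem exists_eigen (hU : IsQW α θ U) (h : Dat a₀ α θ 0) {p : ℂ × ℂ} (hp : p ∈ Sg (rho a₀))
    (hk : ‖p.2‖ < 1) (h0 : Wr a₀ α θ p = 0) : ∃ φ : Hsp, φ ≠ 0 ∧ U φ = p.1 • φ := by
  obtain ⟨u, ⟨x₀, hx₀⟩, hq, C, hC⟩ := h.exists_of_Wr hp h0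
  obtain ⟨φ, hφ⟩ := exists_lp (norm_nonneg _) hk hC
  refine ⟨φ, fun hz => hx₀ ?_, ?_⟩
  · ext i
    rw [← hφ, hz]; rfl
  · ext x i
    have e : (fun y : ℤ => fun j : Fin 2 => (φ : ∀ _ : ℤ, EuclideanSpace ℂ (Fin 2)) y j) = u := by
      ext y j; exact hφ y j
    rw [hU φ x i, e, hq]
    exact congrArg (p.1 * ·) (hφ x i).symm

theorem exists_res (hU : IsQW α θ U) (h : Dat a₀ α θ 0) {p : ℂ × ℂ} (hp : p ∈ Sg (rho a₀))
    (hk : ‖p.2‖ < 1) (h0 : Wr a₀ α θ p ≠ 0) (b : ℤ × Fin 2) :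
    ∃ G : Hsp, U G = p.1 • G + dl b ∧ ∀ a, co G a = gq a₀ α θ p a b := by
  obtain ⟨C, hC⟩ := h.gk_le hp b.1 b.2
  obtain ⟨G, hG⟩ := exists_lp (u := fun x i => gq a₀ α θ p (x, i) b)
    (C := C * ‖Wr a₀ α θ p‖⁻¹) (norm_nonneg _) hk fun x i => by
      rw [gq, norm_div, div_eq_mul_inv, mul_right_comm]
      exact mul_le_mul_of_nonneg_right (hC x i) (by positivity)
  refine ⟨G, ext_co fun a => ?_, fun a => hG a.1 a.2⟩
  obtain ⟨x, i⟩ := a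
  have e : (fun y : ℤ => fun j : Fin 2 => (G : ∀ _ : ℤ, EuclideanSpace ℂ (Fin 2)) y j) =
      fun y => (Wr a₀ α θ p)⁻¹ • gk a₀ α θ p b.1 b.2 y := by
    ext y j
    rw [hG, gq, div_eq_inv_mul]; rfl
  have e2 : ∀ x, qw (coinOf α θ) (fun y => (Wr a₀ α θ p)⁻¹ • gk a₀ α θ p b.1 b.2 y) x =
      (Wr a₀ α θ p)⁻¹ • qw (coinOf α θ) (gk a₀ α θ p b.1 b.2) x := fun x => by
    ext i; fin_cases i <;> simp [qw, mulVec_smul]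
  have e3 : co (p.1 • G + dl b) (x, i) = p.1 * co G (x, i) + co (dl b) (x, i) := rfl
  rw [e3, co_dl]
  change (U G : ∀ _ : ℤ, EuclideanSpace ℂ (Fin 2)) x i = p.1 * (G : ∀ _ : ℤ, EuclideanSpace ℂ (Fin 2)) x i + _
  rw [hU G x i, e, e2, h.qw_gk hp, hG, gq, Pi.smul_apply, Pi.add_apply, Pi.smul_apply, Pi.smul_apply]
  simp only [smul_eq_mul]
  have e4 : (if x = b.1 then (Pi.single b.2 1 : Fin 2 → ℂ) else 0) i = if (x, i) = b then 1 else 0 := by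
    obtain ⟨y, j⟩ := b
    simp only [Prod.mk.injEq]
    by_cases hxy : x = y <;> by_cases hij : i = j <;> simp [hxy, hij]
  rw [e4]
  field_simp

theorem Wr_ne (hU : IsQW α θ U) (h : Dat a₀ α θ 0) {p : ℂ × ℂ} (hp : p ∈ Sg (rho a₀))
    (hk : ‖p.2‖ < 1) (h1 : ‖p.1‖ < 1) : Wr a₀ α θ p ≠ 0 := fun h0 => by
  obtain ⟨φ, hφ, he⟩ := hU.exists_eigen h hp hk h0
  have h2 := congrArg norm he
  rw [U.norm_map, norm_smul] at h2
  have := norm_pos_iff.2 hφ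
  nlinarith

theorem fl_eq (hU : IsQW α θ U) (h : Dat a₀ α θ 0) {z : ℂ} (hz : 1 / 2 ≤ ‖z‖) (hz1 : ‖z‖ < 1)
    (a b : ℤ × Fin 2) : fl U (dl a) (dl b) (pk z) = ds a₀ α θ (z, kap (rho a₀) z) a b := by
  have hr0 := rho_pos h.lt_one
  have hr1 := rho_lt_one h.pos
  have hp := kap_mem hr0 hz hz1.le
  have hk := norm_kap_lt hr0 hr1 hp.1 hz1
  have key : ∀ a b, inner ℂ (dl a) (rs U z (dl b)) = gq a₀ α θ (z, kap (rho a₀) z) a b := fun a b => by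
    obtain ⟨G, hG, hc⟩ := hU.exists_res h hp hk (hU.Wr_ne h hp hk hz1) b
    rw [← rs_unique U hz1 hG, inner_dl, hc]
  rw [fl_pk, key, key, ds]

theorem tendsto_fl (hU : IsQW α θ U) (h : Dat a₀ α θ 0) {p : ℂ × ℂ} (hp : p ∈ Sg (rho a₀))
    (h1 : ‖p.1‖ = 1) (h0 : Wr a₀ α θ p ≠ 0)
    (hl : Tendsto (fun z => (z, kap (rho a₀) z)) (𝓝[Metric.ball 0 1] p.1) (𝓝 p)) (a b : ℤ × Fin 2) :
    Tendsto (fun z => fl U (dl a) (dl b) (pk z)) (𝓝[Metric.ball 0 1] p.1) (𝓝 (ds a₀ α θ p a b)) := by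
  have hr0 := rho_pos h.lt_one
  have hev : ∀ᶠ z : ℂ in 𝓝[Metric.ball 0 1] p.1, 1 / 2 ≤ ‖z‖ ∧ ‖z‖ < 1 := by
    have h2 : ∀ᶠ z : ℂ in 𝓝 p.1, 1 / 2 < ‖z‖ :=
      continuous_norm.continuousAt.eventually_const_lt (by simp only [h1]; norm_num)
    filter_upwards [nhdsWithin_le_nhds h2, self_mem_nhdsWithin] with z h3 h4
    exact ⟨h3.le, mem_ball_zero_iff.1 h4⟩
  have hl2 : Tendsto (fun z => (z, kap (rho a₀) z)) (𝓝[Metric.ball 0 1] p.1) (𝓝[Sg (rho a₀)] p) :=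
    tendsto_nhdsWithin_iff.2 ⟨hl, hev.mono fun z hz => kap_mem hr0 hz.1 hz.2.le⟩
  have hg : ∀ a b, ContinuousWithinAt (fun p => gq a₀ α θ p a b) (Sg (rho a₀)) p := fun a b =>
    (h.continuousOn_gk b.1 b.2 a.1 a.2 p hp).div (h.continuousOn_Wr p hp) h0
  have hd : ContinuousWithinAt (fun p => ds a₀ α θ p a b) (Sg (rho a₀)) p := by
    unfold ds
    refine ((continuousWithinAt_const).add (continuousWithinAt_fst.mul (hg a b))).add ?_
    exact continuous_conj.continuousAt.comp_continuousWithinAt (continuousWithinAt_fst.mul (hg b a))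
  refine (hd.tendsto.comp hl2).congr' (hev.mono fun z hz => ?_)
  exact (hU.fl_eq h hz.1 hz.2 a b).symm

theorem ds_eq_zero (hU : IsQW α θ U) (h : Dat a₀ α θ 0) {p : ℂ × ℂ} (hp : p ∈ Sg (rho a₀))
    (hk : ‖p.2‖ < 1) (h1 : ‖p.1‖ = 1) (h0 : Wr a₀ α θ p ≠ 0) (a : ℤ × Fin 2) :
    ds a₀ α θ p a a = 0 := by
  obtain ⟨G, hG, hc⟩ := hU.exists_res h hp hk h0 a
  have h2 : inner ℂ (U G) (U G) = inner ℂ G G := U.inner_map_map G G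
  rw [hG, inner_add_left, inner_add_right, inner_add_right, inner_smul_left, inner_smul_left,
    inner_smul_right, inner_smul_right, ← inner_conj_symm G (dl a), norm_dl, inner_dl, hc] at h2
  have h3 : (starRingEnd ℂ) p.1 * p.1 = 1 := by rw [conj_mul', h1]; simp
  rw [ds, norm_dl, map_mul]
  linear_combination h2 - inner ℂ G G * h3

end IsQW
end

section
open Filter Topology Spec

theorem Spec.fc_toC_eq_zero {U : Hsp ≃ₗᵢ[ℂ] Hsp} {ψ : C(S1, ℝ)} (hψ : ∀ x, 0 ≤ ψ x)
    (h : ∀ a, fl U (dl a) (dl a) (toC ψ) = 0) : ∃ χ : C(S1, ℂ), (∀ x, ψ x ≠ 0 → χ x ≠ 0) ∧ fc U χ = 0 := by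
  obtain ⟨χ, h1, h2⟩ := toC_eq_star_mul hψ
  refine ⟨toC χ, fun x hx h3 => hx ?_, ?_⟩
  · have : χ x = 0 := by simpa [toC_apply] using h3
    rw [← h2, this]; simp
  have h3 : ∀ a, fc U (toC χ) (dl a) = 0 := fun a => by
    have h4 := norm_fc_sq U (toC χ) (dl a)
    rw [← h1, ← fl_apply, h, zero_re] at h4
    exact norm_eq_zero.1 (pow_eq_zero_iff two_ne_zero |>.1 h4)
  ext1 u
  have h5 := ((hasSum_dl u).mapL (fc U (toC χ))).tsum_eq
  rw [← h5]
  simp [h3]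

theorem Reg.Wr_ne_zero {a₀ : ℂ} {α : ℤ → ℂ} {θ : ℤ → ℝ} {k : ℕ} {s : ℤ} (h : Reg a₀ α θ k s)
    {ξ : ℝ} (hξ : 0 < Real.sin ξ) : Wr a₀ α θ (bc (rho a₀) s ξ) ≠ 0 := by
  have hr0 := rho_pos h.dat0.lt_one
  refine norm_pos_iff.1 (lt_of_lt_of_le ?_ (h.Wr_lower ξ))
  have h1 : 0 < ‖ch 2 ξ - 1‖ := norm_pos_iff.2 fun h0 => by
    rw [ch_two_eq, ch_one_eq] at h0
    rcases mul_eq_zero.1 h0 with h1 | h1 <;>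
    · have := congrArg Complex.im h1
      simp [-ofReal_sin, -ofReal_cos] at this
      linarith
  have := h.dat0.pos
  positivity

namespace IsQW
variable {a₀ : ℂ} {α : ℤ → ℂ} {θ : ℤ → ℝ} {U : Hsp ≃ₗᵢ[ℂ] Hsp}

theorem gap (hU : IsQW α θ U) (h : Dat a₀ α θ 0) (w : S1) (hg : rho a₀ < |(w : ℂ).re|)
    (hw : ∀ φ : Hsp, U φ = (w : ℂ) • φ → φ = 0) : ∃ χ : C(S1, ℂ), χ w ≠ 0 ∧ fc U χ = 0 := by
  have hr0 := rho_pos h.lt_one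
  have hr1 := rho_lt_one h.pos
  have hw1 : ‖(w : ℂ)‖ = 1 := norm_S1 w
  have hp := kap_mem hr0 (z := (w : ℂ)) (by rw [hw1]; norm_num) hw1.le
  have hk := norm_kap_lt_of_gap hr0 hw1 hg
  have hW : Wr a₀ α θ ((w : ℂ), kap (rho a₀) w) ≠ 0 := fun h0 => by
    obtain ⟨φ, h1, h2⟩ := hU.exists_eigen h hp hk h0
    exact h1 (hw φ h2)
  have hev1 : ∀ᶠ z : ℂ in 𝓝 (w : ℂ), rho a₀ < |z.re| :=
    (by fun_prop : Continuous fun z : ℂ => |z.re|).continuousAt.eventually_const_lt hg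
  have hev2 : ∀ᶠ z : ℂ in 𝓝 (w : ℂ), ‖z‖ = 1 → Wr a₀ α θ (z, kap (rho a₀) z) ≠ 0 := by
    have h1 := tendsto_kap_gap hr0 hp.1 hp.2.1 hk hp.2.2.2.2.2
    have h2 : Tendsto (fun z => (z, kap (rho a₀) z)) (𝓝[Metric.sphere 0 1] (w : ℂ))
        (𝓝[Sg (rho a₀)] ((w : ℂ), kap (rho a₀) w)) := by
      refine tendsto_nhdsWithin_iff.2 ⟨h1.mono_left nhdsWithin_le_nhds, ?_⟩
      filter_upwards [self_mem_nhdsWithin] with z hz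
      have hz1 : ‖z‖ = 1 := mem_sphere_zero_iff_norm.1 hz
      exact kap_mem hr0 (by rw [hz1]; norm_num) hz1.le
    have h3 := ((h.continuousOn_Wr _ hp).tendsto.comp h2).eventually_ne hW
    filter_upwards [eventually_nhdsWithin_iff.1 h3] with z hz hz1
    exact hz (mem_sphere_zero_iff_norm.2 hz1)
  obtain ⟨ε, hε, hball⟩ := Metric.eventually_nhds_iff_ball.1 (hev1.and hev2)
  let ψ : C(S1, ℝ) := ⟨fun x => max 0 (ε / 2 - dist (x : ℂ) w), by fun_prop⟩
  have hsupp : ∀ x ∈ tsupport (toC ψ), (x : ℂ) ∈ Metric.ball (w : ℂ) ε := fun x hx => by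
    have hcl : IsClosed {x : S1 | dist (x : ℂ) w ≤ ε / 2} := isClosed_le (by fun_prop) (by fun_prop)
    have hsub : Function.support (toC ψ) ⊆ {x : S1 | dist (x : ℂ) w ≤ ε / 2} := fun y hy => by
      by_contra hcon
      refine hy ?_
      have : ψ y = 0 := max_eq_left (by
        simp only [Set.mem_ofPred_eq, not_le] at hcon
        linarith)
      rw [toC_apply, this, ofReal_zero]
    have := closure_minimal hsub hcl hx
    simp only [Set.mem_ofPred_eq] at this
    exact Metric.mem_ball.2 (by linarith)
  have hfl : ∀ a, fl U (dl a) (dl a) (toC ψ) = 0 := fun a => by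
    rw [eq_integral_boundary (fl U (dl a) (dl a)) (toC ψ) (fun _ => 0) fun φ hφ => ?_]
    · simp
    · obtain ⟨h1, h2⟩ := hball _ (hsupp _ hφ)
      have hz1 := norm_S1 (cpt φ)
      have hp' := kap_mem hr0 (z := (cpt φ : ℂ)) (by rw [hz1]; norm_num) hz1.le
      have hk' := norm_kap_lt_of_gap hr0 hz1 h1
      have h3 := hU.tendsto_fl h hp' hz1 (h2 hz1)
        ((tendsto_kap_gap hr0 hp'.1 hp'.2.1 hk' hp'.2.2.2.2.2).mono_left nhdsWithin_le_nhds) a a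
      rwa [hU.ds_eq_zero h hp' hk' hz1 (h2 hz1)] at h3
  obtain ⟨χ, h1, h2⟩ := fc_toC_eq_zero (fun x => le_max_left _ _) hfl
  refine ⟨χ, h1 w ?_, h2⟩
  have : ψ w = ε / 2 := by
    change max 0 (ε / 2 - dist (w : ℂ) w) = ε / 2
    rw [dist_self, sub_zero, max_eq_right (by positivity)]
  rw [this]; positivity

theorem tendsto_fl_bulk (hU : IsQW α θ U) {k : ℕ} {s : ℤ} (h : Reg a₀ α θ k s) {ξ : ℝ}
    (hξ : 0 < Real.sin ξ) (a b : ℤ × Fin 2) :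
    Tendsto (fun z => fl U (dl a) (dl b) (pk z)) (𝓝[Metric.ball 0 1] (bc (rho a₀) s ξ).1)
      (𝓝 (ds a₀ α θ (bc (rho a₀) s ξ) a b)) := by
  have hr0 := rho_pos h.dat0.lt_one
  have hr1 := rho_lt_one h.dat0.pos
  exact hU.tendsto_fl h.dat0 (h.mem ξ) (norm_bc_fst hr0 hr1 h.sign ξ) (h.Wr_ne_zero hξ)
    (tendsto_kap_bulk hr0 hr1 h.sign hξ) a b

end IsQW

theorem Spec.norm_rs_sq {H : Type*} [NormedAddCommGroup H] [InnerProductSpace ℂ H] [CompleteSpace H]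
    (U : H ≃ₗᵢ[ℂ] H) {z : ℂ} (hz : ‖z‖ < 1) (b : H) :
    (((1 - ‖z‖ ^ 2) * ‖rs U z b‖ ^ 2 : ℝ) : ℂ) = fl U b b (pk z) := by
  have h2 : inner ℂ (U (rs U z b)) (U (rs U z b)) = inner ℂ (rs U z b) (rs U z b) := U.inner_map_map _ _
  rw [rs_eq U hz, inner_add_left, inner_add_right, inner_add_right, inner_smul_left, inner_smul_left,
    inner_smul_right, inner_smul_right, ← inner_conj_symm (rs U z b) b] at h2
  have h3 : (starRingEnd ℂ) z * z = (‖z‖ : ℂ) ^ 2 := conj_mul' z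
  have h4 : inner ℂ (rs U z b) (rs U z b) = (‖rs U z b‖ : ℂ) ^ 2 := inner_self_eq_norm_sq_to_K _
  rw [fl_pk, map_mul]
  push_cast
  rw [← h4, ← h3]
  linear_combination -h2

theorem Spec.eq_zero_of_bounded {H : Type*} [NormedAddCommGroup H] [InnerProductSpace ℂ H]
    [CompleteSpace H] (U : H ≃ₗᵢ[ℂ] H) {w : ℂ} (hw : ‖w‖ = 1) {φ b : H} (hφ : U φ = w • φ) {d : ℂ}
    (hd : Tendsto (fun z => fl U b b (pk z)) (𝓝[Metric.ball 0 1] w) (𝓝 d)) : inner ℂ φ b = 0 := by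
  have hww : (starRingEnd ℂ) w * w = 1 := by rw [conj_mul', hw]; simp
  have hlim : Tendsto (fun r : ℝ => (r : ℂ) * w) (𝓝[Set.Ioo 0 1] 1) (𝓝[Metric.ball 0 1] w) := by
    refine tendsto_nhdsWithin_iff.2 ⟨?_, ?_⟩
    · have : Continuous fun r : ℝ => (r : ℂ) * w := by fun_prop
      have := (this.tendsto 1).mono_left (nhdsWithin_le_nhds (s := Set.Ioo 0 1))
      simpa using this
    · filter_upwards [self_mem_nhdsWithin] with r hr
      rw [mem_ball_zero_iff, norm_mul, norm_real, hw, mul_one, Real.norm_of_nonneg hr.1.le]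
      exact hr.2
  have hle : ∀ᶠ r : ℝ in 𝓝[Set.Ioo 0 1] 1, ‖inner ℂ φ b‖ ^ 2 ≤
      (1 - r) * (‖φ‖ ^ 2 * ‖fl U b b (pk ((r : ℂ) * w))‖) := by
    filter_upwards [self_mem_nhdsWithin] with r hr
    have hn : ‖(r : ℂ) * w‖ = r := by rw [norm_mul, norm_real, hw, mul_one, Real.norm_of_nonneg hr.1.le]
    have hz : ‖(r : ℂ) * w‖ < 1 := by rw [hn]; exact hr.2
    set R := rs U ((r : ℂ) * w) b with hR
    have h1 : inner ℂ (U φ) (U R) = inner ℂ φ R := U.inner_map_map _ _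
    rw [hφ, rs_eq U hz, inner_smul_left, inner_add_right, inner_smul_right] at h1
    have h2 : inner ℂ φ b = ((1 - r : ℝ) : ℂ) * w * inner ℂ φ R := by
      push_cast
      linear_combination w * h1 - (inner ℂ φ b + r * w * inner ℂ φ R) * hww
    have h3 : ‖inner ℂ φ b‖ ≤ (1 - r) * (‖φ‖ * ‖R‖) := by
      rw [h2, norm_mul, norm_mul, hw, mul_one, norm_real, Real.norm_of_nonneg (by linarith [hr.2])]
      exact mul_le_mul_of_nonneg_left (norm_inner_le_norm _ _) (by linarith [hr.2])
    have h4 : ‖fl U b b (pk ((r : ℂ) * w))‖ = (1 - r ^ 2) * ‖R‖ ^ 2 := by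
      rw [← norm_rs_sq U hz, norm_real, hn, Real.norm_of_nonneg]
      have := hr.1; have := hr.2
      exact mul_nonneg (by nlinarith) (by positivity)
    rw [h4]
    calc _ ≤ ((1 - r) * (‖φ‖ * ‖R‖)) ^ 2 := pow_le_pow_left₀ (norm_nonneg _) h3 2
      _ = (1 - r) * (‖φ‖ ^ 2 * ((1 - r) * ‖R‖ ^ 2)) := by ring
      _ ≤ _ := by
          have := hr.1; have := hr.2
          have : 1 - r ≤ 1 - r ^ 2 := by nlinarith
          have : 0 ≤ 1 - r := by linarith
          gcongr
  have hlim2 : Tendsto (fun r : ℝ => (1 - r) * (‖φ‖ ^ 2 * ‖fl U b b (pk ((r : ℂ) * w))‖))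
      (𝓝[Set.Ioo 0 1] 1) (𝓝 ((1 - 1) * (‖φ‖ ^ 2 * ‖d‖))) := by
    refine Tendsto.mul ?_ (((hd.comp hlim).norm).const_mul _)
    exact ((by fun_prop : Continuous fun r : ℝ => 1 - r).tendsto 1).mono_left nhdsWithin_le_nhds
  have hne : (𝓝[Set.Ioo (0 : ℝ) 1] 1).NeBot := by
    rw [← mem_closure_iff_nhdsWithin_neBot, closure_Ioo zero_ne_one]
    simp
  have := ge_of_tendsto hlim2 hle
  rw [sub_self, zero_mul] at this
  exact norm_eq_zero.1 (pow_eq_zero_iff two_ne_zero |>.1 (le_antisymm this (by positivity)))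

end

section
open Filter Topology

theorem exists_bc {r : ℝ} (h0 : 0 < r) (x : S1) (hx : |(x : ℂ).re| < r) :
    ∃ s : ℤ, (s = 1 ∨ s = -1) ∧ ∃ ξ ∈ Set.Ioo 0 Real.pi, (x : ℂ) = (bc r s ξ).1 := by
  obtain ⟨l1, l2⟩ := abs_lt.1 hx
  have hc : Real.cos (Real.arccos ((x : ℂ).re / r)) = (x : ℂ).re / r :=
    Real.cos_arccos (by rw [le_div_iff₀ h0]; linarith) (by rw [div_le_iff₀ h0]; linarith)
  have hre : r * Real.cos (Real.arccos ((x : ℂ).re / r)) = (x : ℂ).re := by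
    rw [hc]; field_simp
  have hξ : Real.arccos ((x : ℂ).re / r) ∈ Set.Ioo 0 Real.pi := by
    refine ⟨Real.arccos_pos.2 (by rw [div_lt_iff₀ h0]; linarith), lt_of_le_of_ne (Real.arccos_le_pi _) ?_⟩
    rw [Ne, Real.arccos_eq_pi, not_le, lt_div_iff₀ h0]; linarith
  have him : (sdisp r (Real.arccos ((x : ℂ).re / r))) = |(x : ℂ).im| := by
    rw [sdisp, hre, ← Real.sqrt_sq_eq_abs]
    congr 1
    have := norm_S1 x
    have h2 := Complex.sq_norm (x : ℂ)
    rw [this, normSq_apply] at h2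
    nlinarith
  rcases le_total 0 (x : ℂ).im with hs | hs
  · refine ⟨1, .inl rfl, _, hξ, ?_⟩
    rw [bc, him, abs_of_nonneg hs, ← ofReal_mul, hre]
    apply Complex.ext <;> simp
  · refine ⟨-1, .inr rfl, _, hξ, ?_⟩
    rw [bc, him, abs_of_nonpos hs, ← ofReal_mul, hre]
    apply Complex.ext <;> simp

theorem osc_isW {r : ℝ} (h0 : 0 < r) (h1 : r < 1) : ∃ C : ℝ, 0 ≤ C ∧ ∀ (t : ℤ) (A : ℝ → ℂ) (M : ℝ),
    IsW 0 A M → ‖∫ ξ in (0 : ℝ)..Real.pi, Complex.exp (I * ((t * disp r ξ : ℝ) : ℂ)) * A ξ‖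
      ≤ C * M * (1 + |(t : ℝ)|) ^ (-(1 / 3 : ℝ)) := by
  obtain ⟨C, hC, hosc⟩ := osc_bound h0 h1
  refine ⟨C, hC, fun t A M hA => ?_⟩
  obtain ⟨ι, hι, c, σ, hs, hM, hA⟩ := hA
  simp only [pow_zero, mul_one] at hs hM
  have hd := continuous_disp h0 h1
  set F : ι → ℝ → ℂ := fun i ξ => c i * Complex.exp (I * ((t * disp r ξ + σ i * ξ : ℝ) : ℂ)) with hF
  have hn : ∀ i ξ, ‖F i ξ‖ = ‖c i‖ := fun i ξ => by
    rw [hF]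
    simp only [norm_mul, mul_comm I, norm_exp_ofReal_mul_I, mul_one]
  have key : HasSum (fun i => ∫ ξ in (0 : ℝ)..Real.pi, F i ξ)
      (∫ ξ in (0 : ℝ)..Real.pi, Complex.exp (I * ((t * disp r ξ : ℝ) : ℂ)) * A ξ) := by
    refine intervalIntegral.hasSum_integral_of_dominated_convergence (fun i _ => ‖c i‖)
      (fun i => ?_) (fun i => .of_forall fun ξ _ => (hn i ξ).le) (.of_forall fun _ _ => hs)
      intervalIntegrable_const (.of_forall fun ξ _ => ?_)
    · exact Continuous.aestronglyMeasurable (by fun_prop)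
    · have h2 : Summable fun i => F i ξ := .of_norm (by simpa only [hn] using hs)
      have h3 : Complex.exp (I * ((t * disp r ξ : ℝ) : ℂ)) * A ξ = ∑' i, F i ξ := by
        rw [hA, ← tsum_mul_left]
        refine tsum_congr fun i => ?_
        rw [hF]
        simp only [ch, ofReal_add, mul_add, Complex.exp_add]
        ring
      rw [h3]
      exact h2.hasSum
  rw [← key.tsum_eq]
  refine tsum_of_norm_bounded (g := fun i => ‖c i‖ * (C * (1 + |(t : ℝ)|) ^ (-(1 / 3 : ℝ))))
    (hs.hasSum.mul_right _) (fun i => ?_) |>.trans ?_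
  · rw [hF]
    simp only [intervalIntegral.integral_const_mul, norm_mul]
    exact mul_le_mul_of_nonneg_left (hosc t (σ i)) (norm_nonneg _)
  · have : 0 ≤ C * (1 + |(t : ℝ)|) ^ (-(1 / 3 : ℝ)) := by positivity
    nlinarith [mul_le_mul_of_nonneg_right hM this]

theorem Reg.amp_ds {a₀ : ℂ} {α : ℤ → ℂ} {θ : ℤ → ℝ} {k : ℕ} {s : ℤ} (h : Reg a₀ α θ k s) :
    ∃ C, 0 ≤ C ∧ ∀ a b, ∃ A, IsW 0 A C ∧ ∀ ξ, 0 < Real.sin ξ →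
      ((rho a₀ * Real.sin ξ / sdisp (rho a₀) ξ : ℝ) : ℂ) * ds a₀ α θ (bc (rho a₀) s ξ) a b = A ξ := by
  have hr0 := rho_pos h.dat0.lt_one
  have hr1 := rho_lt_one h.dat0.pos
  obtain ⟨C, hC, hg⟩ := h.amp_gk
  obtain ⟨M, hM⟩ := isW_sdisp 0 hr0 hr1
  obtain ⟨M', hM'⟩ := isW_inv_sdisp 0 hr0 hr1
  have hz : ∃ Z, IsW 0 (fun ξ => (bc (rho a₀) s ξ).1) Z := by
    have h1 := ((IsW.ncu 0).smul (rho a₀ : ℂ) (IsW.cos_pow 0 1)).add ((IsW.ncu 0).smul (I * s) hM)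
    refine ⟨_, h1.congr fun ξ => ?_⟩
    simp [bc]
  obtain ⟨Z, hZ⟩ := hz
  have hsin : IsW 0 (fun ξ => ((Real.sin ξ : ℝ) : ℂ)) 1 := by
    have h1 := (IsW.char (k := 0) (2 * I)⁻¹ 1).add (IsW.char (k := 0) (-(2 * I)⁻¹) (-1))
    refine (h1.mono ?_).congr fun ξ => ?_
    · norm_num
    · rw [ch_one_eq, ch_neg_one_eq]
      field_simp
      ring
  have hch : ∀ ξ, ch s ξ ^ 2 - 1 = 2 * I * s * Real.sin ξ * ch s ξ := fun ξ => by
    have h1 : ch 1 ξ * ch (-1) ξ = 1 := by rw [← ch_add]; simp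
    have h2 : ch 1 ξ - ch (-1) ξ = 2 * I * Real.sin ξ := by rw [ch_one_eq, ch_neg_one_eq]; ring
    rcases h.sign with rfl | rfl
    · push_cast [-ofReal_sin]; linear_combination ch 1 ξ * h2 + h1
    · push_cast [-ofReal_sin]; linear_combination (-ch (-1) ξ) * h2 + h1
  have hE : ∀ a b, ∃ E, IsW 0 E C ∧ ∀ ξ, 0 < Real.sin ξ →
      Real.sin ξ * gq a₀ α θ (bc (rho a₀) s ξ) a b = E ξ := fun a b => by
    obtain ⟨H, hH, hH2⟩ := hg b.1 b.2 a.1 a.2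
    refine ⟨_, ((hH.mul (IsW.char (k := 0) (-(I * s / 2)) (-s))).mono ?_), fun ξ hξ => ?_⟩
    · have h1 : ‖(s : ℂ)‖ = 1 := by rcases h.sign with rfl | rfl <;> simp
      have h2 : ‖-(I * (s : ℂ) / 2)‖ = 1 / 2 := by
        rw [norm_neg, norm_div, norm_mul, h1]; simp
      rw [h2]; norm_num; linarith
    · have hW := h.Wr_ne_zero hξ
      have h1 : ch s ξ * ch (-s) ξ = 1 := by rw [← ch_add]; simp
      have h3 := hH2 ξ
      rw [hch] at h3
      have h4 := intCast_sq_of_sign h.sign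
      rw [gq, mul_div_assoc', div_eq_iff hW]
      linear_combination (I * s / 2) * ch (-s) ξ * h3 +
        (I ^ 2 * s ^ 2 * Real.sin ξ * gk a₀ α θ (bc (rho a₀) s ξ) b.1 b.2 a.1 a.2) * h1
        + (I ^ 2 * Real.sin ξ * gk a₀ α θ (bc (rho a₀) s ξ) b.1 b.2 a.1 a.2) * h4
        + Real.sin ξ * gk a₀ α θ (bc (rho a₀) s ξ) b.1 b.2 a.1 a.2 * I_sq
  have hZ0 := hZ.nonneg
  have hM0 := hM'.nonneg
  refine ⟨M' * (rho a₀ * (1 + Z * C + Z * C)), by positivity, fun a b => ?_⟩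
  obtain ⟨E, hE1, hE2⟩ := hE a b
  obtain ⟨E', hE1', hE2'⟩ := hE b a
  have hd : IsW 0 (fun ξ => inner ℂ (dl a) (dl b) * ((Real.sin ξ : ℝ) : ℂ)) 1 := by
    refine ((IsW.ncu 0).smul _ hsin).mono ?_
    rw [inner_dl, co_dl]
    split_ifs <;> simp
  have hA := hM'.mul ((IsW.ncu 0).smul (rho a₀ : ℂ) ((hd.add (hZ.mul hE1)).add (hZ.mul hE1').conj))
  refine ⟨_, hA.mono ?_, fun ξ hξ => ?_⟩
  · rw [Complex.norm_of_nonneg hr0.le]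
  · rw [← hE2 ξ hξ, ← hE2' ξ hξ, ds]
    simp only [map_mul, conj_ofReal]
    push_cast [-ofReal_sin]
    ring
end

section
open Filter Topology MeasureTheory Spec

theorem integral_disp {r : ℝ} (h0 : 0 < r) (h1 : r < 1) {g G : ℝ → ℂ} (hG : Continuous G)
    (h : ∀ ξ ∈ Set.Ioo 0 Real.pi, ((r * Real.sin ξ / sdisp r ξ : ℝ) : ℂ) * g (disp r ξ) = G ξ)
    (hz : ∀ φ ∈ Set.Icc 0 Real.pi, r ≤ |Real.cos φ| → g φ = 0) :
    IntervalIntegrable g volume 0 Real.pi ∧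
      ∫ φ in (0 : ℝ)..Real.pi, g φ = ∫ ξ in (0 : ℝ)..Real.pi, G ξ := by
  have hcos : ∀ ξ, Real.cos (disp r ξ) = r * Real.cos ξ := fun ξ => by
    have h2 := (abs_le_one_iff_mul_self_le_one).2 (by nlinarith [one_sub_sq_pos h0 h1 ξ] :
      (r * Real.cos ξ) * (r * Real.cos ξ) ≤ 1)
    exact Real.cos_arccos (abs_le.1 h2).1 (abs_le.1 h2).2
  have hinj : Set.InjOn (disp r) (Set.Ioo 0 Real.pi) := fun x hx y hy hxy => by
    have h2 := congrArg Real.cos hxy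
    rw [hcos, hcos] at h2
    exact Real.injOn_cos ⟨hx.1.le, hx.2.le⟩ ⟨hy.1.le, hy.2.le⟩ (mul_left_cancel₀ h0.ne' h2)
  have hsub : disp r '' Set.Ioo 0 Real.pi ⊆ Set.Ioc 0 Real.pi := by
    rintro _ ⟨ξ, _, rfl⟩
    refine ⟨Real.arccos_pos.2 ?_, Real.arccos_le_pi _⟩
    nlinarith [one_sub_sq_pos h0 h1 ξ]
  have hdiff : ∀ φ ∈ Set.Ioc 0 Real.pi \ disp r '' Set.Ioo 0 Real.pi, g φ = 0 := fun φ hφ => by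
    refine hz φ ⟨hφ.1.1.le, hφ.1.2⟩ (not_lt.1 fun hlt => hφ.2 ?_)
    obtain ⟨l1, l2⟩ := abs_lt.1 hlt
    refine ⟨Real.arccos (Real.cos φ / r), ⟨Real.arccos_pos.2 (by rw [div_lt_iff₀ h0]; linarith),
      lt_of_le_of_ne (Real.arccos_le_pi _) ?_⟩, ?_⟩
    · rw [Ne, Real.arccos_eq_pi, not_le, lt_div_iff₀ h0]; linarith
    · rw [disp, Real.cos_arccos (by rw [le_div_iff₀ h0]; linarith) (by rw [div_le_iff₀ h0]; linarith),
        mul_div_cancel₀ _ h0.ne', Real.arccos_cos hφ.1.1.le hφ.1.2]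
  have hd : ∀ x ∈ Set.Ioo 0 Real.pi, HasDerivWithinAt (disp r) (r * Real.sin x / sdisp r x)
      (Set.Ioo 0 Real.pi) x := fun x _ => (hasDerivAt_disp h0 h1 x).hasDerivWithinAt
  have hG2 : ∀ ξ ∈ Set.Ioo 0 Real.pi,
      G ξ = |r * Real.sin ξ / sdisp r ξ| • g (disp r ξ) := fun ξ hξ => by
    have := Real.sin_pos_of_mem_Ioo hξ
    have h3 := sdisp_pos h0 h1 ξ
    rw [← h ξ hξ, abs_of_nonneg (by positivity), real_smul]
  constructor
  · rw [intervalIntegrable_iff_integrableOn_Ioc_of_le Real.pi_pos.le]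
    refine IntegrableOn.of_forall_sdiff_eq_zero ?_ measurableSet_Ioc hdiff
    rw [integrableOn_image_iff_integrableOn_abs_deriv_smul measurableSet_Ioo hd hinj]
    refine IntegrableOn.congr_fun ?_ hG2 measurableSet_Ioo
    exact (hG.integrableOn_Icc).mono_set Set.Ioo_subset_Icc_self
  · rw [intervalIntegral.integral_of_le Real.pi_pos.le, intervalIntegral.integral_of_le Real.pi_pos.le,
      setIntegral_eq_of_subset_of_forall_sdiff_eq_zero measurableSet_Ioc hsub hdiff,
      integral_image_eq_integral_abs_deriv_smul measurableSet_Ioo hd hinj, integral_Ioc_eq_integral_Ioo]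
    exact (setIntegral_congr_fun measurableSet_Ioo hG2).symm

theorem coe_cpt_disp {r : ℝ} (h0 : 0 < r) (h1 : r < 1) {s : ℤ} (hs : s = 1 ∨ s = -1) (ξ : ℝ) :
    (cpt (s * disp r ξ) : ℂ) = (bc r s ξ).1 := by
  rw [coe_cpt, bc_fst_eq_exp h0 h1 hs, mul_comm]

theorem coe_cpt_re (φ : ℝ) : (cpt φ : ℂ).re = Real.cos φ := by
  rw [coe_cpt, exp_ofReal_mul_I_re]

theorem integral_symm {f : ℝ → ℂ} (h : IntervalIntegrable f volume 0 Real.pi)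
    (h' : IntervalIntegrable (fun φ => f (-φ)) volume 0 Real.pi) :
    ∫ φ in -Real.pi..Real.pi, f φ =
      (∫ φ in (0 : ℝ)..Real.pi, f φ) + ∫ φ in (0 : ℝ)..Real.pi, f (-φ) := by
  have h2 : IntervalIntegrable f volume (-Real.pi) 0 := by
    have := (IntervalIntegrable.iff_comp_neg (f := fun φ => f (-φ))).1 h'
    simpa using this.symm
  rw [← intervalIntegral.integral_add_adjacent_intervals h2 h, add_comm,
    intervalIntegral.integral_comp_neg (fun φ => f φ), neg_zero]

namespace IsQW
variable {a₀ : ℂ} {α : ℤ → ℂ} {θ : ℤ → ℝ} {U : Hsp ≃ₗᵢ[ℂ] Hsp}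

theorem fl_eq_integral (hU : IsQW α θ U) {k k' : ℕ} (hp : Reg a₀ α θ k 1) (hm : Reg a₀ α θ k' (-1))
    (a b : ℤ × Fin 2) {A B : ℝ → ℂ} (hAc : Continuous A) (hBc : Continuous B)
    (hA : ∀ ξ, 0 < Real.sin ξ → ((rho a₀ * Real.sin ξ / sdisp (rho a₀) ξ : ℝ) : ℂ) *
      ds a₀ α θ (bc (rho a₀) 1 ξ) a b = A ξ)
    (hB : ∀ ξ, 0 < Real.sin ξ → ((rho a₀ * Real.sin ξ / sdisp (rho a₀) ξ : ℝ) : ℂ) *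
      ds a₀ α θ (bc (rho a₀) (-1) ξ) a b = B ξ)
    {ψ : C(S1, ℂ)} (hψ : ∀ x ∈ tsupport ψ, |(x : ℂ).re| < rho a₀) :
    fl U (dl a) (dl b) ψ = ((2 * Real.pi : ℝ) : ℂ)⁻¹ *
      ((∫ ξ in (0 : ℝ)..Real.pi, ψ (cpt (disp (rho a₀) ξ)) * A ξ) +
        ∫ ξ in (0 : ℝ)..Real.pi, ψ (cpt (-disp (rho a₀) ξ)) * B ξ) := by
  have hr0 := rho_pos hp.dat0.lt_one
  have hr1 := rho_lt_one hp.dat0.pos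
  set D : ℝ → ℂ := fun φ => limUnder (𝓝[Metric.ball 0 1] (cpt φ : ℂ))
    (fun z => fl U (dl a) (dl b) (pk z)) with hD
  have hne : ∀ x : S1, (𝓝[Metric.ball 0 1] (x : ℂ)).NeBot := fun x => by
    rw [← mem_closure_iff_nhdsWithin_neBot, closure_ball _ one_ne_zero, mem_closedBall_zero_iff,
      norm_S1]
  have hlim : ∀ (k : ℕ) (s : ℤ), Reg a₀ α θ k s → ∀ ξ, 0 < Real.sin ξ →
      D (s * disp (rho a₀) ξ) = ds a₀ α θ (bc (rho a₀) s ξ) a b := fun k s hs ξ hξ => by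
    have h1 := hU.tendsto_fl_bulk hs hξ a b
    rw [← coe_cpt_disp hr0 hr1 hs.sign] at h1
    have := hne (cpt (s * disp (rho a₀) ξ))
    exact h1.limUnder_eq
  have hzero : ∀ φ : ℝ, rho a₀ ≤ |Real.cos φ| → ψ (cpt φ) * D φ = 0 := fun φ hφ => by
    have : ψ (cpt φ) = 0 := image_eq_zero_of_notMem_tsupport fun hx => by
      have := hψ _ hx
      rw [coe_cpt_re] at this
      linarith
    rw [this, zero_mul]
  have hd := continuous_disp hr0 hr1
  have hcpt := continuous_cpt
  obtain ⟨i1, e1⟩ := integral_disp hr0 hr1 (g := fun φ => ψ (cpt φ) * D φ)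
    (G := fun ξ => ψ (cpt (disp (rho a₀) ξ)) * A ξ) (by fun_prop) (fun ξ hξ => by
      have hs := Real.sin_pos_of_mem_Ioo hξ
      have h1 := hlim k 1 hp ξ hs
      rw [Int.cast_one, one_mul] at h1
      rw [← hA ξ hs, h1]; ring) fun φ _ => hzero φ
  obtain ⟨i2, e2⟩ := integral_disp hr0 hr1 (g := fun φ => ψ (cpt (-φ)) * D (-φ))
    (G := fun ξ => ψ (cpt (-disp (rho a₀) ξ)) * B ξ) (by fun_prop) (fun ξ hξ => by
      have hs := Real.sin_pos_of_mem_Ioo hξ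
      have h1 := hlim k' (-1) hm ξ hs
      rw [Int.cast_neg, Int.cast_one, neg_one_mul] at h1
      rw [← hB ξ hs, h1]; ring) fun φ _ hφ => hzero _ (by rwa [Real.cos_neg])
  rw [eq_integral_boundary (fl U (dl a) (dl b)) ψ D fun φ hφ => ?_, ← e1, ← e2,
    integral_symm (f := fun φ => ψ (cpt φ) * D φ) i1 i2]
  refine tendsto_nhds_limUnder ?_
  obtain ⟨s, hs, ξ, hξ, hx⟩ := exists_bc hr0 _ (hψ _ hφ)
  rw [hx]
  have h3 := Real.sin_pos_of_mem_Ioo hξ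
  rcases hs with rfl | rfl
  · exact ⟨_, hU.tendsto_fl_bulk hp h3 a b⟩
  · exact ⟨_, hU.tendsto_fl_bulk hm h3 a b⟩

theorem fl_bound (hU : IsQW α θ U) {k k' : ℕ} (hp : Reg a₀ α θ k 1) (hm : Reg a₀ α θ k' (-1)) :
    ∃ C : ℝ, 0 ≤ C ∧ ∀ (t : ℤ) (a b : ℤ × Fin 2) (χ : ℕ → C(S1, ℂ)),
      (∀ n, ∀ x ∈ tsupport (χ n), |(x : ℂ).re| < rho a₀) → (∀ n x, ‖χ n x‖ ≤ 1) →
      (∀ x : S1, |(x : ℂ).re| < rho a₀ → Tendsto (fun n => χ n x) atTop (𝓝 1)) →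
      ∃ L : ℂ, Tendsto (fun n => fl U (dl a) (dl b) (χ n * zc t)) atTop (𝓝 L) ∧
        ‖L‖ ≤ C * (1 + |(t : ℝ)|) ^ (-(1 / 3 : ℝ)) := by
  have hr0 := rho_pos hp.dat0.lt_one
  have hr1 := rho_lt_one hp.dat0.pos
  obtain ⟨Q, hQ, hosc⟩ := osc_isW hr0 hr1
  obtain ⟨M, hM, hA⟩ := hp.amp_ds
  obtain ⟨M', hM', hB⟩ := hm.amp_ds
  have hd := continuous_disp hr0 hr1
  have hcpt := continuous_cpt
  refine ⟨(2 * Real.pi)⁻¹ * (Q * M + Q * M'), by positivity, fun t a b χ hs hb hl => ?_⟩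
  obtain ⟨A, hA1, hA2⟩ := hA a b
  obtain ⟨B, hB1, hB2⟩ := hB a b
  have lim : ∀ (s : ℤ) (F : ℝ → ℂ) (K : ℝ), (s = 1 ∨ s = -1) → IsW 0 F K → Tendsto (fun n =>
      ∫ ξ in (0 : ℝ)..Real.pi, (χ n * zc t) (cpt (s * disp (rho a₀) ξ)) * F ξ) atTop
      (𝓝 (∫ ξ in (0 : ℝ)..Real.pi, Complex.exp (I * (((t * s : ℤ) * disp (rho a₀) ξ : ℝ) : ℂ)) * F ξ)) :=
    fun s F K hs' hF => by
    have hFc := hF.continuous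
    refine intervalIntegral.tendsto_integral_filter_of_dominated_convergence (fun _ => K)
      (.of_forall fun n => Continuous.aestronglyMeasurable (by fun_prop))
      (.of_forall fun n => .of_forall fun ξ _ => ?_) intervalIntegrable_const ?_
    · rw [ContinuousMap.mul_apply, zc_apply, norm_mul, norm_mul, norm_zpow, norm_S1, _root_.one_zpow, mul_one]
      calc _ ≤ 1 * K := mul_le_mul (hb _ _) (hF.bound ξ) (norm_nonneg _) zero_le_one
        _ = K := one_mul K
    · filter_upwards [compl_mem_ae_iff.2 (measure_singleton Real.pi)] with ξ hπ hξ
      rw [Set.uIoc_of_le Real.pi_pos.le] at hξ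
      have hs := Real.sin_pos_of_mem_Ioo ⟨hξ.1, lt_of_le_of_ne hξ.2 hπ⟩
      have h1 : Complex.exp (I * (((t * s : ℤ) * disp (rho a₀) ξ : ℝ) : ℂ)) =
          1 * zc t (cpt (s * disp (rho a₀) ξ)) := by
        rw [one_mul, zc_apply, coe_cpt, ← Complex.exp_int_mul]
        congr 1
        push_cast
        ring
      rw [h1]
      refine ((hl _ ?_).mul_const _).mul_const _
      rw [coe_cpt_disp hr0 hr1 hs', bc]
      have h2 : |Real.cos ξ| < 1 := (sq_lt_one_iff_abs_lt_one _).1 (by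
        nlinarith [Real.sin_sq_add_cos_sq ξ])
      have h3 : ((rho a₀ : ℂ) * Real.cos ξ + I * s * sdisp (rho a₀) ξ).re = rho a₀ * Real.cos ξ := by
        simp [-ofReal_cos]
      rw [h3, abs_mul, abs_of_pos hr0]
      nlinarith
  have lp := lim 1 A M (.inl rfl) hA1
  have lm := lim (-1) B M' (.inr rfl) hB1
  simp only [Int.cast_one, one_mul, Int.cast_neg, neg_mul] at lp lm
  refine ⟨_, ((lp.add lm).const_mul (((2 * Real.pi : ℝ) : ℂ)⁻¹)).congr fun n => ?_, ?_⟩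
  · refine (hU.fl_eq_integral hp hm a b hA1.continuous hB1.continuous hA2 hB2 fun x hx => ?_).symm
    exact hs n x (closure_mono (Function.support_mul_subset_left _ _) hx)
  · have b1 := hosc (t * 1) A M hA1
    have b2 := hosc (t * (-1)) B M' hB1
    have e1 : |((t * 1 : ℤ) : ℝ)| = |(t : ℝ)| := by simp
    have e2 : |((t * -1 : ℤ) : ℝ)| = |(t : ℝ)| := by simp
    rw [e1] at b1
    rw [e2] at b2
    rw [norm_mul, norm_inv, Complex.norm_of_nonneg (by positivity : (0 : ℝ) ≤ 2 * Real.pi), mul_assoc,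
      add_mul]
    gcongr
    exact (norm_add_le _ _).trans (add_le_add b1 b2)

end IsQW
end

section
open Filter Topology Spec

/-- A continuous cutoff of the open set `|re x| < r` of the circle. -/
def cutoff (r : ℝ) (n : ℕ) : C(S1, ℂ) :=
  toC ⟨fun x => max 0 (min 1 (n * (r - |(x : ℂ).re|) - 1)), by fun_prop⟩

theorem cutoff_apply (r : ℝ) (n : ℕ) (x : S1) :
    cutoff r n x = ((max 0 (min 1 (n * (r - |(x : ℂ).re|) - 1)) : ℝ) : ℂ) := rfl

theorem norm_cutoff_le (r : ℝ) (n : ℕ) (x : S1) : ‖cutoff r n x‖ ≤ 1 := by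
  rw [cutoff_apply, Complex.norm_of_nonneg (le_max_left _ _)]
  exact max_le zero_le_one (min_le_left _ _)

theorem norm_cutoff_sub_one_le (r : ℝ) (n : ℕ) (x : S1) : ‖cutoff r n x - 1‖ ≤ 1 := by
  rw [cutoff_apply, ← ofReal_one, ← ofReal_sub, norm_real, Real.norm_eq_abs, abs_le]
  have h1 := le_max_left 0 (min 1 (n * (r - |(x : ℂ).re|) - 1))
  have h2 : max 0 (min 1 (n * (r - |(x : ℂ).re|) - 1)) ≤ 1 := max_le zero_le_one (min_le_left _ _)
  constructor <;> linarith

theorem tsupport_cutoff (r : ℝ) (n : ℕ) : ∀ x ∈ tsupport (cutoff r n), |(x : ℂ).re| < r := by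
  have hc : IsClosed {x : S1 | 1 ≤ n * (r - |(x : ℂ).re|)} :=
    isClosed_le continuous_const (by fun_prop)
  intro x hx
  have h1 : x ∈ {x : S1 | 1 ≤ n * (r - |(x : ℂ).re|)} := by
    refine closure_minimal (fun y hy => ?_) hc hx
    by_contra hlt
    rw [Set.mem_ofPred_eq, not_le] at hlt
    refine hy ?_
    rw [cutoff_apply, max_eq_left, ofReal_zero]
    exact (min_le_right _ _).trans (by linarith)
  rw [Set.mem_ofPred_eq] at h1
  by_contra hlt
  have h2 : (0 : ℝ) ≤ n := n.cast_nonneg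
  nlinarith

theorem tendsto_cutoff {r : ℝ} (x : S1) (hx : |(x : ℂ).re| < r) :
    Tendsto (fun n => cutoff r n x) atTop (𝓝 1) := by
  have h1 : Tendsto (fun n : ℕ => (n : ℝ) * (r - |(x : ℂ).re|)) atTop atTop :=
    tendsto_natCast_atTop_atTop.atTop_mul_const (by linarith)
  refine tendsto_const_nhds.congr' ?_
  filter_upwards [h1.eventually_ge_atTop 2] with n hn
  rw [cutoff_apply, min_eq_left (by linarith), max_eq_right zero_le_one, ofReal_one]

theorem countable_edge (r : ℝ) : {x : S1 | |(x : ℂ).re| = r}.Countable := by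
  have h1 : Set.Countable ((fun p : ℝ × ℝ => (p.1 + p.2 * I : ℂ)) ''
      ({r, -r} ×ˢ {√(1 - r ^ 2), -√(1 - r ^ 2)})) :=
    ((Set.toFinite _).image _).countable
  refine (h1.preimage Subtype.val_injective).mono fun x hx => ?_
  rw [Set.mem_ofPred_eq] at hx
  refine ⟨((x : ℂ).re, (x : ℂ).im), ⟨?_, ?_⟩, re_add_im _⟩
  · rcases abs_choice (x : ℂ).re with h | h
    · left; change (x : ℂ).re = r; linarith
    · right; change (x : ℂ).re = -r; linarith
  · have h2 : √(1 - r ^ 2) = |(x : ℂ).im| := by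
      rw [← hx, sq_abs, ← Real.sqrt_sq_eq_abs]
      congr 1
      have h2 := Complex.sq_norm (x : ℂ)
      rw [norm_S1, normSq_apply] at h2
      nlinarith
    rw [h2]
    exact eq_or_eq_neg_of_abs_eq rfl

namespace Spec

theorem norm_eigenvalue {H : Type*} [NormedAddCommGroup H] [InnerProductSpace ℂ H]
    {U : H ≃ₗᵢ[ℂ] H} {φ : H} (h0 : φ ≠ 0) {w : ℂ} (h : U φ = w • φ) : ‖w‖ = 1 := by
  have h1 := U.norm_map φ
  rw [h, norm_smul] at h1
  exact mul_right_cancel₀ (norm_ne_zero_iff.2 h0) (h1.trans (one_mul _).symm)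

theorem inner_eigen {H : Type*} [NormedAddCommGroup H] [InnerProductSpace ℂ H]
    {U : H ≃ₗᵢ[ℂ] H} {φ ψ : H} {x y : S1} (hxy : x ≠ y) (hφ : U φ = (x : ℂ) • φ)
    (hψ : U ψ = (y : ℂ) • ψ) : inner ℂ φ ψ = 0 := by
  have h1 : inner ℂ (U φ) (U ψ) = inner ℂ φ ψ := U.inner_map_map _ _
  rw [hφ, hψ, inner_smul_left, inner_smul_right, ← mul_assoc] at h1
  by_contra h0
  have h2 := mul_right_cancel₀ h0 (h1.trans (one_mul _).symm)
  have h3 := S1_mul_conj x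
  refine hxy (Subtype.ext ?_)
  linear_combination (-(x : ℂ)) * h2 + (y : ℂ) * h3

theorem countable_eigenvalues (U : Hsp ≃ₗᵢ[ℂ] Hsp) :
    {x : S1 | ∃ φ : Hsp, φ ≠ 0 ∧ U φ = (x : ℂ) • φ}.Countable := by
  set E := {x : S1 | ∃ φ : Hsp, φ ≠ 0 ∧ U φ = (x : ℂ) • φ} with hE
  have hv : ∀ x : E, ∃ v : Hsp, ‖v‖ = 1 ∧ U v = (x : ℂ) • v := fun x => by
    obtain ⟨φ, h0, h1⟩ := x.2
    refine ⟨((‖φ‖⁻¹ : ℝ) : ℂ) • φ, ?_, ?_⟩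
    · rw [norm_smul, norm_real, norm_inv, norm_norm, inv_mul_cancel₀ (norm_ne_zero_iff.2 h0)]
    · rw [map_smul, h1, smul_comm]
  choose v hv1 hv2 using hv
  have ho : Orthonormal ℂ v :=
    ⟨hv1, fun x y hxy => inner_eigen (fun h => hxy (Subtype.ext h)) (hv2 x) (hv2 y)⟩
  rw [← Set.countable_coe_iff, ← Set.countable_univ_iff]
  refine (Set.countable_iUnion fun a : ℤ × Fin 2 =>
    (ho.inner_products_summable (x := dl a)).countable_support).mono fun x _ => ?_
  rw [Set.mem_iUnion]
  by_contra! hc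
  have h0 : v x = 0 := eq_zero_of_inner_dl fun a => by
    have := hc a
    rw [Function.mem_support, not_not, sq_eq_zero_iff, norm_eq_zero] at this
    rw [← inner_conj_symm, this, map_zero]
  have := hv1 x
  rw [h0, norm_zero] at this
  exact zero_ne_one this

theorem fc_eq_zero_of_mem {H : Type*} [NormedAddCommGroup H] [InnerProductSpace ℂ H] [CompleteSpace H]
    {U : H ≃ₗᵢ[ℂ] H} {ψ : C(S1, ℂ)}
    (hψ : ∀ (x : S1) (φ : H), φ ≠ 0 → U φ = (x : ℂ) • φ → ψ x = 0) {v : H}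
    (hv : v ∈ (Submodule.span ℂ {u : H | u ≠ 0 ∧ ∃ w : ℂ, U u = w • u}).topologicalClosure) :
    fc U ψ v = 0 := by
  have h1 : (Submodule.span ℂ {u : H | u ≠ 0 ∧ ∃ w : ℂ, U u = w • u}).topologicalClosure ≤
      LinearMap.ker (fc U ψ).toLinearMap := by
    refine Submodule.topologicalClosure_minimal _ (Submodule.span_le.2 ?_) (fc U ψ).isClosed_ker
    rintro u ⟨h0, w, hw⟩
    have hw1 := norm_eigenvalue h0 hw
    change fc U ψ u = 0
    have hx : U u = ((⟨w, by simpa using hw1⟩ : S1) : ℂ) • u := hw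
    rw [fc_eigen U hx, hψ _ u h0 hx, zero_smul]
  exact h1 hv

end Spec

namespace IsQW
variable {a₀ : ℂ} {α : ℤ → ℂ} {θ : ℤ → ℝ} {U : Hsp ≃ₗᵢ[ℂ] Hsp}

theorem no_bulk_eigen (hU : IsQW α θ U) {k k' : ℕ} (hp : Reg a₀ α θ k 1) (hm : Reg a₀ α θ k' (-1))
    {x : S1} (hx : |(x : ℂ).re| < rho a₀) {φ : Hsp} (hφ : U φ = (x : ℂ) • φ) : φ = 0 := by
  obtain ⟨s, hs, ξ, hξ, hxe⟩ := exists_bc (rho_pos hp.dat0.lt_one) x hx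
  have h3 := Real.sin_pos_of_mem_Ioo hξ
  have hlim : ∀ a, ∃ d, Tendsto (fun z => fl U (dl a) (dl a) (pk z)) (𝓝[Metric.ball 0 1] (x : ℂ))
      (𝓝 d) := fun a => by
    rw [hxe]
    rcases hs with rfl | rfl
    · exact ⟨_, hU.tendsto_fl_bulk hp h3 a a⟩
    · exact ⟨_, hU.tendsto_fl_bulk hm h3 a a⟩
  refine eq_zero_of_inner_dl fun a => ?_
  obtain ⟨d, hd⟩ := hlim a
  rw [← inner_conj_symm, Spec.eq_zero_of_bounded U (norm_S1 x) hφ hd, map_zero]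

theorem tendsto_cutoff (hU : IsQW α θ U) {k : ℕ} (hp : Reg a₀ α θ k 1) {g : Hsp}
    (hg : ∀ (φ : Hsp) (w : ℂ), U φ = w • φ → inner ℂ φ g = 0) :
    Tendsto (fun n => fc U (cutoff (rho a₀) n) g) atTop (𝓝 g) := by
  refine tendsto_fc U hg (B := {x | |(x : ℂ).re| < rho a₀})
    ((countable_edge (rho a₀)).union (countable_eigenvalues U)) (fun x hx => ?_) _
    (norm_cutoff_sub_one_le _) fun x hx => _root_.tendsto_cutoff x hx
  rw [Set.mem_ofPred_eq, not_lt] at hx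
  by_cases he : x ∈ {x : S1 | |(x : ℂ).re| = rho a₀} ∪
      {x : S1 | ∃ φ : Hsp, φ ≠ 0 ∧ U φ = (x : ℂ) • φ}
  · exact .inl he
  · rw [Set.mem_union, not_or] at he
    obtain ⟨χ, h1, h2⟩ := hU.gap hp.dat0 x (lt_of_le_of_ne hx fun h => he.1 h.symm)
      fun φ hφ => by_contra fun h0 => he.2 ⟨φ, h0, hφ⟩
    exact .inr ⟨χ, h1, by rw [h2]; rfl⟩

theorem fl_dl_bound (hU : IsQW α θ U) {k k' : ℕ} (hp : Reg a₀ α θ k 1) (hm : Reg a₀ α θ k' (-1)) :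
    ∃ C : ℝ, 0 ≤ C ∧ ∀ (t : ℤ) (u₀ pc : Hsp),
      (Summable fun x : ℤ => ‖(u₀ : ∀ _ : ℤ, EuclideanSpace ℂ (Fin 2)) x‖) →
      pc ∈ (Submodule.span ℂ {u : Hsp | u ≠ 0 ∧ ∃ w : ℂ, U u = w • u}).topologicalClosureᗮ →
      u₀ - pc ∈ (Submodule.span ℂ {u : Hsp | u ≠ 0 ∧ ∃ w : ℂ, U u = w • u}).topologicalClosure →
      ∀ a, ‖co ((U ^ t) pc) a‖ ≤ C * (1 + |(t : ℝ)|) ^ (-(1 / 3 : ℝ)) *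
        ∑' x : ℤ, ‖(u₀ : ∀ _ : ℤ, EuclideanSpace ℂ (Fin 2)) x‖ := by
  obtain ⟨C, hC, hb⟩ := hU.fl_bound hp hm
  refine ⟨2 * C, by positivity, fun t u₀ pc hs hpc hd a => ?_⟩
  set ψ : ℕ → C(S1, ℂ) := fun n => cutoff (rho a₀) n * zc t with hψ
  set ε := C * (1 + |(t : ℝ)|) ^ (-(1 / 3 : ℝ)) with hε
  have hε0 : 0 ≤ ε := by positivity
  have hg : ∀ (φ : Hsp) (w : ℂ), U φ = w • φ → inner ℂ φ pc = 0 := fun φ w hφ => by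
    by_cases h0 : φ = 0
    · rw [h0, inner_zero_left]
    · exact hpc φ (Submodule.le_topologicalClosure _ (Submodule.subset_span ⟨h0, w, hφ⟩))
  have hψn : ∀ n x, ‖ψ n x‖ ≤ 1 := fun n x => by
    rw [hψ, ContinuousMap.mul_apply, zc_apply, norm_mul, norm_zpow, norm_S1, _root_.one_zpow, mul_one]
    exact norm_cutoff_le _ _ _
  have hkill : ∀ n, fc U (ψ n) (u₀ - pc) = 0 := fun n => by
    refine fc_eq_zero_of_mem (fun x φ h0 hφ => ?_) hd
    have : cutoff (rho a₀) n x = 0 := image_eq_zero_of_notMem_tsupport fun hx =>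
      h0 (hU.no_bulk_eigen hp hm (tsupport_cutoff _ _ _ hx) hφ)
    rw [hψ, ContinuousMap.mul_apply, this, zero_mul]
  have hlim : Tendsto (fun n => fl U (dl a) u₀ (ψ n)) atTop (𝓝 (co ((U ^ t) pc) a)) := by
    have h1 := ((fc U (zc t)).continuous.tendsto pc).comp (hU.tendsto_cutoff hp hg)
    have h2 := (tendsto_const_nhds (x := dl a)).inner (𝕜 := ℂ) h1
    rw [fc_zc, inner_dl] at h2
    refine h2.congr fun n => ?_
    have h3 := hkill n
    rw [map_sub, sub_eq_zero] at h3
    rw [fl_apply, h3, hψ]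
    simp only [Function.comp]
    rw [← fc_mul_apply, mul_comm]
  have hle : ∀ x j, ‖co u₀ (x, j)‖ ≤ ‖(u₀ : ∀ _ : ℤ, EuclideanSpace ℂ (Fin 2)) x‖ :=
    fun x j => PiLp.norm_apply_le _ j
  choose L hL1 hL2 using fun b => hb t a b (cutoff (rho a₀)) (tsupport_cutoff _) (norm_cutoff_le _)
    fun x hx => _root_.tendsto_cutoff x hx
  have hsum : ∀ n, fl U (dl a) u₀ (ψ n) =
      ∑' x : ℤ, ∑ j, co u₀ (x, j) * fl U (dl a) (dl (x, j)) (ψ n) := fun n => by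
    have h1 := ((hasSum_dl u₀).mapL (fc U (ψ n))).mapL (innerSL ℂ (dl a))
    rw [fl_apply]
    refine h1.tsum_eq.symm.trans (tsum_congr fun x => ?_)
    simp [fl_apply, inner_add_right, inner_smul_right]
  have hfl : ∀ b n, ‖fl U (dl a) (dl b) (ψ n)‖ ≤ 1 := fun b n => by
    have h1 : ∀ b, ‖dl b‖ = 1 := fun b => by
      rw [norm_eq_sqrt_re_inner (𝕜 := ℂ), norm_dl]; simp
    have h2 : ‖fc U (ψ n)‖ ≤ 1 := (NonUnitalStarAlgHom.norm_apply_le (fc U) (ψ n)).trans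
      ((ContinuousMap.norm_le _ zero_le_one).2 (hψn n))
    refine (norm_inner_le_norm (𝕜 := ℂ) (dl a) (fc U (ψ n) (dl b))).trans ?_
    rw [h1, one_mul]
    refine ((fc U (ψ n)).le_opNorm _).trans ?_
    rwa [h1, mul_one]
  have hlim2 : Tendsto (fun n => fl U (dl a) u₀ (ψ n)) atTop
      (𝓝 (∑' x : ℤ, ∑ j, co u₀ (x, j) * L (x, j))) := by
    simp only [hsum]
    refine tendsto_tsum_of_dominated_convergence (bound := fun x =>
      2 * ‖(u₀ : ∀ _ : ℤ, EuclideanSpace ℂ (Fin 2)) x‖) (hs.mul_left 2) (fun x => ?_)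
      (.of_forall fun n x => ?_)
    · exact tendsto_finsetSum _ fun j _ => (hL1 (x, j)).const_mul _
    · rw [Fin.sum_univ_two, two_mul]
      refine (norm_add_le _ _).trans (add_le_add ?_ ?_) <;>
      · rw [norm_mul]
        exact (mul_le_of_le_one_right (norm_nonneg _) (hfl _ n)).trans (hle _ _)
  rw [tendsto_nhds_unique hlim hlim2]
  refine (tsum_of_norm_bounded (g := fun x => 2 * ε * ‖(u₀ : ∀ _ : ℤ, EuclideanSpace ℂ (Fin 2)) x‖)
    (hs.hasSum.mul_left _) fun x => ?_).trans_eq (by rw [hε]; ring)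
  rw [Fin.sum_univ_two, two_mul, add_mul]
  refine (norm_add_le _ _).trans (add_le_add ?_ ?_) <;>
  · rw [norm_mul, mul_comm]
    exact mul_le_mul (hL2 _) (hle _ _) (norm_nonneg _) hε0

end IsQW
end

/-- the dispersive estimate
`sup_x ‖(U^t P_c u₀)(x)‖ ≤ C(1+|t|)^{−1/3} Σ_x ‖u₀(x)‖` for `t ∈ ℤ`, where `P_c` is the
orthogonal projection onto the orthogonal complement of the closed span of all
eigenvectors of `U` (so `P_c u₀` is the unique `pc ∈ Kᗮ` with `u₀ − pc ∈ K`, `K` the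
closed span). -/
theorem stmt19 (α₀ : ℂ) (h₀ : 0 < ‖α₀‖) (h₁ : ‖α₀‖ < 1)
    (α : ℤ → ℂ) (θ : ℤ → ℝ) (hα : ∀ x : ℤ, ‖α x‖ < 1)
    (hsum :
      (Generic α₀ α θ ∧ Summable fun x : ℤ => jp x * (‖α x - α₀‖ + |θ x|)) ∨
      (¬ Generic α₀ α θ ∧ Summable fun x : ℤ => jp x ^ 2 * (‖α x - α₀‖ + |θ x|)))
    (Uop : Hsp ≃ₗᵢ[ℂ] Hsp)
    (hU : ∀ u : Hsp, ∀ x : ℤ, ∀ i : Fin 2,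
      (Uop u : ∀ _ : ℤ, EuclideanSpace ℂ (Fin 2)) x i
        = qw (coinOf α θ)
            (fun y : ℤ => fun j : Fin 2 => (u : ∀ _ : ℤ, EuclideanSpace ℂ (Fin 2)) y j) x i) :
    ∃ C : ℝ, 0 < C ∧
      ∀ t : ℤ, ∀ u₀ pc : Hsp,
        (Summable fun x : ℤ => ‖(u₀ : ∀ _ : ℤ, EuclideanSpace ℂ (Fin 2)) x‖) →
        pc ∈ (Submodule.span ℂ
            {u : Hsp | u ≠ 0 ∧ ∃ w : ℂ, Uop u = w • u}).topologicalClosureᗮ →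
        u₀ - pc ∈ (Submodule.span ℂ
            {u : Hsp | u ≠ 0 ∧ ∃ w : ℂ, Uop u = w • u}).topologicalClosure →
        ∀ x : ℤ,
          ‖((Uop ^ t) pc : ∀ _ : ℤ, EuclideanSpace ℂ (Fin 2)) x‖
            ≤ C * (1 + |(t : ℝ)|) ^ (-(1 / 3 : ℝ)) *
                ∑' x : ℤ, ‖(u₀ : ∀ _ : ℤ, EuclideanSpace ℂ (Fin 2)) x‖ := by
  have hW : IsQW α θ Uop := hU
  obtain ⟨k, hp⟩ := Reg.of_hyp h₀ h₁ hα hsum (.inl rfl)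
  obtain ⟨k', hm⟩ := Reg.of_hyp h₀ h₁ hα hsum (.inr rfl)
  obtain ⟨C, hC, hb⟩ := hW.fl_dl_bound hp hm
  refine ⟨2 * C + 1, by positivity, fun t u₀ pc hs hpc hd x => ?_⟩
  have h1 := hb t u₀ pc hs hpc hd
  have h2 : ‖((Uop ^ t) pc : ∀ _ : ℤ, EuclideanSpace ℂ (Fin 2)) x‖ ≤
      ‖co ((Uop ^ t) pc) (x, 0)‖ + ‖co ((Uop ^ t) pc) (x, 1)‖ := by
    rw [EuclideanSpace.norm_eq, Fin.sum_univ_two]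
    refine Real.sqrt_le_iff.2 ⟨by positivity, ?_⟩
    have h3 := norm_nonneg (co ((Uop ^ t) pc) (x, 0))
    have h4 := norm_nonneg (co ((Uop ^ t) pc) (x, 1))
    simp only [co] at h3 h4 ⊢
    nlinarith
  have h5 : 0 ≤ (1 + |(t : ℝ)|) ^ (-(1 / 3 : ℝ)) *
      ∑' x : ℤ, ‖(u₀ : ∀ _ : ℤ, EuclideanSpace ℂ (Fin 2)) x‖ :=
    mul_nonneg (by positivity) (tsum_nonneg fun _ => norm_nonneg _)
  linarith [h1 (x, 0), h1 (x, 1)]
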